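/- If G is a minimal counterexample, then G is 3-regular, has at least 10 vertices, contains no cycle of length at most 6 (girth at least 7), has no cut-edge, and has no edge-cut of size two. -/

import Mathlib

open SimpleGraph

/-- A `(1,2^k)`-packing edge-coloring encoded as a function assigning a color in
`Fin (k+1)` to each unordered pair. Color `0` is the 1-color (its class must be a
matching) and each color `i ≠ 0` is a 2-color (its class must be an induced matching). -/
def IsPackingEC {V : Type} (G : SimpleGraph V) (k : ℕ)
    (c : Sym2 V → Fin (k + 1)) : Prop :=
  (∀ a b x y : V, G.Adj a b → G.Adj x y → s(a, b) ≠ s(x, y) →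
      c s(a, b) = 0 → c s(x, y) = 0 →
      a ≠ x ∧ a ≠ y ∧ b ≠ x ∧ b ≠ y) ∧
  ∀ a b x y : V, G.Adj a b → G.Adj x y → s(a, b) ≠ s(x, y) →
      c s(a, b) = c s(x, y) → c s(a, b) ≠ 0 →
      (a ≠ x ∧ a ≠ y ∧ b ≠ x ∧ b ≠ y) ∧
      ¬G.Adj a x ∧ ¬G.Adj a y ∧ ¬G.Adj b x ∧ ¬G.Adj b y

/-- A good coloring: a `(1,2^7)`-packing edge-coloring in which every edge of the
1-color class (color `0`) has both endpoints of degree 3. -/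
def GoodColoring {V : Type} (G : SimpleGraph V) (c : Sym2 V → Fin 8) : Prop :=
  IsPackingEC G 7 c ∧
  ∀ a b : V, G.Adj a b → c s(a, b) = 0 →
    (G.neighborSet a).ncard = 3 ∧ (G.neighborSet b).ncard = 3

/-- A graph is subcubic if every vertex has degree at most 3. -/
def Subcubic {V : Type} (G : SimpleGraph V) : Prop :=
  ∀ v : V, (G.neighborSet v).ncard ≤ 3

/-- A minimal counterexample: a finite subcubic simple graph with no good coloring such
that every finite subcubic simple graph with smaller `|V| + |E|` has a good coloring. -/
def MinCounter (V : Type) [Finite V] (G : SimpleGraph V) : Prop :=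
  Subcubic G ∧
  (¬∃ c : Sym2 V → Fin 8, GoodColoring G c) ∧
  ∀ (W : Type) [Finite W] (H : SimpleGraph W), Subcubic H →
    Nat.card W + H.edgeSet.ncard < Nat.card V + G.edgeSet.ncard →
    ∃ c : Sym2 W → Fin 8, GoodColoring H c

set_option linter.unusedSectionVars false

section Core
open Classical

variable {V : Type}

/-- Two edges share a vertex or are joined by an edge. -/
def Near (G : SimpleGraph V) (e f : Sym2 V) : Prop :=
  ∃ x ∈ e, ∃ y ∈ f, x = y ∨ G.Adj x y

/-- Colours `k` on `e` and `l` on `f` may coexist in a packing edge-coloring. -/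
def Compat (G : SimpleGraph V) (e : Sym2 V) (k : Fin 8) (f : Sym2 V) (l : Fin 8) : Prop :=
  (k = 0 → l = 0 → ∀ x ∈ e, x ∉ f) ∧ (k = l → k ≠ 0 → ¬ Near G e f)

/-- The vertex has degree three. -/
def V3 (G : SimpleGraph V) (x : V) : Prop := (G.neighborSet x).ncard = 3

/-- `c` restricted to the edge set `D` is a good partial coloring of `G`. -/
structure PG (G : SimpleGraph V) (D : Set (Sym2 V)) (c : Sym2 V → Fin 8) : Prop where
  sub : D ⊆ G.edgeSet
  zdeg : ∀ e ∈ D, c e = 0 → ∀ x ∈ e, V3 G x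
  compat : ∀ e ∈ D, ∀ f ∈ D, e ≠ f → Compat G e (c e) f (c f)

/-- Nonzero colours appearing on edges of `D` at `z`. -/
noncomputable def K (D : Set (Sym2 V)) (c : Sym2 V → Fin 8) (z : V) : Finset (Fin 8) :=
  Finset.univ.filter fun k => k ≠ 0 ∧ ∃ e ∈ D, z ∈ e ∧ c e = k

/-- Some edge of `D` at `z` has colour zero. -/
def HasZero (D : Set (Sym2 V)) (c : Sym2 V → Fin 8) (z : V) : Prop :=
  ∃ e ∈ D, z ∈ e ∧ c e = 0

lemma Near.symm {G : SimpleGraph V} {e f : Sym2 V} (h : Near G e f) : Near G f e := by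
  obtain ⟨x, hx, y, hy, h⟩ := h
  exact ⟨y, hy, x, hx, h.imp Eq.symm fun h => h.symm⟩

lemma Compat.symm {G : SimpleGraph V} {e f : Sym2 V} {k l : Fin 8} (h : Compat G e k f l) :
    Compat G f l e k :=
  ⟨fun a b x hx hx' => h.1 b a x hx' hx, fun a b n => h.2 a.symm (a ▸ b) n.symm⟩

lemma compat_of_ne {G : SimpleGraph V} {e f : Sym2 V} {k l : Fin 8} (h : k ≠ l) :
    Compat G e k f l :=
  ⟨fun a b => (h (a.trans b.symm)).elim, fun a => (h a).elim⟩

lemma compat_of_not_near {G : SimpleGraph V} {e f : Sym2 V} {k l : Fin 8} (h : ¬ Near G e f) :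
    Compat G e k f l :=
  ⟨fun _ _ x hx hx' => h ⟨x, hx, x, hx', Or.inl rfl⟩, fun _ _ => h⟩

lemma mem_K {D : Set (Sym2 V)} {c : Sym2 V → Fin 8} {z : V} {k : Fin 8} :
    k ∈ K D c z ↔ k ≠ 0 ∧ ∃ e ∈ D, z ∈ e ∧ c e = k := by
  simp [K]

lemma zero_notMem_K {D : Set (Sym2 V)} {c : Sym2 V → Fin 8} {z : V} : (0 : Fin 8) ∉ K D c z := by
  simp [mem_K]

lemma good_of_PG {G : SimpleGraph V} {D : Set (Sym2 V)} {c : Sym2 V → Fin 8} (h : PG G D c)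
    (hD : G.edgeSet ⊆ D) : GoodColoring G c := by
  refine ⟨⟨?_, ?_⟩, ?_⟩
  · intro a b x y hab hxy hne h1 h2
    have := (h.compat _ (hD hab) _ (hD hxy) hne).1 h1 h2
    have ha := this a (by simp)
    have hb := this b (by simp)
    simp at ha hb
    tauto
  · intro a b x y hab hxy hne h1 h2
    have := (h.compat _ (hD hab) _ (hD hxy) hne).2 h1 h2
    simp only [Near, Sym2.mem_iff] at this
    push Not at this
    have ha := this a (Or.inl rfl)
    have hb := this b (Or.inr rfl)
    have := ha x (Or.inl rfl)
    have := ha y (Or.inr rfl)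
    have := hb x (Or.inl rfl)
    have := hb y (Or.inr rfl)
    tauto
  · intro a b hab h0
    exact ⟨h.zdeg _ (hD hab) h0 a (by simp), h.zdeg _ (hD hab) h0 b (by simp)⟩

lemma PG_of_good {G H : SimpleGraph V} {D : Set (Sym2 V)} {c : Sym2 V → Fin 8}
    (h : GoodColoring H c) (hD : D ⊆ G.edgeSet) (hDH : D ⊆ H.edgeSet)
    (h3 : ∀ x, V3 H x → V3 G x)
    (hadj : ∀ x y, (∃ e ∈ D, x ∈ e) → (∃ e ∈ D, y ∈ e) → G.Adj x y → H.Adj x y) :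
    PG G D c := by
  refine ⟨hD, ?_, ?_⟩
  · intro e he h0 x hx
    induction e with | _ a b
    have := h.2 a b (hDH he) h0
    rw [Sym2.mem_iff] at hx
    rcases hx with rfl | rfl
    exacts [h3 _ this.1, h3 _ this.2]
  · intro e he f hf hne
    induction e with | _ a b
    induction f with | _ x y
    refine ⟨?_, ?_⟩
    · intro h1 h2
      have := h.1.1 a b x y (hDH he) (hDH hf) hne h1 h2
      intro z hz
      rw [Sym2.mem_iff] at hz ⊢
      rcases hz with rfl | rfl <;> tauto
    · intro h1 h2 hn
      have := h.1.2 a b x y (hDH he) (hDH hf) hne h1 h2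
      obtain ⟨p, hp, q, hq, hpq⟩ := hn
      have hpq : p = q ∨ H.Adj p q := hpq.imp_right (hadj p q ⟨_, he, hp⟩ ⟨_, hf, hq⟩)
      rw [Sym2.mem_iff] at hp hq
      rcases hp with rfl | rfl <;> rcases hq with rfl | rfl <;> tauto

lemma PG.mono {G : SimpleGraph V} {D D' : Set (Sym2 V)} {c : Sym2 V → Fin 8} (h : PG G D c)
    (hD : D' ⊆ D) : PG G D' c :=
  ⟨hD.trans h.sub, fun e he => h.zdeg e (hD he),
    fun e he f hf => h.compat e (hD he) f (hD hf)⟩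

lemma PG.insert_edge {G : SimpleGraph V} {D : Set (Sym2 V)} {c : Sym2 V → Fin 8} (h : PG G D c)
    {e : Sym2 V} {k : Fin 8} (he : e ∈ G.edgeSet) (hk : k = 0 → ∀ x ∈ e, V3 G x)
    (hc : ∀ f ∈ D, f ≠ e → Compat G e k f (c f)) :
    ∃ c', PG G (insert e D) c' ∧ (∀ f ∈ D, c' f = c f) ∧ (e ∉ D → c' e = k) := by
  by_cases heD : e ∈ D
  · exact ⟨c, by rwa [Set.insert_eq_of_mem heD], fun _ _ => rfl, fun h => (h heD).elim⟩
  refine ⟨Function.update c e k, ⟨?_, ?_, ?_⟩, ?_, fun _ => by simp⟩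
  · exact Set.insert_subset he h.sub
  · rintro f (rfl | hf) h0
    · simp at h0; exact hk h0
    · have : f ≠ e := fun h => heD (h ▸ hf)
      rw [Function.update_of_ne this] at h0
      exact h.zdeg f hf h0
  · rintro f (rfl | hf) g (rfl | hg) hne
    · exact (hne rfl).elim
    · rw [Function.update_self, Function.update_of_ne hne.symm]
      exact hc g hg hne.symm
    · rw [Function.update_self, Function.update_of_ne hne]
      exact (hc f hf hne).symm
    · have h1 : f ≠ e := fun h => heD (h ▸ hf)
      have h2 : g ≠ e := fun h => heD (h ▸ hg)
      rw [Function.update_of_ne h1, Function.update_of_ne h2]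
      exact h.compat f hf g hg hne
  · intro f hf
    have h1 : f ≠ e := fun h => heD (h ▸ hf)
    rw [Function.update_of_ne h1]

lemma PG.extend {G : SimpleGraph V} (T : List (Sym2 V × Fin 8)) :
    ∀ {D : Set (Sym2 V)} {c : Sym2 V → Fin 8}, PG G D c →
    (∀ p ∈ T, p.1 ∈ G.edgeSet ∧ (p.2 = 0 → ∀ x ∈ p.1, V3 G x) ∧
      ∀ f ∈ D, f ≠ p.1 → Compat G p.1 p.2 f (c f)) →
    T.Pairwise (fun p q => p.1 ≠ q.1 → Compat G p.1 p.2 q.1 q.2) →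
    ∃ c', PG G (D ∪ {e | e ∈ T.map Prod.fst}) c' ∧ (∀ f ∈ D, c' f = c f) := by
  induction T with
  | nil => intro D c h _ _; exact ⟨c, by simpa using h, fun _ _ => rfl⟩
  | cons p T ih =>
    intro D c h hT hP
    rw [List.pairwise_cons] at hP
    obtain ⟨h1, h2, h3⟩ := hT p (by simp)
    obtain ⟨c1, hc1, hag, hp⟩ := h.insert_edge h1 h2 h3
    obtain ⟨c2, hc2, hag2⟩ := ih hc1 (by
      intro q hq
      obtain ⟨q1, q2, q3⟩ := hT q (by simp [hq])
      refine ⟨q1, q2, ?_⟩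
      intro f hf hne
      by_cases hfD : f ∈ D
      · rw [hag f hfD]; exact q3 f hfD hne
      · obtain rfl : f = p.1 := by simpa [hfD] using hf
        rw [hp hfD]
        exact (hP.1 q hq hne).symm) hP.2
    refine ⟨c2, hc2.mono ?_, fun f hf => ?_⟩
    · intro e he
      simp at he ⊢
      tauto
    · rw [hag2 f (Set.mem_insert_of_mem _ hf), hag f hf]

/-- Colours blocked at an edge `xy` appear at the remaining neighbours of `x` and `y`. -/
lemma PG.compat_edge {G : SimpleGraph V} {D : Set (Sym2 V)} {c : Sym2 V → Fin 8} (h : PG G D c)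
    {x y : V} {k : Fin 8} (hk : k ≠ 0)
    (hx : ∀ z, G.Adj x z → z ≠ y → k ∉ K D c z) (hy : ∀ z, G.Adj y z → z ≠ x → k ∉ K D c z) :
    ∀ f ∈ D, f ≠ s(x, y) → Compat G s(x, y) k f (c f) := by
  intro f hf hne
  refine ⟨fun h => (hk h).elim, ?_⟩
  rintro rfl - ⟨p, hp, q, hq, hpq⟩
  have key : ∀ x y p q : V, (∀ z, G.Adj x z → z ≠ y → c f ∉ K D c z) → f ≠ s(x, y) → q ∈ f → p = x →
      (∀ z, G.Adj y z → z ≠ x → c f ∉ K D c z) →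
      (p = q ∨ G.Adj p q) → False := by
    rintro x y p q hx hne hq rfl hy hpq
    obtain ⟨r, rfl⟩ := hq
    rcases hpq with rfl | hpq
    · have had : G.Adj p r := h.sub hf
      exact hx r had (by rintro rfl; exact hne rfl) (mem_K.2 ⟨hk, _, hf, by simp, rfl⟩)
    · by_cases hqy : q = y
      · subst hqy
        have had : G.Adj q r := h.sub hf
        exact hy r had (by rintro rfl; exact hne (Sym2.eq_swap)) (mem_K.2 ⟨hk, _, hf, by simp, rfl⟩)
      · exact hx q hpq hqy (mem_K.2 ⟨hk, _, hf, by simp, rfl⟩)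
  rw [Sym2.mem_iff] at hp
  rcases hp with rfl | rfl
  · exact key _ _ _ _ hx hne hq rfl hy hpq
  · exact key _ _ _ _ hy (by rwa [Sym2.eq_swap]) hq rfl hx hpq

lemma PG.compat_zero {G : SimpleGraph V} {D : Set (Sym2 V)} {c : Sym2 V → Fin 8}
    {x y : V} (hx : ¬ HasZero D c x) (hy : ¬ HasZero D c y) :
    ∀ f ∈ D, f ≠ s(x, y) → Compat G s(x, y) 0 f (c f) := by
  intro f hf _
  refine ⟨fun _ h0 z hz hzf => ?_, fun _ h => (h rfl).elim⟩
  rw [Sym2.mem_iff] at hz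
  rcases hz with rfl | rfl
  exacts [hx ⟨f, hf, hzf, h0⟩, hy ⟨f, hf, hzf, h0⟩]

lemma K_card [Finite V] {G : SimpleGraph V} {D : Set (Sym2 V)} {c : Sym2 V → Fin 8}
    (hD : D ⊆ G.edgeSet) {z : V} (W : Finset V)
    (hW : ∀ w ∈ W, G.Adj z w ∧ (s(z, w) ∈ D → c s(z, w) = 0)) :
    (K D c z).card + W.card ≤ (G.neighborSet z).ncard := by
  have hfin : (G.neighborSet z).Finite := Set.toFinite _
  rw [Set.ncard_eq_toFinset_card _ hfin]
  have hWs : W ⊆ hfin.toFinset := by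
    intro w hw; simpa using (hW w hw).1
  have : K D c z ⊆ (hfin.toFinset \ W).image (fun w => c s(z, w)) := by
    intro k hk
    obtain ⟨hk0, e, he, ⟨w, rfl⟩, hce⟩ := mem_K.1 hk
    simp only [Finset.mem_image, Finset.mem_sdiff, Set.Finite.mem_toFinset, mem_neighborSet]
    refine ⟨w, ⟨hD he, fun hw => hk0 ?_⟩, hce⟩
    rw [← hce]; exact (hW w hw).2 he
  have h1 := (Finset.card_le_card this).trans Finset.card_image_le
  rw [Finset.card_sdiff_of_subset hWs] at h1
  have := Finset.card_le_card hWs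
  omega

lemma K_card_zero [Finite V] {G : SimpleGraph V} {D : Set (Sym2 V)} {c : Sym2 V → Fin 8}
    (h : PG G D c) {z : V} (hz : HasZero D c z) (W : Finset V)
    (hW : ∀ w ∈ W, G.Adj z w ∧ s(z, w) ∉ D) :
    (K D c z).card + W.card + 1 ≤ (G.neighborSet z).ncard := by
  obtain ⟨e, he, ⟨w, rfl⟩, h0⟩ := hz
  have hw : w ∉ W := fun hw => (hW w hw).2 he
  have := K_card (G := G) (c := c) h.sub (z := z) (insert w W) (by
    intro u hu
    rw [Finset.mem_insert] at hu
    rcases hu with rfl | hu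
    · exact ⟨h.sub he, fun _ => h0⟩
    · exact ⟨(hW u hu).1, fun h => ((hW u hu).2 h).elim⟩)
  rw [Finset.card_insert_of_notMem hw] at this
  omega

/-- Replacing nonzero colours by zero as often as possible. -/
lemma PG.exists_zero_max [Finite V] {G : SimpleGraph V} {D : Set (Sym2 V)} {c : Sym2 V → Fin 8}
    (h : PG G D c) : ∃ c', PG G D c' ∧ (∀ e, c' e = c e ∨ c' e = 0) ∧
      (∀ x y, s(x, y) ∈ D → V3 G x → V3 G y → HasZero D c' x ∨ HasZero D c' y) := by
  induction hn : {e ∈ D | c e ≠ 0}.ncard using Nat.strong_induction_on generalizing c with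
  | _ n ih =>
    by_cases hmax : ∀ x y, s(x, y) ∈ D → V3 G x → V3 G y → HasZero D c x ∨ HasZero D c y
    · exact ⟨c, h, fun _ => Or.inl rfl, hmax⟩
    push Not at hmax
    obtain ⟨x, y, hxy, hx, hy, zx, zy⟩ := hmax
    have hc0 : c s(x, y) ≠ 0 := fun h0 => zx ⟨_, hxy, by simp, h0⟩
    have hP : PG G D (Function.update c s(x, y) 0) := by
      have hx0 := PG.compat_zero (G := G) zx zy
      refine ⟨h.sub, ?_, ?_⟩
      · intro e he h0 z hz
        by_cases hee : e = s(x, y)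
        · subst hee
          rw [Sym2.mem_iff] at hz
          rcases hz with rfl | rfl <;> assumption
        · rw [Function.update_of_ne hee] at h0
          exact h.zdeg e he h0 z hz
      · intro e he f hf hne
        by_cases hee : e = s(x, y)
        · subst hee
          rw [Function.update_self, Function.update_of_ne hne.symm]
          exact hx0 f hf hne.symm
        · rw [Function.update_of_ne hee]
          by_cases hff : f = s(x, y)
          · subst hff
            rw [Function.update_self]
            exact (hx0 e he hne).symm
          · rw [Function.update_of_ne hff]
            exact h.compat e he f hf hne
    have hlt : {e ∈ D | Function.update c s(x, y) 0 e ≠ 0}.ncard < n := by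
      rw [← hn]
      apply Set.ncard_lt_ncard _ (Set.toFinite _)
      refine ⟨?_, fun hs => ?_⟩
      · rintro e ⟨he, h0⟩
        refine ⟨he, ?_⟩
        by_cases hee : e = s(x, y)
        · subst hee; exact hc0
        · rwa [Function.update_of_ne hee] at h0
      · have := (hs ⟨hxy, hc0⟩).2
        simp at this
    obtain ⟨c', h1, h2, h3⟩ := ih _ hlt hP rfl
    refine ⟨c', h1, fun e => ?_, h3⟩
    rcases h2 e with h2 | h2
    · rw [h2]
      by_cases hee : e = s(x, y)
      · subst hee; simp
      · rw [Function.update_of_ne hee]; simp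
    · exact Or.inr h2

lemma K_mono_of_zero {D : Set (Sym2 V)} {c c' : Sym2 V → Fin 8}
    (h : ∀ e, c' e = c e ∨ c' e = 0) (z : V) : K D c' z ⊆ K D c z := by
  intro k hk
  obtain ⟨h0, e, he, hz, hc⟩ := mem_K.1 hk
  rcases h e with h | h
  · exact mem_K.2 ⟨h0, e, he, hz, by rw [← h, hc]⟩
  · exact (h0 (hc ▸ h)).elim

end Core

section Minimality
open Classical

variable {V : Type} [Finite V] {G : SimpleGraph V}

lemma MinCounter.color (hG : MinCounter V G) (H : SimpleGraph V) (hdeg : Subcubic H)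
    (hlt : H.edgeSet.ncard < G.edgeSet.ncard) : ∃ c, GoodColoring H c :=
  hG.2.2 V H hdeg (by omega)

/-- The spanning subgraph of edges avoiding `X`. -/
def avoid (G : SimpleGraph V) (X : Set V) : SimpleGraph V where
  Adj x y := G.Adj x y ∧ x ∉ X ∧ y ∉ X
  symm := ⟨fun _ _ h => ⟨h.1.symm, h.2.2, h.2.1⟩⟩
  loopless := ⟨fun _ h => h.1.ne rfl⟩

lemma avoid_edgeSet {X : Set V} {e : Sym2 V} :
    e ∈ (avoid G X).edgeSet ↔ e ∈ G.edgeSet ∧ ∀ x ∈ e, x ∉ X := by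
  induction e with | _ a b
  simp [avoid, Sym2.mem_iff]

lemma mem_avoid {X : Set V} {x y : V} :
    s(x, y) ∈ (avoid G X).edgeSet ↔ G.Adj x y ∧ x ∉ X ∧ y ∉ X := Iff.rfl

lemma ncard_nbr_mono {H : SimpleGraph V} {x : V} (h : ∀ y, H.Adj x y → G.Adj x y) :
    (H.neighborSet x).ncard ≤ (G.neighborSet x).ncard :=
  Set.ncard_le_ncard (fun _ hy => h _ hy) (Set.toFinite _)

lemma ncard_nbr_lt {H : SimpleGraph V} {x z : V} (h : ∀ y, H.Adj x y → G.Adj x y)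
    (hz : G.Adj x z) (hz' : ¬ H.Adj x z) :
    (H.neighborSet x).ncard < (G.neighborSet x).ncard :=
  Set.ncard_lt_ncard ⟨fun _ hy => h _ hy, fun hs => hz' (hs hz)⟩ (Set.toFinite _)

lemma V3_of_le (hG : Subcubic G) {H : SimpleGraph V}
    (h : ∀ x, (H.neighborSet x).ncard ≤ (G.neighborSet x).ncard) (x : V) (hx : V3 H x) :
    V3 G x := by
  have := h x
  have := hG x
  unfold V3 at *
  omega

lemma not_hasZero_of_lt (hG : Subcubic G) {H : SimpleGraph V} {D : Set (Sym2 V)}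
    {c : Sym2 V → Fin 8} (hc : GoodColoring H c) (hD : D ⊆ H.edgeSet) {z : V}
    (hz : (H.neighborSet z).ncard < (G.neighborSet z).ncard) : ¬ HasZero D c z := by
  rintro ⟨e, he, ⟨w, rfl⟩, h0⟩
  have := (hc.2 z w (hD he) h0).1
  have := hG z
  omega

lemma MinCounter.color_avoid (hG : MinCounter V G) (X : Set V) {x y : V} (hx : x ∈ X)
    (hxy : G.Adj x y) :
    ∃ c, PG G (avoid G X).edgeSet c ∧
      ∀ z ∉ X, ∀ x ∈ X, G.Adj z x → ¬ HasZero (avoid G X).edgeSet c z := by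
  have hle : ∀ x y, (avoid G X).Adj x y → G.Adj x y := fun _ _ h => h.1
  obtain ⟨c, hc⟩ := hG.color (avoid G X) (fun v => (ncard_nbr_mono (hle v)).trans (hG.1 v)) (by
    apply Set.ncard_lt_ncard _ (Set.toFinite _)
    refine ⟨fun e he => (avoid_edgeSet.1 he).1, fun hs => ?_⟩
    exact (mem_avoid.1 (hs (show s(x, y) ∈ G.edgeSet from hxy))).2.1 hx)
  refine ⟨c, PG_of_good hc (fun e he => (avoid_edgeSet.1 he).1) subset_rfl
    (V3_of_le hG.1 fun v => ncard_nbr_mono (hle v)) ?_, ?_⟩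
  · rintro x y ⟨e, he, hxe⟩ ⟨f, hf, hyf⟩ hxy
    exact ⟨hxy, (avoid_edgeSet.1 he).2 x hxe, (avoid_edgeSet.1 hf).2 y hyf⟩
  · intro z hz x hx hzx
    exact not_hasZero_of_lt hG.1 hc subset_rfl
      (ncard_nbr_lt (hle z) hzx fun h => h.2.2 hx)

lemma MinCounter.false_of_PG (hG : MinCounter V G) {D : Set (Sym2 V)} {c : Sym2 V → Fin 8}
    (h : PG G D c) (hD : G.edgeSet ⊆ D) : False :=
  hG.2.1 ⟨c, good_of_PG h hD⟩

/-- A good partial coloring missing only edges listed in `T`, each of which has a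
compatible colour, cannot exist. -/
lemma MinCounter.false_of_extend (hG : MinCounter V G) {D : Set (Sym2 V)} {c : Sym2 V → Fin 8}
    (h : PG G D c) (T : List (Sym2 V × Fin 8))
    (hT : ∀ p ∈ T, p.1 ∈ G.edgeSet ∧ (p.2 = 0 → ∀ x ∈ p.1, V3 G x) ∧
      ∀ f ∈ D, f ≠ p.1 → Compat G p.1 p.2 f (c f))
    (hP : T.Pairwise (fun p q => p.1 ≠ q.1 → Compat G p.1 p.2 q.1 q.2))
    (hcov : ∀ e ∈ G.edgeSet, e ∈ D ∨ e ∈ T.map Prod.fst) : False := by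
  obtain ⟨c', hc', -⟩ := h.extend T hT hP
  exact hG.false_of_PG hc' fun e he => hcov e he

lemma K_congr {D D' : Set (Sym2 V)} {c c' : Sym2 V → Fin 8} {z : V}
    (h : ∀ e, z ∈ e → (e ∈ D ↔ e ∈ D')) (hc : ∀ e ∈ D, z ∈ e → c e = c' e) :
    K D c z = K D' c' z := by
  ext k
  rw [mem_K, mem_K]
  refine and_congr_right fun _ => ⟨?_, ?_⟩
  · rintro ⟨e, he, hz, rfl⟩
    exact ⟨e, (h e hz).1 he, hz, (hc e he hz).symm⟩
  · rintro ⟨e, he, hz, rfl⟩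
    exact ⟨e, (h e hz).2 he, hz, hc e ((h e hz).2 he) hz⟩

/-- Two partial colorings on the two sides of a vertex partition combine. -/
lemma PG.glue {A : Set V} {D₁ D₂ : Set (Sym2 V)} {c₁ c₂ : Sym2 V → Fin 8}
    (h₁ : PG G D₁ c₁) (h₂ : PG G D₂ c₂) (hA : ∀ e ∈ D₁, ∀ x ∈ e, x ∈ A)
    (hB : ∀ e ∈ D₂, ∀ x ∈ e, x ∉ A)
    (hK : ∀ a ∈ A, ∀ b ∉ A, G.Adj a b → Disjoint (K D₁ c₁ a) (K D₂ c₂ b)) :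
    ∃ c, PG G (D₁ ∪ D₂) c ∧ (∀ a ∈ A, K (D₁ ∪ D₂) c a = K D₁ c₁ a) ∧
      (∀ b ∉ A, K (D₁ ∪ D₂) c b = K D₂ c₂ b) := by
  have hdis : ∀ e ∈ D₂, e ∉ D₁ := by
    intro e he he'
    induction e with | _ a b
    exact hB _ he a (by simp) (hA _ he' a (by simp))
  have key : ∀ e ∈ D₁, ∀ f ∈ D₂, Compat G e (c₁ e) f (c₂ f) := by
    intro e he f hf
    refine ⟨fun _ _ x hx hx' => hB f hf x hx' (hA e he x hx), ?_⟩
    rintro hkl hk ⟨x, hx, y, hy, hxy⟩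
    rcases hxy with rfl | hxy
    · exact hB f hf x hy (hA e he x hx)
    · refine Finset.disjoint_left.1 (hK x (hA e he x hx) y (hB f hf y hy) hxy)
        (mem_K.2 ⟨hk, e, he, hx, rfl⟩) (mem_K.2 ⟨hk, f, hf, hy, hkl.symm⟩)
  refine ⟨fun e => if e ∈ D₁ then c₁ e else c₂ e, ⟨?_, ?_, ?_⟩, ?_, ?_⟩
  · exact Set.union_subset h₁.sub h₂.sub
  · rintro e (he | he) h0
    · rw [if_pos he] at h0; exact h₁.zdeg e he h0
    · rw [if_neg (hdis e he)] at h0; exact h₂.zdeg e he h0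
  · rintro e (he | he) f (hf | hf) hne
    · rw [if_pos he, if_pos hf]; exact h₁.compat e he f hf hne
    · rw [if_pos he, if_neg (hdis f hf)]; exact key e he f hf
    · rw [if_pos hf, if_neg (hdis e he)]; exact (key f hf e he).symm
    · rw [if_neg (hdis e he), if_neg (hdis f hf)]; exact h₂.compat e he f hf hne
  · intro a ha
    apply K_congr
    · intro e hae
      constructor
      · rintro (he | he)
        exacts [he, (hB e he a hae ha).elim]
      · exact Or.inl
    · rintro e (he | he) hae
      exacts [if_pos he, (hB e he a hae ha).elim]
  · intro a ha
    apply K_congr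
    · intro e hae
      constructor
      · rintro (he | he)
        exacts [(ha (hA e he a hae)).elim, he]
      · exact Or.inr
    · rintro e (he | he) hae
      exacts [(ha (hA e he a hae)).elim, if_neg (hdis e he)]

lemma PG.perm {D : Set (Sym2 V)} {c : Sym2 V → Fin 8} (h : PG G D c) (σ : Equiv.Perm (Fin 8))
    (h0 : σ 0 = 0) : PG G D (fun e => σ (c e)) := by
  have hσ : ∀ k, σ k = 0 ↔ k = 0 := fun k => by
    rw [← h0, σ.injective.eq_iff, h0]
  refine ⟨h.sub, fun e he hz => h.zdeg e he ((hσ _).1 hz), fun e he f hf hne => ?_⟩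
  refine ⟨fun a b => (h.compat e he f hf hne).1 ((hσ _).1 a) ((hσ _).1 b), fun a b => ?_⟩
  exact (h.compat e he f hf hne).2 (σ.injective a) (fun h => b ((hσ _).2 h))

lemma K_perm {D : Set (Sym2 V)} {c : Sym2 V → Fin 8} (σ : Equiv.Perm (Fin 8))
    (h0 : σ 0 = 0) (z : V) : K D (fun e => σ (c e)) z = (K D c z).image σ := by
  ext k
  rw [mem_K, Finset.mem_image]
  constructor
  · rintro ⟨hk, e, he, hz, rfl⟩
    exact ⟨c e, mem_K.2 ⟨fun h => hk (by rw [h, h0]), e, he, hz, rfl⟩, rfl⟩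
  · rintro ⟨l, hl, rfl⟩
    obtain ⟨hk, e, he, hz, rfl⟩ := mem_K.1 hl
    exact ⟨fun h => hk (σ.injective (h.trans h0.symm)), e, he, hz, rfl⟩

lemma exists_perm (B : Finset (Fin 8)) (f : Fin 8 → Fin 8) (hf : Set.InjOn f B)
    (R T : Finset (Fin 8)) (hBR : Disjoint B R) (hT : ∀ b ∈ B, f b ∉ T) (hRT : R.card ≤ T.card) :
    ∃ σ : Equiv.Perm (Fin 8), (∀ b ∈ B, σ b = f b) ∧ ∀ r ∈ R, σ r ∈ T := by
  obtain ⟨g⟩ : Nonempty (R ↪ T) := Function.Embedding.nonempty_of_card_le (by simpa using hRT)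
  let F : Fin 8 → Fin 8 := fun x => if h : x ∈ R then g ⟨x, h⟩ else f x
  have hFR : ∀ x (h : x ∈ R), F x = g ⟨x, h⟩ := fun x h => dif_pos h
  have hFB : ∀ x ∈ B, F x = f x := fun x h => dif_neg (Finset.disjoint_left.1 hBR h)
  have hinj : Set.InjOn F (B ∪ R : Finset (Fin 8)) := by
    intro x hx y hy hxy
    rw [Finset.mem_coe, Finset.mem_union] at hx hy
    rcases hx with hx | hx <;> rcases hy with hy | hy
    · rw [hFB x hx, hFB y hy] at hxy; exact hf hx hy hxy
    · rw [hFB x hx, hFR y hy] at hxy; exact (hT x hx (hxy ▸ (g ⟨y, hy⟩).2)).elim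
    · rw [hFR x hx, hFB y hy] at hxy; exact (hT y hy (hxy ▸ (g ⟨x, hx⟩).2)).elim
    · rw [hFR x hx, hFR y hy] at hxy
      have := g.injective (Subtype.ext hxy)
      simpa using this
  obtain ⟨σ, hσ⟩ := Finset.exists_equiv_extend_of_card_eq (t := (Finset.univ : Finset (Fin 8)))
    (by simp) (Finset.subset_univ ((B ∪ R).image F)) hinj
  refine ⟨σ.trans (Equiv.subtypeUnivEquiv (by simp)), fun b hb => ?_, fun r hr => ?_⟩
  · simp [hσ b (by simp [hb]), hFB b hb, Equiv.subtypeUnivEquiv]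
  · simp [hσ r (by simp [hr]), hFR r hr, Equiv.subtypeUnivEquiv]

lemma exists_color {F : Finset (Fin 8)} (hF : F.card ≤ 6) : ∃ k, k ≠ 0 ∧ k ∉ F := by
  have : (insert 0 F).card < (Finset.univ : Finset (Fin 8)).card :=
    (Finset.card_insert_le _ _).trans_lt (by simp; omega)
  obtain ⟨k, -, hk⟩ := Finset.exists_mem_notMem_of_card_lt_card this
  rw [Finset.mem_insert, not_or] at hk
  exact ⟨k, hk⟩

end Minimality

section Connectivity
open Classical

variable {V : Type} [Finite V] {G : SimpleGraph V}

lemma MinCounter.exists_adj (hG : MinCounter V G) (v : V) : ∃ w, G.Adj v w := by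
  by_contra! hv
  let W := {x : V // x ≠ v}
  let f : W → V := Subtype.val
  have hf : Function.Injective f := Subtype.val_injective
  let H : SimpleGraph W := G.comap f
  have hfs := Sym2.map.injective hf
  have hmem : ∀ e, e ∈ H.edgeSet ↔ Sym2.map f e ∈ G.edgeSet := by
    intro e; induction e with | _ a b
    simp [H]
  have hnb : ∀ x : W, f '' H.neighborSet x = G.neighborSet x := by
    intro x
    ext y
    simp only [Set.mem_image, mem_neighborSet]
    constructor
    · rintro ⟨z, hz, rfl⟩; exact hz
    · intro h
      exact ⟨⟨y, fun hy => hv x (hy ▸ h.symm)⟩, h, rfl⟩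
  have hdeg : ∀ x : W, (H.neighborSet x).ncard = (G.neighborSet x).ncard := by
    intro x
    rw [← hnb x, Set.ncard_image_of_injective _ hf]
  have hcard : Nat.card W < Nat.card V := by
    have := Finite.card_subtype_lt (p := fun x => x ≠ v) (x := v) (by simp)
    exact this
  have hedge : H.edgeSet.ncard ≤ G.edgeSet.ncard := by
    rw [← Set.ncard_image_of_injective H.edgeSet hfs]
    apply Set.ncard_le_ncard _ (Set.toFinite _)
    rintro _ ⟨e, he, rfl⟩
    exact (hmem e).1 he
  obtain ⟨c, hc⟩ := hG.2.2 W H (fun x => (hdeg x).trans_le (hG.1 x)) (by omega)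
  have hcg : PG H H.edgeSet c := PG_of_good hc subset_rfl subset_rfl (fun _ h => h) fun _ _ _ _ h => h
  have hlift : ∀ e ∈ G.edgeSet, ∃ e' ∈ H.edgeSet, Sym2.map f e' = e := by
    intro e he
    induction e with | _ a b
    have ha : a ≠ v := by rintro rfl; exact hv _ he
    have hb : b ≠ v := by rintro rfl; exact hv _ he.symm
    exact ⟨s(⟨a, ha⟩, ⟨b, hb⟩), he, rfl⟩
  let c' := Function.extend (Sym2.map f) c 0
  have hc' : ∀ e, c' (Sym2.map f e) = c e := fun e => hfs.extend_apply _ _ _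
  refine hG.false_of_PG (D := G.edgeSet) (c := c') ⟨subset_rfl, ?_, ?_⟩ subset_rfl
  · intro e he h0 x hx
    obtain ⟨e, he', rfl⟩ := hlift e he
    rw [hc'] at h0
    obtain ⟨y, hy, rfl⟩ := Sym2.mem_map.1 hx
    exact (hdeg y).symm.trans (hcg.zdeg e he' h0 y hy)
  · intro e he g hg hne
    obtain ⟨e, he', rfl⟩ := hlift e he
    obtain ⟨g, hg', rfl⟩ := hlift g hg
    rw [hc', hc']
    have := hcg.compat e he' g hg' (by rintro rfl; exact hne rfl)
    refine ⟨fun a b x hx hx' => ?_, fun a b hn => this.2 a b ?_⟩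
    · obtain ⟨y, hy, rfl⟩ := Sym2.mem_map.1 hx
      obtain ⟨z, hz, hzy⟩ := Sym2.mem_map.1 hx'
      obtain rfl := hf hzy
      exact this.1 a b z hy hz
    · obtain ⟨x, hx, y, hy, hxy⟩ := hn
      obtain ⟨x, hx', rfl⟩ := Sym2.mem_map.1 hx
      obtain ⟨y, hy', rfl⟩ := Sym2.mem_map.1 hy
      exact ⟨x, hx', y, hy', hxy.imp (fun h => hf h) id⟩

lemma K_avoid_empty {X : Set V} {c : Sym2 V → Fin 8} {z : V} (hz : z ∈ X) :
    K (avoid G X).edgeSet c z = ∅ := by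
  rw [Finset.eq_empty_iff_forall_notMem]
  intro k hk
  obtain ⟨-, e, he, hze, -⟩ := mem_K.1 hk
  exact (avoid_edgeSet.1 he).2 z hze hz

lemma MinCounter.preconnected (hG : MinCounter V G) : G.Preconnected := by
  intro u v
  by_contra huv
  set A : Set V := {x | G.Reachable u x} with hA
  obtain ⟨u', hu'⟩ := hG.exists_adj u
  obtain ⟨v', hv'⟩ := hG.exists_adj v
  have hcl : ∀ x y, G.Adj x y → (x ∈ A ↔ y ∈ A) := fun x y h =>
    ⟨fun hx => hx.trans h.reachable, fun hy => hy.trans h.symm.reachable⟩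
  have huA : u ∈ A := Reachable.refl u
  obtain ⟨c₁, h₁, -⟩ := hG.color_avoid A huA hu'
  obtain ⟨c₂, h₂, -⟩ := hG.color_avoid Aᶜ (show v ∈ Aᶜ from huv) hv'
  obtain ⟨c, hc, -⟩ := PG.glue h₂ h₁ (A := A)
    (fun e he x hx => not_not.1 ((avoid_edgeSet.1 he).2 x hx))
    (fun e he x hx => (avoid_edgeSet.1 he).2 x hx)
    (fun a ha b hb hab => (hb ((hcl a b hab).1 ha)).elim)
  refine hG.false_of_PG hc fun e he => ?_
  induction e with | _ a b
  by_cases ha : a ∈ A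
  · left; exact mem_avoid.2 ⟨he, not_not.2 ha, not_not.2 ((hcl a b he).1 ha)⟩
  · right; exact mem_avoid.2 ⟨he, ha, fun hb => ha ((hcl a b he).2 hb)⟩

lemma K_card_le_three (hG : Subcubic G) {D : Set (Sym2 V)} {c : Sym2 V → Fin 8}
    (hD : D ⊆ G.edgeSet) (z : V) : (K D c z).card ≤ 3 := by
  have := K_card (c := c) hD (z := z) ∅ (by simp)
  have := hG z
  simp at *
  omega

lemma exists_color_biUnion {ι : Type*} (S : Finset ι) (F : ι → Finset (Fin 8)) {m n : ℕ}
    (hS : S.card ≤ m) (hF : ∀ i ∈ S, (F i).card ≤ n) (hmn : m * n ≤ 6) :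
    ∃ k, k ≠ 0 ∧ ∀ i ∈ S, k ∉ F i := by
  have h1 : (S.biUnion F).card ≤ 6 :=
    (Finset.card_biUnion_le_card_mul _ _ _ hF).trans ((Nat.mul_le_mul_right _ hS).trans hmn)
  obtain ⟨k, h0, hk⟩ := exists_color h1
  refine ⟨k, h0, fun i hi h => hk (Finset.mem_biUnion.2 ⟨i, hi, h⟩)⟩

/-- The neighbours of `x` other than `y`. -/
noncomputable def nbrs (G : SimpleGraph V) (x y : V) : Finset V :=
  (Set.toFinite (G.neighborSet x \ {y})).toFinset

lemma mem_nbrs {x y z : V} : z ∈ nbrs G x y ↔ G.Adj x z ∧ z ≠ y := by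
  simp [nbrs]

lemma card_nbrs {x y : V} (h : G.Adj x y) :
    (nbrs G x y).card + 1 = (G.neighborSet x).ncard := by
  rw [nbrs, ← Set.ncard_eq_toFinset_card]
  exact Set.ncard_sdiff_singleton_add_one h (Set.toFinite _)

/-- A vertex of a minimal counterexample has a second neighbour. -/
lemma MinCounter.exists_adj_ne (hG : MinCounter V G) {b a : V} (hab : G.Adj b a) :
    ∃ w, G.Adj b w ∧ w ≠ a := by
  by_contra! hb
  obtain ⟨c, hc, -⟩ := hG.color_avoid {b} rfl hab
  have hcard := card_nbrs hab.symm
  have ha := hG.1 a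
  obtain ⟨k, hk0, hk⟩ := exists_color_biUnion (m := 2) (n := 3) (nbrs G a b)
    (fun z => K (avoid G {b}).edgeSet c z) (by omega)
    (fun z _ => K_card_le_three hG.1 hc.sub z) (by norm_num)
  refine hG.false_of_extend hc [(s(a, b), k)] ?_ (by simp) ?_
  · simp only [List.mem_singleton, forall_eq]
    refine ⟨hab.symm, fun h => (hk0 h).elim, hc.compat_edge hk0 ?_ ?_⟩
    · intro z hz hne
      exact hk z (mem_nbrs.2 ⟨hz, hne⟩)
    · intro z hz hne
      exact (hne (hb z hz)).elim
  · intro e he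
    by_cases hbe : b ∈ e
    · right
      obtain ⟨w, rfl⟩ := hbe
      obtain rfl := hb w he
      simp [Sym2.eq_swap]
    · left
      exact avoid_edgeSet.2 ⟨he, fun x hx hxb => hbe (hxb ▸ hx)⟩

end Connectivity

section Bridge
open Classical

variable {V : Type} [Finite V] {G : SimpleGraph V}

lemma PG.notMem_K {D D' : Set (Sym2 V)} {c : Sym2 V → Fin 8} (h : PG G D c) {e : Sym2 V}
    (he : e ∈ D) (hD : D' ⊆ D) (heD : e ∉ D') {a z : V} (ha : a ∈ e) (hz : a = z ∨ G.Adj a z) :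
    c e ∉ K D' c z := by
  intro hk
  obtain ⟨h0, f, hf, hzf, hfc⟩ := mem_K.1 hk
  refine (h.compat e he f (hD hf) (by rintro rfl; exact heD hf)).2 hfc.symm h0 ?_
  exact ⟨a, ha, z, hzf, hz⟩

lemma exists_perm_one {k l : Fin 8} (hk : k ≠ 0) (hl : l ≠ 0) {P R : Finset (Fin 8)}
    (hlR : l ∉ R) (h0R : 0 ∉ R) (hc : P.card + R.card ≤ 6) :
    ∃ σ : Equiv.Perm (Fin 8), σ 0 = 0 ∧ σ l = k ∧ ∀ r ∈ R, σ r ∉ P := by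
  have hT : R.card ≤ (insert 0 (insert k P))ᶜ.card := by
    have h1 := Finset.card_insert_le 0 (insert k P)
    have h2 := Finset.card_insert_le k P
    rw [Finset.card_compl, Fintype.card_fin]
    omega
  have hinj : Set.InjOn (fun x => if x = 0 then 0 else k) (({0, l} : Finset (Fin 8)) : Set (Fin 8)) := by
    intro x hx y hy hxy
    rw [Finset.mem_coe, Finset.mem_insert, Finset.mem_singleton] at hx hy
    rcases hx with rfl | rfl <;> rcases hy with rfl | rfl
    · rfl
    · exact (hk (by simpa [hl] using hxy.symm)).elim
    · exact (hk (by simpa [hl] using hxy)).elim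
    · rfl
  obtain ⟨σ, hσ, hσR⟩ := exists_perm {0, l} _ hinj R (insert 0 (insert k P))ᶜ (by
      rw [Finset.disjoint_left]
      intro x hx
      rw [Finset.mem_insert, Finset.mem_singleton] at hx
      rcases hx with rfl | rfl <;> assumption) (by
      intro x hx
      rw [Finset.mem_insert, Finset.mem_singleton] at hx
      rcases hx with rfl | rfl <;> simp [hl]) hT
  refine ⟨σ, by simpa using hσ 0 (by simp), by simpa [hl] using hσ l (by simp), fun r hr h => ?_⟩
  have := hσR r hr
  simp only [Finset.mem_compl, Finset.mem_insert, not_or] at this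
  exact this.2.2 h

lemma MinCounter.no_cut_one (hG : MinCounter V G) (A : Set V) {a b : V} (ha : a ∈ A) (hb : b ∉ A)
    (hab : G.Adj a b) (hcut : ∀ x ∈ A, ∀ y ∉ A, G.Adj x y → x = a ∧ y = b) : False := by
  have side : ∀ (A : Set V) (a b : V), a ∈ A → b ∉ A → G.Adj a b →
      (∀ x ∈ A, ∀ y ∉ A, G.Adj x y → x = a ∧ y = b) →
      ∃ (c : Sym2 V → Fin 8) (k : Fin 8), PG G (avoid G Aᶜ).edgeSet c ∧ k ≠ 0 ∧
        ∀ z ∈ A, a = z ∨ G.Adj a z → k ∉ K (avoid G Aᶜ).edgeSet c z := by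
    intro A a b ha hb hab hcut
    obtain ⟨w, hw, hwa⟩ := hG.exists_adj_ne hab.symm
    have hwA : w ∉ A := fun h => hwa (hcut w h b hb hw.symm).1
    have hwX : w ∈ Aᶜ \ {b} := ⟨hwA, hw.ne'⟩
    obtain ⟨c, hc, hz⟩ := hG.color_avoid (Aᶜ \ {b}) hwX hw.symm
    have hmem : s(a, b) ∈ (avoid G (Aᶜ \ {b})).edgeSet :=
      mem_avoid.2 ⟨hab, fun h => h.1 ha, fun h => h.2 rfl⟩
    have hsub : (avoid G Aᶜ).edgeSet ⊆ (avoid G (Aᶜ \ {b})).edgeSet := fun e he =>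
      avoid_edgeSet.2 ⟨(avoid_edgeSet.1 he).1, fun x hx h => (avoid_edgeSet.1 he).2 x hx h.1⟩
    refine ⟨c, c s(a, b), hc.mono hsub, fun h0 => ?_, ?_⟩
    · exact hz b (fun h => h.2 rfl) w hwX hw ⟨_, hmem, by simp, h0⟩
    · intro z _ hz
      exact hc.notMem_K hmem hsub (fun h => (mem_avoid.1 h).2.2 hb) (by simp) hz
  obtain ⟨c₁, k, h₁, hk, hk₁⟩ := side A a b ha hb hab hcut
  obtain ⟨c₂, l, h₂, hl, hl₂⟩ := side Aᶜ b a hb (not_not.2 ha) hab.symm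
    (fun x hx y hy h => (hcut y (not_not.1 hy) x hx h.symm).symm)
  rw [compl_compl] at h₂ hl₂
  have hP3 := K_card_le_three hG.1 h₁.sub (c := c₁) a
  have hR3 := K_card_le_three hG.1 h₂.sub (c := c₂) b
  obtain ⟨σ, hσ0, hσl, hσR⟩ := exists_perm_one hk hl (hl₂ b hb (Or.inl rfl)) zero_notMem_K
    (by omega : (K (avoid G Aᶜ).edgeSet c₁ a).card + (K (avoid G A).edgeSet c₂ b).card ≤ 6)
  obtain ⟨c, hc, hcA, hcB⟩ := PG.glue h₁ (h₂.perm σ hσ0) (A := A)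
    (fun e he x hx => not_not.1 ((avoid_edgeSet.1 he).2 x hx))
    (fun e he x hx => (avoid_edgeSet.1 he).2 x hx) (by
      intro x hx y hy hxy
      obtain ⟨rfl, rfl⟩ := hcut x hx y hy hxy
      rw [K_perm σ hσ0, Finset.disjoint_right]
      intro q hq
      obtain ⟨r, hr, rfl⟩ := Finset.mem_image.1 hq
      exact hσR r hr)
  refine hG.false_of_extend hc [(s(a, b), k)] ?_ (by simp) ?_
  · simp only [List.mem_singleton, forall_eq]
    refine ⟨hab, fun h => (hk h).elim, hc.compat_edge hk ?_ ?_⟩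
    · intro z hz hne
      have hzA : z ∈ A := by_contra fun h => hne (hcut a ha z h hz).2
      rw [hcA z hzA]
      exact hk₁ z hzA (Or.inr hz)
    · intro z hz hne
      have hzA : z ∉ A := fun h => hne (hcut z h b hb hz.symm).1
      rw [hcB z hzA, K_perm σ hσ0, ← hσl, Finset.mem_image]
      rintro ⟨r, hr, h⟩
      rw [σ.injective h] at hr
      exact hl₂ z hzA (Or.inr hz) hr
  · intro e he
    induction e with | _ x y
    by_cases hx : x ∈ A <;> by_cases hy : y ∈ A
    · exact Or.inl (Or.inl (mem_avoid.2 ⟨he, not_not.2 hx, not_not.2 hy⟩))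
    · obtain ⟨rfl, rfl⟩ := hcut x hx y hy he
      simp
    · obtain ⟨rfl, rfl⟩ := hcut y hy x hx he.symm
      simp [Sym2.eq_swap]
    · exact Or.inl (Or.inr (mem_avoid.2 ⟨he, hx, hy⟩))

lemma MinCounter.not_isBridge (hG : MinCounter V G) (e : Sym2 V) : ¬ G.IsBridge e := by
  induction e with | _ u v
  rw [isBridge_iff]
  intro huv
  set G' := G.deleteEdges {s(u, v)}
  set A : Set V := {x | G'.Reachable u x}
  have hcut : ∀ x ∈ A, ∀ y ∉ A, G.Adj x y → x = u ∧ y = v := by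
    intro x hx y hy hxy
    have : ¬ G'.Adj x y := fun h => hy (Reachable.trans hx h.reachable)
    have h : s(x, y) = s(u, v) := by
      by_contra h
      exact this (by simpa [G', hxy] using h)
    rcases Sym2.eq_iff.1 h with h | ⟨rfl, rfl⟩
    · exact h
    · exact (huv hx).elim
  have hadj : G.Adj u v := by
    by_contra h
    apply huv
    have : G' = G := by
      apply deleteEdges_eq_self.2
      simpa using h
    rw [this]
    exact hG.preconnected u v
  exact hG.no_cut_one A (Reachable.refl u) huv hadj hcut

end Bridge

section Lists
open Classical

variable {α : Type*}

lemma pick_one {L : Finset α} (h : 1 ≤ L.card) : ∃ x ∈ L, True :=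
  let ⟨x, hx⟩ := Finset.card_pos.1 h
  ⟨x, hx, trivial⟩

lemma pick_two {L : Finset α} (h : 2 ≤ L.card) (a : α) : ∃ x ∈ L, x ≠ a := by
  obtain ⟨x, hx, hn⟩ := Finset.exists_mem_notMem_of_card_lt_card
    (s := {a}) (t := L) (by rw [Finset.card_singleton]; omega)
  exact ⟨x, hx, by simpa using hn⟩

lemma pick_three {L : Finset α} (h : 3 ≤ L.card) (a b : α) : ∃ x ∈ L, x ≠ a ∧ x ≠ b := by
  obtain ⟨x, hx, hn⟩ := Finset.exists_mem_notMem_of_card_lt_card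
    (s := {a, b}) (t := L) (Finset.card_le_two.trans_lt h)
  exact ⟨x, hx, by simpa using hn⟩

lemma pick_four {L : Finset α} (h : 4 ≤ L.card) (a b c : α) :
    ∃ x ∈ L, x ≠ a ∧ x ≠ b ∧ x ≠ c := by
  obtain ⟨x, hx, hn⟩ := Finset.exists_mem_notMem_of_card_lt_card
    (s := {a, b, c}) (t := L) (Finset.card_le_three.trans_lt h)
  exact ⟨x, hx, by simpa using hn⟩

lemma greedy_four {A B C D : Finset α} (hA : 1 ≤ A.card) (hB : 2 ≤ B.card) (hC : 3 ≤ C.card)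
    (hD : 4 ≤ D.card) : ∃ a ∈ A, ∃ b ∈ B, ∃ c ∈ C, ∃ d ∈ D,
      a ≠ b ∧ a ≠ c ∧ a ≠ d ∧ b ≠ c ∧ b ≠ d ∧ c ≠ d := by
  obtain ⟨a, ha, -⟩ := pick_one hA
  obtain ⟨b, hb, hab⟩ := pick_two hB a
  obtain ⟨c, hc, hca, hcb⟩ := pick_three hC a b
  obtain ⟨d, hd, hda, hdb, hdc⟩ := pick_four hD a b c
  exact ⟨a, ha, b, hb, c, hc, d, hd, hab.symm, hca.symm, hda.symm, hcb.symm, hdb.symm, hdc.symm⟩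

/-- List coloring of `K₄` minus an edge. -/
lemma diamond_choice {A A' B B' : Finset α}
    (h : (4 ≤ A.card ∧ 1 ≤ B.card) ∨ (3 ≤ A.card ∧ 2 ≤ B.card))
    (h' : (4 ≤ A'.card ∧ 1 ≤ B'.card) ∨ (3 ≤ A'.card ∧ 2 ≤ B'.card)) :
    ∃ a ∈ A, ∃ a' ∈ A', ∃ b ∈ B, ∃ b' ∈ B', a ≠ a' ∧ a ≠ b ∧ a ≠ b' ∧ a' ≠ b ∧ a' ≠ b' := by
  by_cases h4 : 4 ≤ A.card
  · obtain ⟨b, hb, -⟩ := pick_one (L := B) (by omega)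
    obtain ⟨b', hb', -⟩ := pick_one (L := B') (by omega)
    obtain ⟨a', ha', h1, h2⟩ := pick_three (L := A') (by omega) b b'
    obtain ⟨a, ha, h3, h4, h5⟩ := pick_four h4 a' b b'
    exact ⟨a, ha, a', ha', b, hb, b', hb', h3, h4, h5, h1, h2⟩
  by_cases h4' : 4 ≤ A'.card
  · obtain ⟨b, hb, -⟩ := pick_one (L := B) (by omega)
    obtain ⟨b', hb', -⟩ := pick_one (L := B') (by omega)
    obtain ⟨a, ha, h1, h2⟩ := pick_three (L := A) (by omega) b b'
    obtain ⟨a', ha', h3, h4, h5⟩ := pick_four h4' a b b'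
    exact ⟨a, ha, a', ha', b, hb, b', hb', h3.symm, h1, h2, h4, h5⟩
  by_cases hdis : Disjoint B B'
  · have hcard := Finset.card_union_of_disjoint hdis
    obtain ⟨x, hx, hxA⟩ := Finset.exists_mem_notMem_of_card_lt_card
      (s := A) (t := B ∪ B') (by omega)
    rcases Finset.mem_union.1 hx with hx | hx
    · obtain ⟨b', hb', -⟩ := pick_one (L := B') (by omega)
      obtain ⟨a', ha', h1, h2⟩ := pick_three (L := A') (by omega) x b'
      obtain ⟨a, ha, h3, h4⟩ := pick_three (L := A) (by omega) a' b'
      exact ⟨a, ha, a', ha', x, hx, b', hb', h3, fun h => hxA (h ▸ ha), h4, h1, h2⟩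
    · obtain ⟨b, hb, -⟩ := pick_one (L := B) (by omega)
      obtain ⟨a', ha', h1, h2⟩ := pick_three (L := A') (by omega) b x
      obtain ⟨a, ha, h3, h4⟩ := pick_three (L := A) (by omega) a' b
      exact ⟨a, ha, a', ha', b, hb, x, hx, h3, h4, fun h => hxA (h ▸ ha), h1, h2⟩
  · obtain ⟨b, hb, hb'⟩ := Finset.not_disjoint_iff.1 hdis
    obtain ⟨a', ha', h1⟩ := pick_two (L := A') (by omega) b
    obtain ⟨a, ha, h3, h4⟩ := pick_three (L := A) (by omega) a' b
    exact ⟨a, ha, a', ha', b, hb, b, hb', h3, h4, h4, h1, h1⟩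

end Lists

section Avail
open Classical

variable {V : Type} [Finite V] {G : SimpleGraph V}

/-- Nonzero colours compatible at `e` with the coloring of `D`. -/
noncomputable def avail (G : SimpleGraph V) (D : Set (Sym2 V)) (c : Sym2 V → Fin 8)
    (e : Sym2 V) : Finset (Fin 8) :=
  Finset.univ.filter fun k => k ≠ 0 ∧ ∀ f ∈ D, f ≠ e → Compat G e k f (c f)

lemma mem_avail {D : Set (Sym2 V)} {c : Sym2 V → Fin 8} {e : Sym2 V} {k : Fin 8} :
    k ∈ avail G D c e ↔ k ≠ 0 ∧ ∀ f ∈ D, f ≠ e → Compat G e k f (c f) := by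
  simp [avail]

lemma PG.avail_superset {D : Set (Sym2 V)} {c : Sym2 V → Fin 8} (h : PG G D c) {x y : V}
    (F : Finset (Fin 8)) (hx : ∀ z, G.Adj x z → z ≠ y → K D c z ⊆ F)
    (hy : ∀ z, G.Adj y z → z ≠ x → K D c z ⊆ F) {k : Fin 8} (hk : k ≠ 0) (hkF : k ∉ F) :
    k ∈ avail G D c s(x, y) :=
  mem_avail.2 ⟨hk, h.compat_edge hk (fun z hz hn hkz => hkF (hx z hz hn hkz))
    (fun z hz hn hkz => hkF (hy z hz hn hkz))⟩

lemma PG.card_avail {D : Set (Sym2 V)} {c : Sym2 V → Fin 8} (h : PG G D c) {x y : V}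
    (F : Finset (Fin 8)) (hx : ∀ z, G.Adj x z → z ≠ y → K D c z ⊆ F)
    (hy : ∀ z, G.Adj y z → z ≠ x → K D c z ⊆ F) :
    7 ≤ (avail G D c s(x, y)).card + F.card := by
  have : (insert 0 F)ᶜ ⊆ avail G D c s(x, y) := by
    intro k hk
    rw [Finset.mem_compl, Finset.mem_insert, not_or] at hk
    exact h.avail_superset F hx hy hk.1 hk.2
  have h1 := Finset.card_le_card this
  rw [Finset.card_compl, Fintype.card_fin] at h1
  have := Finset.card_insert_le 0 F
  omega

lemma MinCounter.false_of_avail (hG : MinCounter V G) {D : Set (Sym2 V)} {c : Sym2 V → Fin 8}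
    (h : PG G D c) (T : List (Sym2 V × Fin 8))
    (hT : ∀ p ∈ T, p.1 ∈ G.edgeSet ∧ p.2 ∈ avail G D c p.1)
    (hP : T.Pairwise (fun p q => p.2 ≠ q.2 ∨ ¬ Near G p.1 q.1))
    (hcov : ∀ e ∈ G.edgeSet, e ∈ D ∨ e ∈ T.map Prod.fst) : False := by
  refine hG.false_of_extend h T (fun p hp => ⟨(hT p hp).1, ?_, (mem_avail.1 (hT p hp).2).2⟩)
    (hP.imp fun hpq _ => ?_) hcov
  · intro h0
    exact ((mem_avail.1 (hT p hp).2).1 h0).elim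
  · exact hpq.elim compat_of_ne compat_of_not_near

/-- The edges avoiding `X` and a list containing those that meet `X` cover the edge set. -/
lemma cover_avoid {X : Set V} {T : List (Sym2 V)}
    (h : ∀ x ∈ X, ∀ y, G.Adj x y → s(x, y) ∈ T) :
    ∀ e ∈ G.edgeSet, e ∈ (avoid G X).edgeSet ∨ e ∈ T := by
  intro e he
  induction e with | _ a b
  by_cases ha : a ∈ X
  · exact Or.inr (h a ha b he)
  by_cases hb : b ∈ X
  · exact Or.inr (Sym2.eq_swap ▸ h b hb a he.symm)
  · exact Or.inl (mem_avoid.2 ⟨he, ha, hb⟩)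

end Avail

section DegreeTwo
open Classical

variable {V : Type} [Finite V] {G : SimpleGraph V}

/-- The vertex has a zero edge or degree at most two. -/
def Low (G : SimpleGraph V) (D : Set (Sym2 V)) (c : Sym2 V → Fin 8) (z : V) : Prop :=
  HasZero D c z ∨ (G.neighborSet z).ncard ≤ 2

lemma PG.low_card {D : Set (Sym2 V)} {c : Sym2 V → Fin 8} (h : PG G D c) (hG : Subcubic G)
    {z : V} (hz : Low G D c z) (W : Finset V) (hW : ∀ w ∈ W, G.Adj z w ∧ s(z, w) ∉ D) :
    (K D c z).card + W.card ≤ 2 := by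
  rcases hz with hz | hz
  · have := K_card_zero h hz W hW
    have := hG z
    omega
  · exact (K_card h.sub W fun w hw => ⟨(hW w hw).1, fun h => ((hW w hw).2 h).elim⟩).trans hz

lemma PG.exists_low {D : Set (Sym2 V)} {c : Sym2 V → Fin 8}
    (h : PG G D c) (hG : Subcubic G) : ∃ c', PG G D c' ∧ (∀ e, c' e = c e ∨ c' e = 0) ∧
      (∀ x y, s(x, y) ∈ D → Low G D c' x ∨ Low G D c' y) := by
  obtain ⟨c', h1, h2, h3⟩ := h.exists_zero_max
  refine ⟨c', h1, h2, fun x y hxy => ?_⟩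
  by_cases hx : V3 G x
  · by_cases hy : V3 G y
    · exact (h3 x y hxy hx hy).imp Or.inl Or.inl
    · right; right; have := hG y; unfold V3 at hy; omega
  · left; right; have := hG x; unfold V3 at hx; omega

lemma MinCounter.nbr_cases (hG : MinCounter V G) {b v : V} (h : G.Adj b v) :
    ∃ z₁ z₂, z₁ ≠ v ∧ z₂ ≠ v ∧ G.Adj b z₁ ∧ G.Adj b z₂ ∧
      (∀ z, G.Adj b z → z = v ∨ z = z₁ ∨ z = z₂) ∧
      ((z₁ ≠ z₂ ∧ V3 G b) ∨ (z₁ = z₂ ∧ (G.neighborSet b).ncard = 2)) := by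
  have h1 := card_nbrs h
  have h2 := hG.1 b
  obtain ⟨w, hw, hwv⟩ := hG.exists_adj_ne h
  have h3 : 0 < (nbrs G b v).card := Finset.card_pos.2 ⟨w, mem_nbrs.2 ⟨hw, hwv⟩⟩
  have hm : ∀ z, G.Adj b z → z = v ∨ z ∈ nbrs G b v := fun z hz => by
    rw [mem_nbrs]; tauto
  rcases (by omega : (nbrs G b v).card = 1 ∨ (nbrs G b v).card = 2) with h4 | h4
  · obtain ⟨z, hz⟩ := Finset.card_eq_one.1 h4
    have hz' := mem_nbrs.1 (hz ▸ Finset.mem_singleton_self z)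
    refine ⟨z, z, hz'.2, hz'.2, hz'.1, hz'.1, fun y hy => ?_, Or.inr ⟨rfl, by omega⟩⟩
    have := hm y hy
    rw [hz, Finset.mem_singleton] at this
    tauto
  · obtain ⟨z₁, z₂, hne, hz⟩ := Finset.card_eq_two.1 h4
    have hz1 : z₁ ∈ nbrs G b v := by rw [hz]; simp
    have hz2 : z₂ ∈ nbrs G b v := by rw [hz]; simp
    rw [mem_nbrs] at hz1 hz2
    refine ⟨z₁, z₂, hz1.2, hz2.2, hz1.1, hz2.1, fun y hy => ?_, Or.inl ⟨hne, ?_⟩⟩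
    · have := hm y hy
      rw [hz, Finset.mem_insert, Finset.mem_singleton] at this
      tauto
    · unfold V3; omega

lemma card_le_deg {x : V} (W : Finset V) (hW : ∀ w ∈ W, G.Adj x w) :
    W.card ≤ (G.neighborSet x).ncard := by
  rw [← Set.ncard_coe_finset]
  exact Set.ncard_le_ncard (fun w hw => hW w hw) (Set.toFinite _)

lemma near_mk {a b x y : V} : Near G s(a, b) s(x, y) ↔
    (a = x ∨ G.Adj a x) ∨ (a = y ∨ G.Adj a y) ∨ (b = x ∨ G.Adj b x) ∨ (b = y ∨ G.Adj b y) := by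
  simp only [Near, Sym2.mem_iff]
  constructor
  · rintro ⟨p, rfl | rfl, q, rfl | rfl, h⟩ <;> tauto
  · rintro (h | h | h | h)
    exacts [⟨a, by simp, x, by simp, h⟩, ⟨a, by simp, y, by simp, h⟩,
      ⟨b, by simp, x, by simp, h⟩, ⟨b, by simp, y, by simp, h⟩]

lemma MinCounter.outer_avail (hG : MinCounter V G) {D : Set (Sym2 V)} {c : Sym2 V → Fin 8}
    (h : PG G D c) (hlow : ∀ x y, s(x, y) ∈ D → Low G D c x ∨ Low G D c y) {v a b : V}
    (hbv : G.Adj b v) (hbD : s(b, v) ∉ D) (hv : ∀ z, G.Adj v z → z = a ∨ z = b)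
    (hK : (K D c a).card ≤ 1)
    (hz : ∀ z, G.Adj b z → z ≠ v → K D c z = ∅ ∨ s(b, z) ∈ D) :
    ((K D c b).card ≤ 1 ∧ 1 ≤ (avail G D c s(v, b)).card) ∨
      ((K D c b).card ≤ 2 ∧ 2 ≤ (avail G D c s(v, b)).card) := by
  obtain ⟨z₁, z₂, hz1, hz2, hb1, hb2, hN, hcase⟩ := hG.nbr_cases hbv
  have hW : ∀ w ∈ ({v} : Finset V), G.Adj b w ∧ s(b, w) ∉ D := by
    intro w hw
    rw [Finset.mem_singleton] at hw
    subst hw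
    exact ⟨hbv, hbD⟩
  have hav := h.card_avail (x := v) (y := b) (K D c a ∪ (K D c z₁ ∪ K D c z₂)) (by
      intro z hz hzb
      rcases hv z hz with rfl | rfl
      · exact Finset.subset_union_left
      · exact (hzb rfl).elim) (by
      intro z hz hzv
      rcases hN z hz with rfl | rfl | rfl
      · exact (hzv rfl).elim
      · exact Finset.subset_union_left.trans Finset.subset_union_right
      · exact Finset.subset_union_right.trans Finset.subset_union_right)
  have hu1 := Finset.card_union_le (K D c a) (K D c z₁ ∪ K D c z₂)
  have hu2 := Finset.card_union_le (K D c z₁) (K D c z₂)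
  have h31 := K_card_le_three hG.1 h.sub (c := c) z₁
  have h32 := K_card_le_three hG.1 h.sub (c := c) z₂
  have hlow1 : ∀ z, Low G D c z → (K D c z).card ≤ 2 := fun z hz => by
    simpa using h.low_card hG.1 hz ∅ (by simp)
  rcases hcase with ⟨hne, h3⟩ | ⟨rfl, h2⟩
  · by_cases hzero : HasZero D c b
    · left
      have := h.low_card hG.1 (Or.inl hzero) {v} hW
      rw [Finset.card_singleton] at this
      refine ⟨by omega, ?_⟩
      obtain ⟨e, he, ⟨w, rfl⟩, h0⟩ := hzero
      have hwz : (K D c w).card ≤ 2 := hlow1 w (Or.inl ⟨_, he, by simp, h0⟩)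
      rcases hN w (h.sub he) with rfl | rfl | rfl
      · exact (hbD he).elim
      · omega
      · omega
    · right
      have hnl : ¬ Low G D c b := by
        rintro (h | h)
        · exact hzero h
        · unfold V3 at h3; omega
      have hle : ∀ z, G.Adj b z → z ≠ v → (K D c z).card ≤ 2 := by
        intro z hbz hzv
        rcases hz z hbz hzv with h | h
        · simp [h]
        · exact hlow1 z ((hlow b z h).resolve_left hnl)
      have := hle z₁ hb1 hz1
      have := hle z₂ hb2 hz2
      have := K_card h.sub (c := c) {v} fun w hw => ⟨(hW w hw).1, fun h => ((hW w hw).2 h).elim⟩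
      rw [Finset.card_singleton] at this
      have := hG.1 b
      omega
  · left
    have := h.low_card hG.1 (Or.inr h2.le) {v} hW
    rw [Finset.card_singleton] at this
    rw [Finset.union_self] at hav hu1
    omega

/-- No vertex of degree three has two neighbours of degree two. -/
lemma MinCounter.no_two_deg_two (hG : MinCounter V G) {a v v' : V} (ha : V3 G a)
    (hav : G.Adj a v) (hav' : G.Adj a v') (hne : v ≠ v') (hv : (G.neighborSet v).ncard = 2)
    (hv' : (G.neighborSet v').ncard = 2) : False := by
  obtain ⟨b, b₂, hba, -, hvb, -, hNv, hcase⟩ := hG.nbr_cases hav.symm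
  obtain ⟨-, h3⟩ | ⟨rfl, -⟩ := hcase
  · unfold V3 at h3; omega
  obtain ⟨b', b₂, hba', -, hvb', -, hNv', hcase⟩ := hG.nbr_cases hav'.symm
  obtain ⟨-, h3⟩ | ⟨rfl, -⟩ := hcase
  · unfold V3 at h3; omega
  replace hNv : ∀ z, G.Adj v z → z = a ∨ z = b := fun z hz => by have := hNv z hz; tauto
  replace hNv' : ∀ z, G.Adj v' z → z = a ∨ z = b' := fun z hz => by have := hNv' z hz; tauto
  obtain ⟨a₂, ha2v, ha2v', haa2, hNa⟩ : ∃ a₂, a₂ ≠ v ∧ a₂ ≠ v' ∧ G.Adj a a₂ ∧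
      ∀ z, G.Adj a z → z = v ∨ z = v' ∨ z = a₂ := by
    obtain ⟨z₁, z₂, hz1, hz2, hb1, hb2, hN, hcase⟩ := hG.nbr_cases hav
    obtain ⟨hz, -⟩ | ⟨-, h2⟩ := hcase
    · rcases hN v' hav' with rfl | rfl | rfl
      · exact (hne rfl).elim
      · exact ⟨z₂, hz2, hz.symm, hb2, hN⟩
      · exact ⟨z₁, hz1, hz, hb1, fun z h => by have := hN z h; tauto⟩
    · unfold V3 at ha; omega
  obtain ⟨c₀, hc₀, -⟩ := hG.color_avoid {v, v'} (by simp) hav.symm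
  obtain ⟨c, hc, -, hlow⟩ := hc₀.exists_low hG.1
  set D := (avoid G {v, v'}).edgeSet with hD
  have hKv : K D c v = ∅ := K_avoid_empty (by simp)
  have hKv' : K D c v' = ∅ := K_avoid_empty (by simp)
  have hD1 : ∀ x, s(x, v) ∉ D := fun x h => (mem_avoid.1 h).2.2 (by simp)
  have hD2 : ∀ x, s(x, v') ∉ D := fun x h => (mem_avoid.1 h).2.2 (by simp)
  have hlow1 : ∀ z, Low G D c z → (K D c z).card ≤ 2 := fun z hz => by
    simpa using hc.low_card hG.1 hz ∅ (by simp)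
  have hlow2 : ∀ z w, Low G D c z → G.Adj z w → s(z, w) ∉ D → (K D c z).card ≤ 1 := by
    intro z w hz hzw hw
    have := hc.low_card hG.1 hz {w} (by simpa using ⟨hzw, hw⟩)
    rw [Finset.card_singleton] at this
    omega
  have hKle : ∀ z w, G.Adj z w → s(z, w) ∉ D → (K D c z).card ≤ 2 := by
    intro z w hzw hw
    have := K_card hc.sub (c := c) (z := z) {w} (by simpa using ⟨hzw, fun h => (hw h).elim⟩)
    rw [Finset.card_singleton] at this
    have := hG.1 z
    omega
  have hKa : (K D c a).card ≤ 1 := by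
    have := K_card hc.sub (c := c) (z := a) {v, v'} (by
      simpa using ⟨⟨hav, fun h => (hD1 a h).elim⟩, ⟨hav', fun h => (hD2 a h).elim⟩⟩)
    rw [Finset.card_pair hne] at this
    have := hG.1 a
    omega
  have hKa2 : (K D c a₂).card ≤ 2 := by
    by_cases haD : s(a, a₂) ∈ D
    · rcases hlow a a₂ haD with (⟨e, he, ⟨w, rfl⟩, h0⟩ | h) | h
      · rcases hNa w (hc.sub he) with rfl | rfl | rfl
        · exact (hD1 _ he).elim
        · exact (hD2 _ he).elim
        · exact hlow1 _ (Or.inl ⟨_, he, by simp, h0⟩)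
      · unfold V3 at ha; omega
      · exact hlow1 _ h
    · exact hKle a₂ a haa2.symm (by rwa [Sym2.eq_swap])
  have hava : ∀ {v v' b : V}, K D c v' = ∅ → (∀ z, G.Adj v z → z = a ∨ z = b) →
      (∀ z, G.Adj a z → z = v ∨ z = v' ∨ z = a₂) →
      7 ≤ (avail G D c s(v, a)).card + ((K D c b).card + (K D c a₂).card) := by
    intro v v' b hKv' hNv hNa
    refine (hc.card_avail (K D c b ∪ K D c a₂) ?_ ?_).trans
      (Nat.add_le_add_left (Finset.card_union_le _ _) _)
    · intro z hz hza
      rcases hNv z hz with rfl | rfl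
      · exact (hza rfl).elim
      · exact Finset.subset_union_left
    · intro z hz hzv
      rcases hNa z hz with rfl | rfl | rfl
      · exact (hzv rfl).elim
      · rw [hKv']; exact Finset.empty_subset _
      · exact Finset.subset_union_right
  have hA := hava hKv' hNv hNa
  have hA' := hava hKv hNv' (fun z hz => by have := hNa z hz; tauto)
  have hfin : ∀ ka kb ka' kb', ka ∈ avail G D c s(v, a) → kb ∈ avail G D c s(v, b) →
      ka' ∈ avail G D c s(v', a) → kb' ∈ avail G D c s(v', b') →
      ka ≠ kb → ka ≠ ka' → ka ≠ kb' → ka' ≠ kb → ka' ≠ kb' →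
      (kb ≠ kb' ∨ ¬ Near G s(v, b) s(v', b')) → False := by
    intro ka kb ka' kb' h1 h2 h3 h4 n1 n2 n3 n4 n5 n6
    refine hG.false_of_avail hc [(s(v, a), ka), (s(v, b), kb), (s(v', a), ka'), (s(v', b'), kb')]
      ?_ ?_ ?_
    · simp only [List.mem_cons, List.not_mem_nil, or_false, forall_eq_or_imp, forall_eq]
      exact ⟨⟨hav.symm, h1⟩, ⟨hvb, h2⟩, ⟨hav'.symm, h3⟩, ⟨hvb', h4⟩⟩
    · simp [n1, n2, n3, n4.symm, n5, n6]
    · refine cover_avoid ?_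
      intro x hx y hxy
      simp only [List.map_cons, List.map_nil, List.mem_cons]
      rcases hx with rfl | hx
      · rcases hNv y hxy with rfl | rfl <;> simp
      · rw [Set.mem_singleton_iff] at hx
        subst hx
        rcases hNv' y hxy with rfl | rfl <;> simp
  by_cases hbv' : b = v'
  · subst hbv'
    obtain rfl : b' = v := by
      rcases hNv' v hvb.symm with h | h
      · exact (hav.ne h.symm).elim
      · exact h.symm
    have hB := hc.card_avail (x := b') (y := b) (K D c a) (by
        intro z hz hzb
        rcases hNv z hz with rfl | rfl
        · exact subset_rfl
        · exact (hzb rfl).elim) (by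
        intro z hz hzb
        rcases hNv' z hz with rfl | rfl
        · exact subset_rfl
        · exact (hzb rfl).elim)
    rw [hKv, Finset.card_empty] at hA'
    rw [hKv', Finset.card_empty] at hA
    obtain ⟨k, hk, -⟩ := pick_one (L := avail G D c s(b', a)) (by omega)
    obtain ⟨k', hk', h1⟩ := pick_two (L := avail G D c s(b, a)) (by omega) k
    obtain ⟨l, hl, h2, h3⟩ := pick_three (L := avail G D c s(b', b)) (by omega) k k'
    refine hG.false_of_avail hc [(s(b', a), k), (s(b, a), k'), (s(b', b), l)] ?_ ?_ ?_
    · simp only [List.mem_cons, List.not_mem_nil, or_false, forall_eq_or_imp, forall_eq]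
      exact ⟨⟨hav.symm, hk⟩, ⟨hav'.symm, hk'⟩, ⟨hvb, hl⟩⟩
    · simp [h1.symm, h2.symm, h3.symm]
    · refine cover_avoid ?_
      intro x hx y hxy
      simp only [List.map_cons, List.map_nil, List.mem_cons]
      rcases hx with rfl | hx
      · rcases hNv y hxy with rfl | rfl <;> simp
      · rw [Set.mem_singleton_iff] at hx
        subst hx
        rcases hNv' y hxy with rfl | rfl <;> simp
  have hb'v : b' ≠ v := by
    rintro rfl
    rcases hNv v' hvb'.symm with h | h
    · exact hav'.ne h.symm
    · exact hbv' h.symm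
  have hzb : ∀ b, b ≠ v → b ≠ v' → ∀ z, G.Adj b z → K D c z = ∅ ∨ s(b, z) ∈ D := by
    intro b h1 h2 z hz
    by_cases hzX : z ∈ ({v, v'} : Set V)
    · exact Or.inl (K_avoid_empty hzX)
    · exact Or.inr (mem_avoid.2 ⟨hz, by simp [h1, h2], hzX⟩)
  have hB := hG.outer_avail hc hlow hvb.symm (hD1 b) hNv hKa
    fun z hz _ => hzb b hvb.ne' hbv' z hz
  have hB' := hG.outer_avail hc hlow hvb'.symm (hD2 b') hNv' hKa
    fun z hz _ => hzb b' hb'v hvb'.ne' z hz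
  by_cases hbb : b = b'
  · subst hbb
    have hKb : (K D c b).card ≤ 1 := by
      have := K_card hc.sub (c := c) (z := b) {v, v'} (by
        simpa using ⟨⟨hvb.symm, fun h => (hD1 b h).elim⟩, ⟨hvb'.symm, fun h => (hD2 b h).elim⟩⟩)
      rw [Finset.card_pair hne] at this
      have := hG.1 b
      omega
    have key : ∀ {v v' : V}, G.Adj b v → G.Adj b v' → v ≠ v' → K D c v' = ∅ →
        (∀ z, G.Adj v z → z = a ∨ z = b) → 3 ≤ (avail G D c s(v, b)).card := by
      intro v v' hbv hbv' hne hKv' hNv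
      obtain ⟨z₁, hz1⟩ : ∃ z₁, ∀ z, G.Adj b z → z = v ∨ z = v' ∨ z = z₁ := by
        obtain ⟨z₁, z₂, -, -, -, -, hN, -⟩ := hG.nbr_cases hbv
        rcases hN v' hbv' with rfl | rfl | rfl
        · exact (hne rfl).elim
        · exact ⟨z₂, hN⟩
        · exact ⟨z₁, fun z h => by have := hN z h; tauto⟩
      have h1 := hc.card_avail (x := v) (y := b) (K D c a ∪ K D c z₁) (by
        intro z hz hzb
        rcases hNv z hz with rfl | rfl
        · exact Finset.subset_union_left
        · exact (hzb rfl).elim) (by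
        intro z hz hzv
        rcases hz1 z hz with rfl | rfl | rfl
        · exact (hzv rfl).elim
        · rw [hKv']; exact Finset.empty_subset _
        · exact Finset.subset_union_right)
      have h2 := Finset.card_union_le (K D c a) (K D c z₁)
      have h3 := K_card_le_three hG.1 hc.sub (c := c) z₁
      omega
    have k1 := key hvb.symm hvb'.symm hne hKv' hNv
    have k2 := key hvb'.symm hvb.symm hne.symm hKv hNv'
    obtain ⟨x, hx, y, hy, z, hz, t, ht, h1, h2, h3, h4, h5, h6⟩ := greedy_four
      (A := avail G D c s(v, b)) (B := avail G D c s(v', b)) (C := avail G D c s(v, a))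
      (D := avail G D c s(v', a)) (by omega) (by omega) (by omega) (by omega)
    exact hfin z x t y hz hx ht hy h2.symm h6 h4.symm h3.symm h5.symm (Or.inl h1)
  by_cases hadj : G.Adj b b'
  swap
  · obtain ⟨x, hx, y, hy, z, hz, t, ht, h1, h2, h3, h4, h5⟩ := diamond_choice
      (A := avail G D c s(v, a)) (B := avail G D c s(v, b)) (A' := avail G D c s(v', a))
      (B' := avail G D c s(v', b')) (by omega) (by omega)
    refine hfin x z y t hx hz hy ht h2 h1 h3 h4 h5 (Or.inr ?_)
    rw [near_mk]
    rintro ((h | h) | (h | h) | (h | h) | (h | h))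
    · exact hne h
    · rcases hNv _ h with h | h
      exacts [hav'.ne h.symm, hbv' h.symm]
    · exact hb'v h.symm
    · rcases hNv _ h with h | h
      exacts [hba' h, hbb h.symm]
    · exact hbv' h
    · rcases hNv' _ h.symm with h | h
      exacts [hba h, hbb h]
    · exact hbb h
    · exact hadj h
  have hbD : s(b, b') ∈ D := mem_avoid.2 ⟨hadj, by simp [hvb.ne', hbv'], by simp [hb'v, hvb'.ne']⟩
  have outer : ∀ {v b b' : V}, G.Adj b v → G.Adj b b' → v ≠ b' →
      (∀ z, G.Adj v z → z = a ∨ z = b) → ∀ n, (∀ z, G.Adj b z → z ≠ v → z ≠ b' →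
        (K D c z).card ≤ n) →
      7 ≤ (avail G D c s(v, b)).card + (1 + (K D c b').card + n) := by
    intro v b b' hbv hbb' hvb' hNv n hn
    obtain ⟨z₁, hN, hz1⟩ : ∃ z₁, (∀ z, G.Adj b z → z = v ∨ z = b' ∨ z = z₁) ∧
        (K D c z₁ \ K D c b').card ≤ n := by
      obtain ⟨z₁, z₂, h1, h2, h3, h4, hN, h5⟩ := hG.nbr_cases hbv
      have hle : ∀ z, G.Adj b z → z ≠ v → (K D c z \ K D c b').card ≤ n := by
        intro z hz hzv
        by_cases hzb : z = b'
        · subst hzb; simp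
        · exact (Finset.card_le_card Finset.sdiff_subset).trans (hn z hz hzv hzb)
      rcases hN b' hbb' with rfl | rfl | rfl
      · exact (hvb' rfl).elim
      · exact ⟨z₂, hN, hle z₂ h4 h2⟩
      · exact ⟨z₁, fun z h => by have := hN z h; tauto, hle z₁ h3 h1⟩
    have h1 := hc.card_avail (x := v) (y := b) (K D c a ∪ (K D c b' ∪ K D c z₁ \ K D c b')) (by
      intro z hz hzb
      rcases hNv z hz with rfl | rfl
      · exact Finset.subset_union_left
      · exact (hzb rfl).elim) (by
      intro z hz hzv
      rw [Finset.union_sdiff_self_eq_union]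
      rcases hN z hz with rfl | rfl | rfl
      · exact (hzv rfl).elim
      · exact Finset.subset_union_left.trans Finset.subset_union_right
      · exact Finset.subset_union_right.trans Finset.subset_union_right)
    have h2 := Finset.card_union_le (K D c a) (K D c b' ∪ K D c z₁ \ K D c b')
    have h3 := Finset.card_union_le (K D c b') (K D c z₁ \ K D c b')
    omega
  have hb3 : ∀ z, (K D c z).card ≤ 3 := fun z => K_card_le_three hG.1 hc.sub z
  have o1 := fun n => outer hvb.symm hadj hb'v.symm hNv n
  have o2 := fun n => outer hvb'.symm hadj.symm (fun h => hbv' h.symm) hNv' n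
  have third : ∀ {v b b' : V}, G.Adj b v → G.Adj b b' → v ≠ b' → s(b, v) ∉ D →
      c s(b, b') ≠ 0 → (∀ z, G.Adj b z → K D c z = ∅ ∨ s(b, z) ∈ D) →
      ∀ z, G.Adj b z → z ≠ v → z ≠ b' → (K D c z).card ≤ 2 := by
    intro v b b' hbv hbb' hvb' hbD h0 hzD z hz hzv hzb'
    rcases hzD z hz with h | h
    · simp [h]
    rcases hlow b z h with (⟨e, he, ⟨w, rfl⟩, hw0⟩ | h2) | h
    · have hwv : w ≠ v := by rintro rfl; exact hbD he
      have hwb' : w ≠ b' := by rintro rfl; exact h0 hw0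
      by_cases hwz : w = z
      · subst hwz
        exact hlow1 _ (Or.inl ⟨_, he, by simp, hw0⟩)
      · have := card_le_deg (G := G) (x := b) {v, b', z, w} (by
          simpa using ⟨hbv, hbb', hz, hc.sub he⟩)
        rw [Finset.card_eq_of_equiv_fin (n := 4)] at this
        · have := hG.1 b
          omega
        · refine (Finset.equivFinOfCardEq ?_)
          rw [Finset.card_insert_of_notMem, Finset.card_insert_of_notMem, Finset.card_pair] <;>
            simp [hvb', hzv.symm, hzb'.symm, hwv.symm, hwb'.symm, Ne.symm hwz]
    · have := card_le_deg (G := G) (x := b) {v, b', z} (by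
          simpa using ⟨hbv, hbb', hz⟩)
      rw [Finset.card_insert_of_notMem, Finset.card_pair] at this
      · omega
      · exact hzb'.symm
      · simp [hvb', hzv.symm]
    · exact hlow1 _ h
  have hbl := fun h => hlow2 b v h hvb.symm (hD1 b)
  have hbl' := fun h => hlow2 b' v' h hvb'.symm (hD2 b')
  have hKb := hKle b v hvb.symm (hD1 b)
  have hKb' := hKle b' v' hvb'.symm (hD2 b')
  by_cases h0 : c s(b, b') = 0
  · have l1 := hbl (Or.inl ⟨_, hbD, by simp, h0⟩)
    have l2 := hbl' (Or.inl ⟨_, hbD, by simp, h0⟩)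
    have := o1 3 fun z _ _ _ => hb3 z
    have := o2 3 fun z _ _ _ => hb3 z
    obtain ⟨x, hx, y, hy, z, hz, t, ht, h1, h2, h3, h4, h5, h6⟩ := greedy_four
      (A := avail G D c s(v, b)) (B := avail G D c s(v', b')) (C := avail G D c s(v, a))
      (D := avail G D c s(v', a)) (by omega) (by omega) (by omega) (by omega)
    exact hfin z x t y hz hx ht hy h2.symm h6 h4.symm h3.symm h5.symm (Or.inl h1)
  have m1 := o1 2 (third hvb.symm hadj hb'v.symm (hD1 b) h0 (hzb b hvb.ne' hbv'))
  have m2 := o2 2 (third hvb'.symm hadj.symm (fun h => hbv' h.symm) (hD2 b')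
    (by rwa [Sym2.eq_swap]) (hzb b' hb'v hvb'.ne'))
  rcases hlow b b' hbD with hl | hl
  · have := hbl hl
    obtain ⟨x, hx, y, hy, z, hz, t, ht, h1, h2, h3, h4, h5, h6⟩ := greedy_four
      (A := avail G D c s(v, b)) (B := avail G D c s(v', b')) (C := avail G D c s(v', a))
      (D := avail G D c s(v, a)) (by omega) (by omega) (by omega) (by omega)
    exact hfin t x z y ht hx hz hy h3.symm h6.symm h5.symm h2.symm h4.symm (Or.inl h1)
  · have := hbl' hl
    obtain ⟨x, hx, y, hy, z, hz, t, ht, h1, h2, h3, h4, h5, h6⟩ := greedy_four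
      (A := avail G D c s(v', b')) (B := avail G D c s(v, b)) (C := avail G D c s(v, a))
      (D := avail G D c s(v', a)) (by omega) (by omega) (by omega) (by omega)
    exact hfin z y t x hz hy ht hx h4.symm h6 h2.symm h5.symm h3.symm (Or.inl h1.symm)

end DegreeTwo

section Matching
open Classical

variable {V : Type} [Finite V] {G : SimpleGraph V}

lemma even_card_adj_pairs (A : Finset V) :
    Even ((A ×ˢ A).filter fun p => G.Adj p.1 p.2).card := by
  rw [← ZMod.natCast_eq_zero_iff_even, Finset.card_eq_sum_ones, Nat.cast_sum]
  refine Finset.sum_involution (fun p _ => p.swap) ?_ ?_ ?_ ?_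
  · intro p _; decide
  · rintro ⟨x, y⟩ h _ heq
    rw [Finset.mem_filter] at h
    exact h.2.ne (Prod.ext_iff.1 heq).2
  · rintro ⟨x, y⟩ h
    simp only [Finset.mem_filter, Finset.mem_product, Prod.swap] at h ⊢
    exact ⟨h.1.symm, h.2.symm⟩
  · intro p _; simp

lemma MinCounter.three_le_cut (hG : MinCounter V G) (A : Finset V) (hodd : Odd A.card)
    (hA : ∀ x ∈ A, V3 G x) :
    3 ≤ {p : V × V | p.1 ∈ A ∧ p.2 ∉ A ∧ G.Adj p.1 p.2}.ncard := by
  have := Fintype.ofFinite V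
  have hset : {p : V × V | p.1 ∈ A ∧ p.2 ∉ A ∧ G.Adj p.1 p.2} =
      ((A ×ˢ Aᶜ).filter fun p => G.Adj p.1 p.2 : Finset (V × V)) := by
    ext p
    simp [and_assoc]
  have hcard : ((A ×ˢ Finset.univ).filter fun p => G.Adj p.1 p.2).card = 3 * A.card := by
    rw [Finset.card_filter, Finset.sum_product, mul_comm, ← smul_eq_mul, ← Finset.sum_const]
    refine Finset.sum_congr rfl fun x hx => ?_
    rw [← hA x hx, ← Finset.card_filter, ← Set.ncard_coe_finset]
    congr 1
    ext y
    simp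
  have hsplit : ((A ×ˢ Finset.univ).filter fun p => G.Adj p.1 p.2).card =
      ((A ×ˢ A).filter fun p => G.Adj p.1 p.2).card +
      ((A ×ˢ Aᶜ).filter fun p => G.Adj p.1 p.2).card := by
    rw [← Finset.card_union_of_disjoint, ← Finset.filter_union, ← Finset.product_union,
      Finset.union_compl]
    rw [Finset.disjoint_left]
    rintro ⟨x, y⟩ h1 h2
    simp at h1 h2
    tauto
  obtain ⟨r, hr⟩ := even_card_adj_pairs (G := G) A
  obtain ⟨s, hs⟩ := hodd
  rw [hset, Set.ncard_coe_finset]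
  by_contra hlt
  have h1 : ((A ×ˢ Aᶜ).filter fun p => G.Adj p.1 p.2).card = 1 := by omega
  obtain ⟨⟨a, b⟩, hab⟩ := Finset.card_eq_one.1 h1
  have hmem : ∀ x y, (x ∈ A ∧ y ∉ A ∧ G.Adj x y) ↔ x = a ∧ y = b := by
    intro x y
    have : (x, y) ∈ ((A ×ˢ Aᶜ).filter fun p => G.Adj p.1 p.2) ↔ (x, y) = (a, b) := by
      rw [hab, Finset.mem_singleton]
    simpa [and_assoc] using this
  obtain ⟨ha, hb, hadj⟩ := (hmem a b).2 ⟨rfl, rfl⟩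
  exact hG.no_cut_one (A : Set V) ha hb hadj fun x hx y hy h => (hmem x y).1 ⟨hx, hy, h⟩

/-- Two copies of `G` whose vertices of degree less than three form a clique. -/
def doubled (G : SimpleGraph V) : SimpleGraph (V × Bool) where
  Adj p q := (p.2 = q.2 ∧ G.Adj p.1 q.1) ∨ (p ≠ q ∧ ¬ V3 G p.1 ∧ ¬ V3 G q.1)
  symm := ⟨fun _ _ h => h.imp (fun h => ⟨h.1.symm, h.2.symm⟩) fun h => ⟨h.1.symm, h.2.2, h.2.1⟩⟩
  loopless := ⟨fun _ h => h.elim (fun h => h.2.ne rfl) fun h => h.1 rfl⟩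

/-- The doubled graph with the vertices in `U` removed. -/
abbrev doubledMinus (G : SimpleGraph V) (U : Set (V × Bool)) :=
  ((⊤ : (doubled G).Subgraph).deleteVerts U).coe

lemma doubledMinus_adj {U : Set (V × Bool)} (p q) :
    (doubledMinus G U).Adj p q ↔ (doubled G).Adj p.1 q.1 := by
  obtain ⟨p, hp⟩ := p
  obtain ⟨q, hq⟩ := q
  simp only [Subgraph.deleteVerts_verts, Subgraph.verts_top, Set.mem_sdiff, Set.mem_univ,
    true_and] at hp hq
  simp [hp, hq]

lemma MinCounter.three_le_component_cut (hG : MinCounter V G) (U : Set (V × Bool))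
    (C : (doubledMinus G U).ConnectedComponent)
    (hodd : Odd C.supp.ncard) (hC : ∀ p ∈ C.supp, V3 G p.1.1) :
    3 ≤ {q : (V × Bool) × (V × Bool) | q.1 ∈ Subtype.val '' C.supp ∧ q.2 ∈ U ∧
      q.1.2 = q.2.2 ∧ G.Adj q.1.1 q.2.1}.ncard := by
  have hstep : ∀ p q, p ∈ C.supp → (doubledMinus G U).Adj p q → q ∈ C.supp ∧ p.1.2 = q.1.2 := by
    intro p q hp hpq
    refine ⟨(C.mem_supp_congr_adj hpq).1 hp, ?_⟩
    rcases (doubledMinus_adj p q).1 hpq with h | h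
    · exact h.1
    · exact (h.2.1 (hC p hp)).elim
  have hcopy : ∀ p q, (doubledMinus G U).Walk p q → p ∈ C.supp → p.1.2 = q.1.2 := by
    intro p q w
    induction w with
    | nil => intro _; rfl
    | cons h _ ih => intro hp; exact (hstep _ _ hp h).2.trans (ih (hstep _ _ hp h).1)
  obtain ⟨p₀, hp₀⟩ := C.nonempty_supp
  set i := p₀.1.2
  have hi : ∀ p ∈ C.supp, p.1.2 = i := by
    intro p hp
    obtain ⟨w⟩ := C.reachable_of_mem_supp hp₀ hp
    exact (hcopy _ _ w hp₀).symm
  let A : Finset V := (Set.toFinite ((fun p => p.1.1) '' C.supp)).toFinset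
  have hAmem : ∀ x, x ∈ A ↔ ∃ p ∈ C.supp, p.1.1 = x := by intro x; simp [A]
  have hAcard : A.card = C.supp.ncard := by
    rw [← Set.ncard_eq_toFinset_card]
    apply Set.InjOn.ncard_image
    intro p hp q hq hpq
    exact Subtype.ext (Prod.ext hpq ((hi p hp).trans (hi q hq).symm))
  refine (hG.three_le_cut A (hAcard ▸ hodd) ?_).trans ?_
  · intro x hx
    obtain ⟨p, hp, rfl⟩ := (hAmem x).1 hx
    exact hC p hp
  · apply Set.ncard_le_ncard_of_injOn (fun p => ((p.1, i), (p.2, i)))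
    · rintro ⟨x, y⟩ ⟨hx, hy, hxy⟩
      obtain ⟨p, hp, rfl⟩ := (hAmem x).1 hx
      have hpi : (p.1.1, i) = p.1 := Prod.ext rfl (hi p hp).symm
      refine ⟨⟨p, hp, hpi.symm⟩, ?_, rfl, hxy⟩
      by_contra hyU
      have hq : (doubledMinus G U).Adj p ⟨(y, i), by simpa using hyU⟩ := (doubledMinus_adj _ _).2 (Or.inl ⟨hi p hp, hxy⟩)
      exact hy ((hAmem y).2 ⟨_, (hstep _ _ hp hq).1, rfl⟩)
    · rintro ⟨x, y⟩ _ ⟨z, w⟩ _ h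
      simpa using h

end Matching

section Matching2
open Classical

variable {V : Type} [Finite V] {G : SimpleGraph V}

lemma cut_card_le (hG : Subcubic G) (U : Finset (V × Bool)) :
    {q : (V × Bool) × (V × Bool) | q.2 ∈ U ∧ q.1.2 = q.2.2 ∧ G.Adj q.1.1 q.2.1}.ncard
      ≤ 3 * U.card := by
  have := Fintype.ofFinite V
  rw [Set.ncard_eq_toFinset_card']
  have hsub : {q : (V × Bool) × (V × Bool) | q.2 ∈ U ∧ q.1.2 = q.2.2 ∧
      G.Adj q.1.1 q.2.1}.toFinset ⊆
      U.biUnion fun u => (Finset.univ.filter fun y => G.Adj u.1 y).image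
        fun y => (((y, u.2), u) : (V × Bool) × (V × Bool)) := by
    rintro ⟨⟨y, i⟩, u⟩ h
    simp only [Set.mem_toFinset, Set.mem_ofPred_eq] at h
    simp only [Finset.mem_biUnion, Finset.mem_image, Finset.mem_filter, Finset.mem_univ,
      true_and]
    exact ⟨u, h.1, y, h.2.2.symm, by rw [← h.2.1]⟩
  refine (Finset.card_le_card hsub).trans ?_
  rw [mul_comm]
  refine Finset.card_biUnion_le_card_mul _ _ _ fun u _ => Finset.card_image_le.trans ?_
  refine le_trans (le_of_eq ?_) (hG u.1)
  rw [← Set.ncard_coe_finset]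
  congr 1
  ext y
  simp

lemma MinCounter.not_isTutteViolator (hG : MinCounter V G) (U : Set (V × Bool)) :
    ¬ (doubled G).IsTutteViolator U := by
  have := Fintype.ofFinite V
  intro hU
  unfold IsTutteViolator at hU
  change U.ncard < (doubledMinus G U).oddComponents.ncard at hU
  have hfin : Finite (doubledMinus G U).ConnectedComponent := inferInstance
  have := Fintype.ofFinite (doubledMinus G U).ConnectedComponent
  set S := (doubledMinus G U).oddComponents with hS
  set S₁ := S.toFinset.filter fun C => ∀ p ∈ C.supp, V3 G p.1.1 with hS₁
  set S₂ := S.toFinset.filter fun C => ¬ ∀ p ∈ C.supp, V3 G p.1.1 with hS₂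
  have hsum : S₁.card + S₂.card = S.ncard := by
    rw [Set.ncard_eq_toFinset_card']
    exact Finset.card_filter_add_card_filter_not _
  have h2 : S₂.card ≤ 1 := by
    rw [Finset.card_le_one]
    intro C hC C' hC'
    simp only [hS₂, Finset.mem_filter] at hC hC'
    have hC := hC.2
    have hC' := hC'.2
    push Not at hC hC'
    obtain ⟨p, hp, hp3⟩ := hC
    obtain ⟨q, hq, hq3⟩ := hC'
    rw [ConnectedComponent.mem_supp_iff] at hp hq
    rw [← hp, ← hq, ConnectedComponent.eq]
    by_cases hpq : p = q
    · rw [hpq]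
    · refine Adj.reachable ?_
      rw [doubledMinus_adj]
      exact Or.inr ⟨fun h => hpq (Subtype.ext h), hp3, hq3⟩
  let E : (doubledMinus G U).ConnectedComponent → Set ((V × Bool) × (V × Bool)) := fun C =>
    {q | q.1 ∈ Subtype.val '' C.supp ∧ q.2 ∈ U ∧ q.1.2 = q.2.2 ∧ G.Adj q.1.1 q.2.1}
  have h1 : 3 * S₁.card ≤ 3 * U.ncard := by
    calc 3 * S₁.card = S₁.card • 3 := by simp [mul_comm]
      _ ≤ ∑ C ∈ S₁, (E C).toFinset.card := by
          refine Finset.card_nsmul_le_sum _ _ _ fun C hC => ?_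
          simp only [hS₁, Finset.mem_filter, Set.mem_toFinset] at hC
          rw [← Set.ncard_eq_toFinset_card']
          exact hG.three_le_component_cut U C hC.1 hC.2
      _ = (S₁.biUnion fun C => (E C).toFinset).card := by
          refine (Finset.card_biUnion ?_).symm
          intro C _ C' _ hne
          rw [Function.onFun, Finset.disjoint_left]
          intro q hq hq'
          simp only [E, Set.mem_toFinset, Set.mem_ofPred_eq] at hq hq'
          obtain ⟨⟨p, hp, hpq⟩, -⟩ := hq
          obtain ⟨⟨p', hp', hpq'⟩, -⟩ := hq'
          have : p = p' := Subtype.ext (hpq.trans hpq'.symm)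
          subst this
          rw [ConnectedComponent.mem_supp_iff] at hp hp'
          exact hne (hp.symm.trans hp')
      _ ≤ _ := by
          refine le_trans ?_ (Set.ncard_eq_toFinset_card' U ▸ cut_card_le hG.1 U.toFinset)
          rw [← Set.ncard_coe_finset]
          refine Set.ncard_le_ncard ?_ (Set.toFinite _)
          intro q hq
          simp only [E, Finset.coe_biUnion, Set.mem_iUnion, Set.coe_toFinset,
            Set.mem_ofPred_eq] at hq
          obtain ⟨C, _, _, hq⟩ := hq
          simpa using hq
  have hpar := odd_ncard_oddComponents (G := doubledMinus G U)
  rw [← hS] at hpar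
  have hcard : Nat.card ((⊤ : (doubled G).Subgraph).deleteVerts U).verts + U.ncard =
      2 * Nat.card V := by
    rw [Nat.card_coe_set_eq, Subgraph.deleteVerts_verts, Subgraph.verts_top,
      Set.ncard_sdiff_add_ncard_of_subset (Set.subset_univ _), Set.ncard_univ, Nat.card_prod]
    simp [mul_comm]
  rw [Nat.odd_iff, Nat.odd_iff] at hpar
  omega

/-- A matching of the cubic vertices of a minimal counterexample. -/
lemma MinCounter.exists_matching (hG : MinCounter V G) :
    ∃ m : V → V, (∀ x, V3 G x → G.Adj x (m x)) ∧
      (∀ x y, V3 G x → V3 G y → m x = m y → x = y) ∧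
      (∀ x, V3 G x → V3 G (m x) → m (m x) = x) := by
  have := Fintype.ofFinite V
  obtain ⟨M, hM⟩ := tutte.2 fun U => hG.not_isTutteViolator U
  rw [Subgraph.isPerfectMatching_iff] at hM
  choose f hf huniq using hM
  have hadj : ∀ x, V3 G x → G.Adj x (f (x, false)).1 ∧ (f (x, false)).2 = false := by
    intro x hx
    rcases M.adj_sub (hf (x, false)) with h | h
    · exact ⟨h.2, h.1.symm⟩
    · exact (h.2.1 hx).elim
  have hff : ∀ p, f (f p) = p := fun p => (huniq _ _ (hf p).symm).symm
  have hex : ∀ x, V3 G x → f (x, false) = ((f (x, false)).1, false) := fun x hx =>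
    Prod.ext rfl (hadj x hx).2
  refine ⟨fun x => (f (x, false)).1, fun x hx => (hadj x hx).1, ?_, ?_⟩
  · intro x y hx hy h
    dsimp only at h
    have : f (x, false) = f (y, false) := by rw [hex x hx, hex y hy, h]
    have h2 := congrArg f this
    rw [hff, hff] at h2
    exact congrArg Prod.fst h2
  · intro x hx _
    have h2 := hff (x, false)
    rw [hex x hx] at h2
    exact congrArg Prod.fst h2

end Matching2

section DegTwo
open Classical

variable {V : Type} [Finite V] {G : SimpleGraph V}

/-- Colour the edges of `S` with nonzero colours in order of decreasing `lev`. -/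
lemma PG.extend_by_level {D : Set (Sym2 V)} {c : Sym2 V → Fin 8} (h : PG G D c)
    (lev : Sym2 V → ℕ) :
    ∀ (n : ℕ) (S : Set (Sym2 V)), S.ncard = n → S ⊆ G.edgeSet → (∀ e ∈ S, e ∉ D) →
    (∀ e ∈ S, ∀ D' c', D' ⊆ D ∪ S → e ∉ D' → (∀ f ∈ S, f ∈ D' → lev e ≤ lev f) →
      PG G D' c' → (∀ f ∈ D, c' f = c f) →
      ∃ k, k ≠ 0 ∧ ∀ f ∈ D', f ≠ e → Compat G e k f (c' f)) →
    ∃ c', PG G (D ∪ S) c' ∧ ∀ f ∈ D, c' f = c f := by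
  intro n
  induction n with
  | zero =>
    intro S hS _ _ _
    rw [Set.ncard_eq_zero] at hS
    subst hS
    exact ⟨c, by simpa using h, fun _ _ => rfl⟩
  | succ n ih =>
    intro S hS hSG hdis hstep
    have hne : S.Nonempty := by
      rw [Set.nonempty_iff_ne_empty]
      rintro rfl
      simp at hS
    obtain ⟨e, heS, hmin⟩ := Set.exists_min_image S lev (Set.toFinite S) hne
    obtain ⟨c₁, h₁, hc₁⟩ := ih (S \ {e}) (by
      rw [Set.ncard_sdiff_singleton_of_mem heS, hS]; rfl) (Set.sdiff_subset.trans hSG)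
      (fun f hf => hdis f hf.1) (by
      intro f hf D' c' hD' hfD' hlev hP hc'
      refine hstep f hf.1 D' c' (hD'.trans (Set.union_subset_union_right _ Set.sdiff_subset))
        hfD' ?_ hP hc'
      intro g hg hgD
      rcases hD' hgD with hgD' | hgS
      · exact (hdis g hg hgD').elim
      · exact hlev g hgS hgD)
    have hDS : D ∪ S = insert e (D ∪ S \ {e}) := by
      ext g
      by_cases hg : g = e
      · subst hg; simp [heS]
      · simp [hg]
    obtain ⟨k, hk, hcomp⟩ := hstep e heS (D ∪ S \ {e}) c₁
      (Set.union_subset_union_right _ Set.sdiff_subset) (by simp [hdis e heS])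
      (fun f hf _ => hmin f hf) h₁ hc₁
    obtain ⟨c₂, h₂, hc₂, -⟩ := h₁.insert_edge (hSG heS) (fun h => (hk h).elim) hcomp
    exact ⟨c₂, hDS ▸ h₂, fun f hf => (hc₂ f (Or.inl hf)).trans (hc₁ f hf)⟩

/-- A cubic vertex not covered by the edges of `Z`. -/
def Unsat (G : SimpleGraph V) (Z : Set (Sym2 V)) (u : V) : Prop := V3 G u ∧ ∀ e ∈ Z, u ∉ e

/-- A matching of cubic vertices such that every unsaturated cubic vertex can be assigned
a neighbour of degree two. -/
structure ZeroMatching (G : SimpleGraph V) (Z : Set (Sym2 V)) : Prop where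
  sub : Z ⊆ G.edgeSet
  cubic : ∀ e ∈ Z, ∀ x ∈ e, V3 G x
  matching : ∀ e ∈ Z, ∀ f ∈ Z, ∀ x ∈ e, x ∈ f → e = f
  late : ∀ u, Unsat G Z u → ∃ v, G.Adj u v ∧ (G.neighborSet v).ncard = 2 ∧
    ∀ w, G.Adj v w → w ≠ u → ¬ Unsat G Z w

lemma MinCounter.two_le_deg (hG : MinCounter V G) (x : V) : 2 ≤ (G.neighborSet x).ncard := by
  obtain ⟨y, hy⟩ := hG.exists_adj x
  obtain ⟨z, hz, hzy⟩ := hG.exists_adj_ne hy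
  have := card_le_deg (G := G) (x := x) {y, z} (by simp [hy, hz])
  rwa [Finset.card_pair hzy.symm] at this

lemma MinCounter.deg_eq_two (hG : MinCounter V G) {x : V} (h : ¬ V3 G x) :
    (G.neighborSet x).ncard = 2 := by
  have h1 := hG.two_le_deg x
  have h2 := hG.1 x
  unfold V3 at h
  omega

lemma MinCounter.exists_zeroMatching (hG : MinCounter V G) : ∃ Z, ZeroMatching G Z := by
  obtain ⟨m, hm, hinj, hinv⟩ := hG.exists_matching
  refine ⟨{e | ∃ x, V3 G x ∧ V3 G (m x) ∧ e = s(x, m x)}, ?_, ?_, ?_, ?_⟩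
  · rintro e ⟨x, hx, -, rfl⟩
    exact hm x hx
  · rintro e ⟨x, hx, hx', rfl⟩ y hy
    rcases Sym2.mem_iff.1 hy with rfl | rfl
    · exact hx
    · exact hx'
  · rintro e ⟨x, hx, hx', rfl⟩ f ⟨y, hy, hy', rfl⟩ z hz hz'
    have key : ∀ x, V3 G x → V3 G (m x) → z ∈ s(x, m x) → s(x, m x) = s(z, m z) := by
      intro x hx hx' hz
      rcases Sym2.mem_iff.1 hz with rfl | rfl
      · rfl
      · rw [hinv x hx hx', Sym2.eq_swap]
    rw [key x hx hx' hz, key y hy hy' hz']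
  · rintro u ⟨hu, hu'⟩
    have hun : ∀ w, Unsat G {e | ∃ x, V3 G x ∧ V3 G (m x) ∧ e = s(x, m x)} w →
        ¬ V3 G (m w) := fun w hw hmw => hw.2 s(w, m w) ⟨w, hw.1, hmw, rfl⟩ (by simp)
    have hmu := hun u ⟨hu, hu'⟩
    refine ⟨m u, hm u hu, hG.deg_eq_two hmu, ?_⟩
    intro w hw hwu hw'
    refine hG.no_two_deg_two hw'.1 hw.symm (hm w hw'.1) ?_ (hG.deg_eq_two hmu)
      (hG.deg_eq_two (hun w hw'))
    intro h
    exact hwu (hinj _ _ hw'.1 hu h.symm)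

lemma MinCounter.exists_max_zeroMatching (hG : MinCounter V G) : ∃ Z, ZeroMatching G Z ∧
    ∀ u w, Unsat G Z u → Unsat G Z w → ¬ G.Adj u w := by
  obtain ⟨Z₀, hZ₀⟩ := hG.exists_zeroMatching
  have : Nonempty {Z // ZeroMatching G Z} := ⟨⟨Z₀, hZ₀⟩⟩
  obtain ⟨⟨Z, hZ⟩, hmax⟩ := Finite.exists_max fun Z : {Z // ZeroMatching G Z} => Z.1.ncard
  refine ⟨Z, hZ, ?_⟩
  intro u w hu hw huw
  have hnot : s(u, w) ∉ Z := fun h => hu.2 _ h (by simp)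
  have hmono : ∀ x, Unsat G (insert s(u, w) Z) x → Unsat G Z x := fun x hx =>
    ⟨hx.1, fun e he => hx.2 e (Or.inr he)⟩
  have hend : ∀ x ∈ s(u, w), Unsat G Z x := by
    intro x hx
    rcases Sym2.mem_iff.1 hx with rfl | rfl
    · exact hu
    · exact hw
  have hZ' : ZeroMatching G (insert s(u, w) Z) := by
    refine ⟨Set.insert_subset huw hZ.sub, ?_, ?_, ?_⟩
    · rintro e (rfl | he) x hx
      · exact (hend x hx).1
      · exact hZ.cubic e he x hx
    · rintro e (rfl | he) f (rfl | hf) x hx hx'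
      · rfl
      · exact ((hend x hx).2 f hf hx').elim
      · exact ((hend x hx').2 e he hx).elim
      · exact hZ.matching e he f hf x hx hx'
    · intro x hx
      obtain ⟨v, hv, hv2, hvw⟩ := hZ.late x (hmono x hx)
      exact ⟨v, hv, hv2, fun w hw hwx h => hvw w hw hwx (hmono w h)⟩
  have h1 := hmax ⟨_, hZ'⟩
  dsimp only at h1
  rw [Set.ncard_insert_of_notMem hnot (Set.toFinite _)] at h1
  omega

/-- The smaller distance from `v` to an endpoint of an edge. -/
noncomputable def level (G : SimpleGraph V) (v : V) : Sym2 V → ℕ :=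
  Sym2.lift ⟨fun x y => min (G.dist v x) (G.dist v y), fun _ _ => min_comm _ _⟩

lemma exists_parent (hconn : G.Preconnected) {v x : V} (h : x ≠ v) :
    ∃ p, G.Adj x p ∧ G.dist v p < G.dist v x := by
  obtain ⟨w, hw⟩ := (hconn x v).exists_walk_length_eq_dist
  cases w with
  | nil => exact (h rfl).elim
  | cons hxp w' =>
    refine ⟨_, hxp, ?_⟩
    rw [dist_comm, dist_comm (u := v), ← hw, Walk.length_cons]
    exact Nat.lt_succ_of_le (dist_le w')

lemma nbrs_color {D : Set (Sym2 V)} {c : Sym2 V → Fin 8} (h : PG G D c) {x y : V}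
    (S : Finset V) (hS : S.card ≤ 3) (hK : ∀ z ∈ S, (K D c z).card ≤ 2)
    (hx : ∀ z, G.Adj x z → z ≠ y → z ∉ S → K D c z = ∅)
    (hy : ∀ z, G.Adj y z → z ≠ x → z ∉ S → K D c z = ∅) :
    ∃ k, k ≠ 0 ∧ ∀ f ∈ D, f ≠ s(x, y) → Compat G s(x, y) k f (c f) := by
  obtain ⟨k, hk, hkS⟩ := exists_color_biUnion S (K D c) hS hK (by norm_num)
  refine ⟨k, hk, h.compat_edge hk ?_ ?_⟩
  · intro z hz hzy
    by_cases hzS : z ∈ S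
    · exact hkS z hzS
    · rw [hx z hz hzy hzS]; simp
  · intro z hz hzy
    by_cases hzS : z ∈ S
    · exact hkS z hzS
    · rw [hy z hz hzy hzS]; simp

lemma MinCounter.cubic (hG : MinCounter V G) (v : V) : V3 G v := by
  by_contra hv3
  have hv := hG.deg_eq_two hv3
  obtain ⟨Z, hZ, hind⟩ := hG.exists_max_zeroMatching
  choose! m hm using hZ.late
  let Lt : Set (Sym2 V) := {e | ∃ u, Unsat G Z u ∧ e = s(u, m u)}
  have hZL : ∀ e ∈ Lt, e ∉ Z := by
    rintro e ⟨u, hu, rfl⟩ he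
    exact hu.2 _ he (by simp)
  have h0 : PG G Z fun _ => 0 := by
    refine ⟨hZ.sub, fun e he _ => hZ.cubic e he, ?_⟩
    intro e he f hf hne
    exact ⟨fun _ _ x hx hx' => hne (hZ.matching e he f hf x hx hx'), fun _ h => (h rfl).elim⟩
  have hKsat : ∀ (D : Set (Sym2 V)) (c : Sym2 V → Fin 8), D ⊆ G.edgeSet → (∀ e ∈ Z, c e = 0) →
      ∀ z, ¬ Unsat G Z z → (K D c z).card ≤ 2 := by
    intro D c hD hc z hz
    by_cases hz3 : V3 G z
    · have : ∃ e ∈ Z, z ∈ e := by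
        by_contra! hno
        exact hz ⟨hz3, hno⟩
      obtain ⟨e, he, hze⟩ := this
      obtain ⟨w, rfl⟩ := hze
      have := K_card hD (c := c) (z := z) {w} (by
        simp only [Finset.mem_singleton, forall_eq]
        exact ⟨hZ.sub he, fun _ => hc _ he⟩)
      rw [hz3, Finset.card_singleton] at this
      omega
    · have := K_card hD (c := c) (z := z) ∅ (by simp)
      rw [hG.deg_eq_two hz3] at this
      simpa using this
  obtain ⟨c₁, h₁, hc₁⟩ := h0.extend_by_level (level G v) _
    (G.edgeSet \ (Z ∪ Lt)) rfl Set.sdiff_subset (fun e he hz => he.2 (Or.inl hz)) (by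
    intro e he D' c' hD' heD' hlev hP hc'
    have hDsub : D' ⊆ G.edgeSet := hP.sub
    have hK2 : ∀ z, (K D' c' z).card ≤ 2 := by
      intro z
      by_cases hz : Unsat G Z z
      · have := K_card hDsub (c := c') (z := z) {m z} (by
          simp only [Finset.mem_singleton, forall_eq]
          refine ⟨(hm z hz).1, fun h => ?_⟩
          have hL : s(z, m z) ∈ Lt := ⟨z, hz, rfl⟩
          rcases hD' h with h | h
          · exact (hZL _ hL h).elim
          · exact (h.2 (Or.inr hL)).elim)
        rw [hz.1, Finset.card_singleton] at this
        omega
      · exact hKsat D' c' hDsub hc' z hz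
    obtain ⟨x, y, rfl, hxy⟩ : ∃ x y, e = s(x, y) ∧ G.dist v x ≤ G.dist v y := by
      induction e using Sym2.ind with
      | _ x y =>
        rcases le_total (G.dist v x) (G.dist v y) with h | h
        · exact ⟨x, y, rfl, h⟩
        · exact ⟨y, x, Sym2.eq_swap, h⟩
    have hadj : G.Adj x y := he.1
    have hcy : (nbrs G y x).card ≤ 2 := by
      have h1 := card_nbrs hadj.symm
      have h2 := hG.1 y
      omega
    by_cases hxv : x = v
    · subst hxv
      refine nbrs_color hP (nbrs G x y ∪ nbrs G y x) ?_ (fun z _ => hK2 z) ?_ ?_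
      · have h1 := card_nbrs hadj
        have := Finset.card_union_le (nbrs G x y) (nbrs G y x)
        omega
      · intro z hz hzy hzS
        exact (hzS (Finset.mem_union_left _ (mem_nbrs.2 ⟨hz, hzy⟩))).elim
      · intro z hz hzy hzS
        exact (hzS (Finset.mem_union_right _ (mem_nbrs.2 ⟨hz, hzy⟩))).elim
    · obtain ⟨p, hp, hpd⟩ := exists_parent hG.preconnected hxv
      have hpy : p ≠ y := by
        rintro rfl
        omega
      have hKp : K D' c' p = ∅ := by
        rw [Finset.eq_empty_iff_forall_notMem]
        intro k hk
        obtain ⟨hk0, f, hf, ⟨q, rfl⟩, hfk⟩ := mem_K.1 hk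
        rcases hD' hf with hfZ | hfS
        · exact hk0 (hfk ▸ hc' _ hfZ)
        · have := hlev _ hfS hf
          simp only [level, Sym2.lift_mk] at this
          omega
      refine nbrs_color hP ((nbrs G x y).erase p ∪ nbrs G y x) ?_ (fun z _ => hK2 z) ?_ ?_
      · have h1 := card_nbrs hadj
        have h2 := hG.1 x
        have h3 := Finset.card_erase_add_one (mem_nbrs.2 ⟨hp, hpy⟩)
        have := Finset.card_union_le ((nbrs G x y).erase p) (nbrs G y x)
        omega
      · intro z hz hzy hzS
        by_cases hzp : z = p
        · rw [hzp, hKp]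
        · exact (hzS (Finset.mem_union_left _
            (Finset.mem_erase.2 ⟨hzp, mem_nbrs.2 ⟨hz, hzy⟩⟩))).elim
      · intro z hz hzy hzS
        exact (hzS (Finset.mem_union_right _ (mem_nbrs.2 ⟨hz, hzy⟩))).elim)
  obtain ⟨c₂, h₂, -⟩ := h₁.extend_by_level (fun _ => 0) _ Lt rfl (by
      rintro e ⟨u, hu, rfl⟩
      exact (hm u hu).1) (by
      intro e he h
      rcases h with h | h
      · exact hZL e he h
      · exact h.2 (Or.inr he)) (by
    rintro e ⟨u, hu, rfl⟩ D' c' hD' heD' - hP hc'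
    have hK2 := hKsat D' c' hP.sub fun e he => (hc' e (Or.inl he)).trans (hc₁ e he)
    obtain ⟨hadj, hm2, hmw⟩ := hm u hu
    have hS : ∀ z ∈ nbrs G u (m u) ∪ nbrs G (m u) u, ¬ Unsat G Z z := by
      intro z hz hzu
      rcases Finset.mem_union.1 hz with hz | hz
      · exact hind u z hu hzu (mem_nbrs.1 hz).1
      · exact hmw z (mem_nbrs.1 hz).1 (mem_nbrs.1 hz).2 hzu
    refine nbrs_color hP (nbrs G u (m u) ∪ nbrs G (m u) u) ?_ (fun z hz => hK2 z (hS z hz)) ?_ ?_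
    · have h1 := card_nbrs hadj
      have h2 := card_nbrs hadj.symm
      have h3 := hG.1 u
      have := Finset.card_union_le (nbrs G u (m u)) (nbrs G (m u) u)
      omega
    · intro z hz hzy hzS
      exact (hzS (Finset.mem_union_left _ (mem_nbrs.2 ⟨hz, hzy⟩))).elim
    · intro z hz hzy hzS
      exact (hzS (Finset.mem_union_right _ (mem_nbrs.2 ⟨hz, hzy⟩))).elim)
  refine hG.false_of_PG h₂ fun e he => ?_
  by_cases h : e ∈ Z ∪ Lt
  · rcases h with h | h
    · exact Or.inl (Or.inl h)
    · exact Or.inr h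
  · exact Or.inl (Or.inr ⟨he, h⟩)

end DegTwo

section TwoCuts
open Classical

variable {V : Type} [Finite V] {G : SimpleGraph V}

/-- Exactly the two disjoint edges `a₁b₁` and `a₂b₂` join `A` to its complement. -/
structure TwoCut (G : SimpleGraph V) (A : Set V) (a₁ b₁ a₂ b₂ : V) : Prop where
  ha₁ : a₁ ∈ A
  ha₂ : a₂ ∈ A
  hb₁ : b₁ ∉ A
  hb₂ : b₂ ∉ A
  adj₁ : G.Adj a₁ b₁
  adj₂ : G.Adj a₂ b₂
  cut : ∀ x ∈ A, ∀ y ∉ A, G.Adj x y → (x = a₁ ∧ y = b₁) ∨ (x = a₂ ∧ y = b₂)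
  ne_a : a₁ ≠ a₂
  ne_b : b₁ ≠ b₂

lemma TwoCut.compl {A : Set V} {a₁ b₁ a₂ b₂ : V} (h : TwoCut G A a₁ b₁ a₂ b₂) :
    TwoCut G Aᶜ b₁ a₁ b₂ a₂ where
  ha₁ := h.hb₁
  ha₂ := h.hb₂
  hb₁ := not_not.2 h.ha₁
  hb₂ := not_not.2 h.ha₂
  adj₁ := h.adj₁.symm
  adj₂ := h.adj₂.symm
  cut := fun x hx y hy hxy =>
    (h.cut y (not_not.1 hy) x hx hxy.symm).imp (fun h => ⟨h.2, h.1⟩) (fun h => ⟨h.2, h.1⟩)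
  ne_a := h.ne_b
  ne_b := h.ne_a

/-- No edge of `D` at a neighbour of `a` has colour `k`. -/
def Free (G : SimpleGraph V) (D : Set (Sym2 V)) (c : Sym2 V → Fin 8) (a : V) (k : Fin 8) : Prop :=
  k ≠ 0 ∧ ∀ z, G.Adj a z → k ∉ K D c z

/-- The edges inside `A`. -/
abbrev inside (G : SimpleGraph V) (A : Set V) : Set (Sym2 V) := (avoid G Aᶜ).edgeSet

lemma mem_inside {A : Set V} {x y : V} : s(x, y) ∈ inside G A ↔ G.Adj x y ∧ x ∈ A ∧ y ∈ A := by
  rw [mem_avoid]; simp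

lemma inside_sub {A : Set V} : inside G A ⊆ G.edgeSet := fun _ h => (avoid_edgeSet.1 h).1

lemma TwoCut.side (hG : MinCounter V G) {A : Set V} {a₁ b₁ a₂ b₂ : V}
    (h : TwoCut G A a₁ b₁ a₂ b₂) : ∃ c k₁ k₂, PG G (inside G A) c ∧
      (∀ x y, s(x, y) ∈ inside G A → HasZero (inside G A) c x ∨ HasZero (inside G A) c y) ∧
      k₁ ≠ k₂ ∧ Free G (inside G A) c a₁ k₁ ∧ Free G (inside G A) c a₂ k₂ ∧
      k₁ ∉ K (inside G A) c a₁ ∧ k₁ ∉ K (inside G A) c a₂ ∧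
      k₂ ∉ K (inside G A) c a₁ ∧ k₂ ∉ K (inside G A) c a₂ := by
  obtain ⟨ha₁, ha₂, hb₁, hb₂, adj₁, adj₂, cut, ne_a, ne_b⟩ := h
  set D := inside G A with hD
  have ne1 : a₁ ≠ b₁ := adj₁.ne
  have ne2 : b₁ ≠ a₂ := fun h => hb₁ (h ▸ ha₂)
  let H : SimpleGraph V := avoid G Aᶜ ⊔ edge a₁ b₁ ⊔ edge b₁ a₂
  have hH : ∀ x y, H.Adj x y ↔ (G.Adj x y ∧ x ∈ A ∧ y ∈ A) ∨
      (x = a₁ ∧ y = b₁ ∨ x = b₁ ∧ y = a₁) ∨ (x = b₁ ∧ y = a₂ ∨ x = a₂ ∧ y = b₁) := by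
    intro x y
    have h1 : (avoid G Aᶜ).Adj x y ↔ G.Adj x y ∧ x ∈ A ∧ y ∈ A := mem_inside
    simp only [H, sup_adj, edge_adj, h1]
    constructor
    · tauto
    · rintro (h | h | h)
      · exact Or.inl (Or.inl h)
      · refine Or.inl (Or.inr ⟨by tauto, ?_⟩)
        rintro rfl
        rcases h with ⟨h, h'⟩ | ⟨h, h'⟩
        · exact ne1 (h.symm.trans h')
        · exact ne1 (h'.symm.trans h)
      · refine Or.inr ⟨by tauto, ?_⟩
        rintro rfl
        rcases h with ⟨h, h'⟩ | ⟨h, h'⟩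
        · exact ne2 (h.symm.trans h')
        · exact ne2 (h'.symm.trans h)
  have hHb : (H.neighborSet b₁).ncard ≤ 2 := by
    refine le_trans (Set.ncard_le_ncard (t := {a₁, a₂}) ?_ (Set.toFinite _)) ((Set.ncard_insert_le _ _).trans (by simp))
    intro y hy
    rw [mem_neighborSet, hH] at hy
    rcases hy with h | (h | h) | (h | h)
    · exact (hb₁ h.2.1).elim
    · exact (ne1 h.1.symm).elim
    · exact Or.inl h.2
    · exact Or.inr h.2
    · exact (ne2 h.1).elim
  have hHle : ∀ x, x ≠ b₁ → x ≠ a₂ → ∀ y, H.Adj x y → G.Adj x y := by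
    intro x hxb hxa y hxy
    rw [hH] at hxy
    rcases hxy with h | (h | h) | (h | h)
    · exact h.1
    · rw [h.1, h.2]; exact adj₁
    · exact (hxb h.1).elim
    · exact (hxb h.1).elim
    · exact (hxa h.1).elim
  have hdeg : Subcubic H := by
    intro x
    by_cases hxb : x = b₁
    · subst hxb; omega
    by_cases hxa : x = a₂
    · subst hxa
      refine le_trans ?_ (hG.1 x)
      have : H.neighborSet x ⊆ insert b₁ (G.neighborSet x \ {b₂}) := by
        intro y hy
        rw [mem_neighborSet, hH] at hy
        rcases hy with h | (h | h) | (h | h)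
        · exact Or.inr ⟨h.1, fun hy => hb₂ (hy ▸ h.2.2)⟩
        · exact (ne_a h.1.symm).elim
        · exact (ne2 h.1.symm).elim
        · exact (ne2 h.1.symm).elim
        · exact Or.inl h.2
      refine (Set.ncard_le_ncard this (Set.toFinite _)).trans ((Set.ncard_insert_le _ _).trans ?_)
      have h2 := Set.ncard_sdiff_singleton_add_one (a := b₂) (s := G.neighborSet x) adj₂
        (Set.toFinite _)
      omega
    · exact (ncard_nbr_mono (hHle x hxb hxa)).trans (hG.1 x)
  have hb1A : ∀ w, G.Adj b₁ w → w ≠ a₁ → w ∉ A := by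
    intro w hw hwa hwA
    rcases cut w hwA b₁ hb₁ hw.symm with h | h
    · exact hwa h.1
    · exact ne_b h.2
  have hlt : H.edgeSet.ncard < G.edgeSet.ncard := by
    obtain ⟨w, hw, hwa⟩ := hG.exists_adj_ne adj₁.symm
    have hwA := hb1A w hw hwa
    have h1 : H.edgeSet ⊆ insert s(b₁, a₂) (insert s(a₁, b₁) D) := by
      intro e
      induction e using Sym2.ind with
      | _ x y =>
        intro he
        rw [mem_edgeSet, hH] at he
        rcases he with h | (h | h) | (h | h)
        · exact Or.inr (Or.inr (mem_inside.2 h))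
        · rw [h.1, h.2]; simp
        · rw [h.1, h.2, Sym2.eq_swap]; simp
        · rw [h.1, h.2]; simp
        · rw [h.1, h.2, Sym2.eq_swap]; simp
    have h2 : insert s(b₁, w) (insert s(a₂, b₂) (insert s(a₁, b₁) D)) ⊆ G.edgeSet :=
      Set.insert_subset hw (Set.insert_subset adj₂ (Set.insert_subset adj₁ inside_sub))
    have h3 := Set.ncard_le_ncard h1 (Set.toFinite _)
    have h4 := Set.ncard_le_ncard h2 (Set.toFinite _)
    have h5 : s(a₂, b₂) ∉ insert s(a₁, b₁) D := by
      rintro (h | h)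
      · rcases Sym2.eq_iff.1 h with h | h
        · exact ne_a h.1.symm
        · exact hb₂ (h.2 ▸ ha₁)
      · exact hb₂ (mem_inside.1 h).2.2
    have h6 : s(b₁, w) ∉ insert s(a₂, b₂) (insert s(a₁, b₁) D) := by
      rintro (h | h | h)
      · rcases Sym2.eq_iff.1 h with h | h
        · exact ne2 h.1
        · exact hwA (h.2 ▸ ha₂)
      · rcases Sym2.eq_iff.1 h with h | h
        · exact ne1 h.1.symm
        · exact hwa h.2
      · exact hwA (mem_inside.1 h).2.2
    rw [Set.ncard_insert_of_notMem h6 (Set.toFinite _),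
      Set.ncard_insert_of_notMem h5 (Set.toFinite _)] at h4
    have h7 := Set.ncard_insert_le s(b₁, a₂) (insert s(a₁, b₁) D)
    omega
  obtain ⟨c, hc⟩ := hG.color H hdeg hlt
  have hDH : D ⊆ H.edgeSet := by
    intro e
    induction e using Sym2.ind with
    | _ x y =>
      intro he
      exact (hH x y).2 (Or.inl (mem_inside.1 he))
  have hDA : ∀ x, (∃ e ∈ D, x ∈ e) → x ∈ A := by
    rintro x ⟨e, he, ⟨y, rfl⟩⟩
    exact (mem_inside.1 he).2.1
  have hP : PG G D c := PG_of_good hc inside_sub hDH (fun x _ => hG.cubic x)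
    (fun x y hx hy hxy => (hH x y).2 (Or.inl ⟨hxy, hDA x hx, hDA y hy⟩))
  have e1 : H.Adj a₁ b₁ := by rw [hH]; simp
  have e2 : H.Adj a₂ b₁ := by rw [hH]; simp
  have hz : ∀ x, H.Adj x b₁ → c s(x, b₁) ≠ 0 := by
    intro x hx h0
    have := (hc.2 x b₁ hx h0).2
    omega
  have hKn : ∀ x, H.Adj x b₁ → x ∈ A → ∀ z, (x = z ∨ H.Adj x z ∨ H.Adj b₁ z) →
      c s(x, b₁) ∉ K D c z := by
    intro x hx hxA z hz hk
    obtain ⟨hk0, f, hf, ⟨w, rfl⟩, hfk⟩ := mem_K.1 hk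
    have hne : s(x, b₁) ≠ s(z, w) := by
      intro h
      rw [← h] at hf
      exact hb₁ (mem_inside.1 hf).2.2
    have := hc.1.2 x b₁ z w hx (hDH hf) hne hfk.symm hk0
    tauto
  have hGH : ∀ x ∈ A, ∀ z, G.Adj x z → z ∈ A → H.Adj x z := fun x hx z hxz hz =>
    (hH x z).2 (Or.inl ⟨hxz, hx, hz⟩)
  have hemp : ∀ z ∉ A, ∀ k, k ∉ K D c z := by
    intro z hz k
    rw [hD, inside, K_avoid_empty (by simpa using hz)]
    simp
  have hne : c s(a₁, b₁) ≠ c s(a₂, b₁) := by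
    intro h
    have := (hc.1.2 a₁ b₁ a₂ b₁ e1 e2 (by
      intro h
      rcases Sym2.eq_iff.1 h with h | h
      · exact ne_a h.1
      · exact ne1 h.1) h (hz _ e1)).1
    exact this.2.2.2 rfl
  have hfree : ∀ x, H.Adj x b₁ → x ∈ A → ∀ z, G.Adj x z → c s(x, b₁) ∉ K D c z := by
    intro x hx hxA z hxz
    by_cases hzA : z ∈ A
    · exact hKn x hx hxA z (Or.inr (Or.inl (hGH x hxA z hxz hzA)))
    · exact hemp z hzA _
  obtain ⟨c', hc', hcc, hmax⟩ := hP.exists_zero_max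
  have hmono := K_mono_of_zero (D := D) hcc
  refine ⟨c', c s(a₁, b₁), c s(a₂, b₁), hc', fun x y hxy =>
    hmax x y hxy (hG.cubic x) (hG.cubic y), hne,
    ⟨hz _ e1, fun z h hk => hfree a₁ e1 ha₁ z h (hmono z hk)⟩,
    ⟨hz _ e2, fun z h hk => hfree a₂ e2 ha₂ z h (hmono z hk)⟩,
    fun hk => hKn a₁ e1 ha₁ a₁ (Or.inl rfl) (hmono _ hk),
    fun hk => hKn a₁ e1 ha₁ a₂ (Or.inr (Or.inr e2.symm)) (hmono _ hk),
    fun hk => hKn a₂ e2 ha₂ a₁ (Or.inr (Or.inr e1.symm)) (hmono _ hk),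
    fun hk => hKn a₂ e2 ha₂ a₂ (Or.inl rfl) (hmono _ hk)⟩

lemma TwoCut.false_of_perm (hG : MinCounter V G) {A : Set V} {a₁ b₁ a₂ b₂ : V}
    (h : TwoCut G A a₁ b₁ a₂ b₂) {c c' : Sym2 V → Fin 8} (hc : PG G (inside G A) c)
    (hc' : PG G (inside G Aᶜ) c') (σ : Equiv.Perm (Fin 8)) (h0 : σ 0 = 0) {k₁ k₂ l₁ l₂ : Fin 8}
    (hk₁ : Free G (inside G A) c a₁ k₁) (hk₂ : Free G (inside G A) c a₂ k₂)
    (hl₁ : Free G (inside G Aᶜ) c' b₁ l₁) (hl₂ : Free G (inside G Aᶜ) c' b₂ l₂)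
    (hσ₁ : σ l₁ = k₁) (hσ₂ : σ l₂ = k₂)
    (hR₁ : ∀ r ∈ K (inside G Aᶜ) c' b₁, σ r ∉ K (inside G A) c a₁)
    (hR₂ : ∀ r ∈ K (inside G Aᶜ) c' b₂, σ r ∉ K (inside G A) c a₂)
    (hne : k₁ ≠ k₂ ∨ (¬ G.Adj a₁ a₂ ∧ ¬ G.Adj b₁ b₂)) : False := by
  obtain ⟨ha₁, ha₂, hb₁, hb₂, adj₁, adj₂, cut, ne_a, ne_b⟩ := h
  have hdis : ∀ r (D₁ D₂ : Set (Sym2 V)) (x y : V), (∀ r ∈ K D₂ c' y, σ r ∉ K D₁ c x) →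
      r ∈ K D₁ c x → r ∉ (K D₂ c' y).image σ := by
    intro r D₁ D₂ x y hh hr hr'
    obtain ⟨s, hs, rfl⟩ := Finset.mem_image.1 hr'
    exact hh s hs hr
  obtain ⟨d, hd, hdA, hdB⟩ := PG.glue (A := A) hc (hc'.perm σ h0)
    (by rintro e he x ⟨y, rfl⟩; exact (mem_inside.1 he).2.1)
    (by rintro e he x ⟨y, rfl⟩; exact (mem_inside.1 he).2.1)
    (by
      intro a ha b hb hab
      rw [K_perm σ h0, Finset.disjoint_left]
      intro r
      rcases cut a ha b hb hab with ⟨rfl, rfl⟩ | ⟨rfl, rfl⟩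
      · exact hdis r _ _ _ _ hR₁
      · exact hdis r _ _ _ _ hR₂)
  have hKA : ∀ z ∈ A, K (inside G A ∪ inside G Aᶜ) d z = K (inside G A) c z := hdA
  have hKB : ∀ z ∉ A, K (inside G A ∪ inside G Aᶜ) d z = (K (inside G Aᶜ) c' z).image σ :=
    fun z hz => (hdB z hz).trans (K_perm σ h0 z)
  have hcomp : ∀ a ∈ A, ∀ b ∉ A, ∀ k l, G.Adj a b → (∀ y ∉ A, G.Adj a y → y = b) →
      (∀ x ∈ A, G.Adj x b → x = a) → Free G (inside G A) c a k → Free G (inside G Aᶜ) c' b l →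
      σ l = k → ∀ f ∈ inside G A ∪ inside G Aᶜ, f ≠ s(a, b) → Compat G s(a, b) k f (d f) := by
    intro a ha b hb k l hab huy hux hk hl hσ
    refine hd.compat_edge hk.1 ?_ ?_
    · intro z hz hzb
      have hzA : z ∈ A := by
        by_contra hzA
        exact hzb (huy z hzA hz)
      rw [hKA z hzA]
      exact hk.2 z hz
    · intro z hz hza
      have hzA : z ∉ A := fun hzA => hza (hux z hzA hz.symm)
      rw [hKB z hzA]
      intro hm
      obtain ⟨s, hs, hsk⟩ := Finset.mem_image.1 hm
      rw [← hσ] at hsk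
      exact hl.2 z hz (σ.injective hsk ▸ hs)
  refine hG.false_of_extend hd [(s(a₁, b₁), k₁), (s(a₂, b₂), k₂)] ?_ ?_ ?_
  · intro p hp
    simp only [List.mem_cons, List.not_mem_nil, or_false] at hp
    rcases hp with rfl | rfl
    · refine ⟨adj₁, fun h => (hk₁.1 h).elim, hcomp a₁ ha₁ b₁ hb₁ k₁ l₁ adj₁ ?_ ?_ hk₁ hl₁ hσ₁⟩
      · intro y hy hay
        rcases cut a₁ ha₁ y hy hay with h | h
        · exact h.2
        · exact (ne_a h.1).elim
      · intro x hx hxb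
        rcases cut x hx b₁ hb₁ hxb with h | h
        · exact h.1
        · exact (ne_b h.2).elim
    · refine ⟨adj₂, fun h => (hk₂.1 h).elim, hcomp a₂ ha₂ b₂ hb₂ k₂ l₂ adj₂ ?_ ?_ hk₂ hl₂ hσ₂⟩
      · intro y hy hay
        rcases cut a₂ ha₂ y hy hay with h | h
        · exact (ne_a h.1.symm).elim
        · exact h.2
      · intro x hx hxb
        rcases cut x hx b₂ hb₂ hxb with h | h
        · exact (ne_b h.2.symm).elim
        · exact h.1
  · simp only [List.pairwise_cons, List.mem_singleton, forall_eq, List.not_mem_nil, false_imp_iff,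
      implies_true, List.Pairwise.nil, and_true]
    intro _
    rcases hne with hne | ⟨hna, hnb⟩
    · exact compat_of_ne hne
    · apply compat_of_not_near
      rw [near_mk]
      have h1 : a₁ ≠ b₂ := fun h => hb₂ (h ▸ ha₁)
      have h2 : b₁ ≠ a₂ := fun h => hb₁ (h ▸ ha₂)
      have h3 : ¬ G.Adj a₁ b₂ := fun h => by
        rcases cut a₁ ha₁ b₂ hb₂ h with h | h
        · exact ne_b h.2.symm
        · exact ne_a h.1
      have h4 : ¬ G.Adj b₁ a₂ := fun h => by
        rcases cut a₂ ha₂ b₁ hb₁ h.symm with h | h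
        · exact ne_a h.1.symm
        · exact ne_b h.2
      tauto
  · intro e
    induction e using Sym2.ind with
    | _ x y =>
      intro he
      have he' : G.Adj x y := he
      simp only [Set.mem_union, mem_inside, Set.mem_compl_iff, List.map_cons, List.map_nil,
        List.mem_cons, List.not_mem_nil, or_false]
      by_cases hx : x ∈ A <;> by_cases hy : y ∈ A
      · exact Or.inl (Or.inl ⟨he', hx, hy⟩)
      · rcases cut x hx y hy he' with ⟨rfl, rfl⟩ | ⟨rfl, rfl⟩ <;> simp
      · rcases cut y hy x hx he'.symm with ⟨rfl, rfl⟩ | ⟨rfl, rfl⟩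
        · exact Or.inr (Or.inl Sym2.eq_swap)
        · exact Or.inr (Or.inr Sym2.eq_swap)
      · exact Or.inl (Or.inr ⟨he', hx, hy⟩)

end TwoCuts

section TwoCuts2
open Classical

variable {V : Type} [Finite V] {G : SimpleGraph V}

lemma exists_perm_two {k₁ k₂ l₁ l₂ : Fin 8} (hk₁ : k₁ ≠ 0) (hk₂ : k₂ ≠ 0) (hk : k₁ ≠ k₂)
    (hl₁ : l₁ ≠ 0) (hl₂ : l₂ ≠ 0) (hl : l₁ ≠ l₂) {P₁ P₂ R₁ R₂ : Finset (Fin 8)}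
    (hP₁ : P₁.card ≤ 2) (hP₂ : P₂.card ≤ 2) (hR₁ : R₁.card ≤ 2) (hR₂ : R₂.card ≤ 2)
    (hR : ∀ r ∈ R₁ ∪ R₂, r ≠ 0 ∧ r ≠ l₁ ∧ r ≠ l₂)
    (h : ¬ (P₁ = P₂ ∧ P₁.card = 2 ∧ Disjoint R₁ R₂ ∧ R₁.card = 2 ∧ R₂.card = 2))
    (h' : ¬ (R₁ = R₂ ∧ R₁.card = 2 ∧ Disjoint P₁ P₂ ∧ P₁.card = 2 ∧ P₂.card = 2)) :
    ∃ σ : Equiv.Perm (Fin 8), σ 0 = 0 ∧ σ l₁ = k₁ ∧ σ l₂ = k₂ ∧ (∀ r ∈ R₁, σ r ∉ P₁) ∧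
      ∀ r ∈ R₂, σ r ∉ P₂ := by
  let C : Finset (Fin 8) := Finset.univ \ {0, k₁, k₂}
  have hC : C.card = 5 := by
    have : ({0, k₁, k₂} : Finset (Fin 8)).card = 3 :=
      Finset.card_eq_three.2 ⟨_, _, _, hk₁.symm, hk₂.symm, hk, rfl⟩
    rw [Finset.card_sdiff_of_subset (Finset.subset_univ _), this]
    rfl
  let t : Fin 8 → Finset (Fin 8) := fun x =>
    C \ ((if x ∈ R₁ then P₁ else ∅) ∪ (if x ∈ R₂ then P₂ else ∅))
  have hsd : ∀ S : Finset (Fin 8), 5 ≤ (C \ S).card + S.card := by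
    intro S
    have := Finset.le_card_sdiff S C
    omega
  have hall : ∀ s : Finset {x // x ∈ R₁ ∪ R₂}, s.card ≤ (s.biUnion fun x => t x.1).card := by
    intro s
    set s' := s.image Subtype.val with hs'
    have hcard : s.card = s'.card := (Finset.card_image_of_injective _ Subtype.val_injective).symm
    have hsub : s' ⊆ R₁ ∪ R₂ := by
      intro x hx
      obtain ⟨y, -, rfl⟩ := Finset.mem_image.1 hx
      exact y.2
    have hle : ∀ x ∈ s', t x ⊆ s.biUnion fun x => t x.1 := by
      intro x hx
      obtain ⟨y, hy, rfl⟩ := Finset.mem_image.1 hx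
      exact Finset.subset_biUnion_of_mem (fun x : {x // x ∈ R₁ ∪ R₂} => t x.1) hy
    rw [hcard]
    generalize (s.biUnion fun x => t x.1) = U at hle
    have hadd := Finset.card_union_add_card_inter R₁ R₂
    have hPadd := Finset.card_union_add_card_inter P₁ P₂
    have hs4 := Finset.card_le_card hsub
    by_cases hmix : s' ⊆ R₁ ∩ R₂
    · rcases s'.eq_empty_or_nonempty with he | ⟨x, hx⟩
      · simp [he]
      have htx : t x = C \ (P₁ ∪ P₂) := by
        have := Finset.mem_inter.1 (hmix hx)
        simp [t, this.1, this.2]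
      have h1 := Finset.card_le_card (hle x hx)
      rw [htx] at h1
      have h2 := hsd (P₁ ∪ P₂)
      have h3 := Finset.card_le_card hmix
      have h4 := Finset.card_le_card (Finset.inter_subset_left (s₁ := R₁) (s₂ := R₂))
      have h5 := Finset.card_le_card (Finset.inter_subset_right (s₁ := R₁) (s₂ := R₂))
      by_contra hlt
      refine h' ⟨?_, by omega, ?_, by omega, by omega⟩
      · rw [← Finset.eq_of_subset_of_card_le (Finset.inter_subset_left (s₁ := R₁) (s₂ := R₂))
          (by omega)]
        exact Finset.eq_of_subset_of_card_le Finset.inter_subset_right (by omega)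
      · rw [Finset.disjoint_iff_inter_eq_empty, ← Finset.card_eq_zero]
        omega
    · obtain ⟨x, hx, hxn⟩ := Finset.not_subset.1 hmix
      have h3 : 3 ≤ (t x).card := by
        by_cases hx1 : x ∈ R₁
        · have hx2 : x ∉ R₂ := fun hx2 => hxn (Finset.mem_inter.2 ⟨hx1, hx2⟩)
          have : t x = C \ P₁ := by simp [t, hx1, hx2]
          rw [this]
          have := hsd P₁
          omega
        · have hx2 : x ∈ R₂ := (Finset.mem_union.1 (hsub hx)).resolve_left hx1
          have : t x = C \ P₂ := by simp [t, hx1, hx2]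
          rw [this]
          have := hsd P₂
          omega
      have h4 := Finset.card_le_card (hle x hx)
      by_contra hlt
      have hdis : R₁ ∩ R₂ = ∅ := by
        rw [← Finset.card_eq_zero]
        omega
      have hall : s' = R₁ ∪ R₂ := Finset.eq_of_subset_of_card_le hsub (by omega)
      rw [hdis, Finset.card_empty] at hadd
      obtain ⟨y, hy⟩ := Finset.card_pos.1 (show 0 < R₁.card by omega)
      obtain ⟨z, hz⟩ := Finset.card_pos.1 (show 0 < R₂.card by omega)
      have hy2 : y ∉ R₂ := fun h => by
        have := Finset.mem_inter.2 ⟨hy, h⟩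
        rw [hdis] at this
        simp at this
      have hz1 : z ∉ R₁ := fun h => by
        have := Finset.mem_inter.2 ⟨h, hz⟩
        rw [hdis] at this
        simp at this
      have hty : t y = C \ P₁ := by simp [t, hy, hy2]
      have htz : t z = C \ P₂ := by simp [t, hz, hz1]
      have hyU := hle y (hall ▸ Finset.mem_union_left _ hy)
      have hzU := hle z (hall ▸ Finset.mem_union_right _ hz)
      have hCU : C \ (P₁ ∩ P₂) ⊆ U := by
        intro w hw
        rw [Finset.mem_sdiff, Finset.mem_inter] at hw
        by_cases hw1 : w ∈ P₁
        · refine hzU ?_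
          rw [htz, Finset.mem_sdiff]
          exact ⟨hw.1, fun h => hw.2 ⟨hw1, h⟩⟩
        · refine hyU ?_
          rw [hty, Finset.mem_sdiff]
          exact ⟨hw.1, hw1⟩
      have h6 := Finset.card_le_card hCU
      have h7 := hsd (P₁ ∩ P₂)
      have h8 := Finset.card_le_card (Finset.inter_subset_left (s₁ := P₁) (s₂ := P₂))
      have h9 := Finset.card_le_card (Finset.inter_subset_right (s₁ := P₁) (s₂ := P₂))
      refine h ⟨?_, by omega, Finset.disjoint_iff_inter_eq_empty.2 hdis, by omega, by omega⟩
      rw [← Finset.eq_of_subset_of_card_le (Finset.inter_subset_left (s₁ := P₁) (s₂ := P₂))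
          (by omega)]
      exact Finset.eq_of_subset_of_card_le Finset.inter_subset_right (by omega)
  obtain ⟨g, hg, hgt⟩ := (Finset.all_card_le_biUnion_card_iff_exists_injective
    (fun x : {x // x ∈ R₁ ∪ R₂} => t x.1)).1 hall
  let f : Fin 8 → Fin 8 := fun x => if hx : x ∈ R₁ ∪ R₂ then g ⟨x, hx⟩ else
    if x = 0 then 0 else if x = l₁ then k₁ else k₂
  have hfR : ∀ x (hx : x ∈ R₁ ∪ R₂), f x = g ⟨x, hx⟩ := fun x hx => by simp only [f, dif_pos hx]
  have hgC : ∀ x, g x ≠ 0 ∧ g x ≠ k₁ ∧ g x ≠ k₂ := by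
    intro x
    have := (Finset.mem_sdiff.1 (hgt x)).1
    simpa [C] using this
  have hn0 : 0 ∉ R₁ ∪ R₂ := fun h => (hR 0 h).1 rfl
  have hn1 : l₁ ∉ R₁ ∪ R₂ := fun h => (hR _ h).2.1 rfl
  have hn2 : l₂ ∉ R₁ ∪ R₂ := fun h => (hR _ h).2.2 rfl
  have f0 : f 0 = 0 := by simp only [f, dif_neg hn0, if_true]
  have f1 : f l₁ = k₁ := by simp only [f, dif_neg hn1, if_neg hl₁, if_true]
  have f2 : f l₂ = k₂ := by simp only [f, dif_neg hn2, if_neg hl₂, if_neg hl.symm]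
  have hinj : Set.InjOn f ((R₁ ∪ R₂) ∪ {0, l₁, l₂} : Finset (Fin 8)) := by
    have key : ∀ x ∈ R₁ ∪ R₂, ∀ y ∈ ({0, l₁, l₂} : Finset (Fin 8)), f x ≠ f y := by
      intro x hx y hy
      rw [hfR x hx]
      have := hgC ⟨x, hx⟩
      simp only [Finset.mem_insert, Finset.mem_singleton] at hy
      rcases hy with rfl | rfl | rfl
      · rw [f0]; exact this.1
      · rw [f1]; exact this.2.1
      · rw [f2]; exact this.2.2
    intro x hx y hy hxy
    rw [Finset.mem_coe, Finset.mem_union] at hx hy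
    rcases hx with hx | hx <;> rcases hy with hy | hy
    · rw [hfR x hx, hfR y hy] at hxy
      exact congrArg Subtype.val (hg hxy)
    · exact (key x hx y hy hxy).elim
    · exact (key y hy x hx hxy.symm).elim
    · simp only [Finset.mem_insert, Finset.mem_singleton] at hx hy
      rcases hx with rfl | rfl | rfl <;> rcases hy with rfl | rfl | rfl <;>
        first
        | rfl
        | exfalso
          simp only [f0, f1, f2] at hxy
          first
          | exact hk₁ hxy
          | exact hk₁ hxy.symm
          | exact hk₂ hxy
          | exact hk₂ hxy.symm
          | exact hk hxy
          | exact hk hxy.symm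
  obtain ⟨σ, hσ, -⟩ := exists_perm _ f hinj ∅ ∅ (by simp) (by simp) le_rfl
  refine ⟨σ, ?_, ?_, ?_, ?_, ?_⟩
  · rw [hσ 0 (by simp), f0]
  · rw [hσ l₁ (by simp), f1]
  · rw [hσ l₂ (by simp), f2]
  · intro r hr
    have hr' : r ∈ R₁ ∪ R₂ := Finset.mem_union_left _ hr
    rw [hσ r (Finset.mem_union_left _ hr'), hfR r hr']
    have := (Finset.mem_sdiff.1 (hgt ⟨r, hr'⟩)).2
    simp only [hr, if_true] at this
    exact fun h => this (Finset.mem_union_left _ h)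
  · intro r hr
    have hr' : r ∈ R₁ ∪ R₂ := Finset.mem_union_right _ hr
    rw [hσ r (Finset.mem_union_left _ hr'), hfR r hr']
    have := (Finset.mem_sdiff.1 (hgt ⟨r, hr'⟩)).2
    simp only [hr, if_true] at this
    exact fun h => this (Finset.mem_union_right _ h)

/-- A colouring of the edges inside `A` with two colours for the cut edges at `a₁`, `a₂`. -/
structure Side (G : SimpleGraph V) (A : Set V) (a₁ a₂ : V) (c : Sym2 V → Fin 8)
    (k₁ k₂ : Fin 8) : Prop where
  pg : PG G (inside G A) c
  max : ∀ x y, s(x, y) ∈ inside G A → HasZero (inside G A) c x ∨ HasZero (inside G A) c y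
  ne : k₁ ≠ k₂
  free₁ : Free G (inside G A) c a₁ k₁
  free₂ : Free G (inside G A) c a₂ k₂
  n₁₁ : k₁ ∉ K (inside G A) c a₁
  n₁₂ : k₁ ∉ K (inside G A) c a₂
  n₂₁ : k₂ ∉ K (inside G A) c a₁
  n₂₂ : k₂ ∉ K (inside G A) c a₂

lemma Side.not_hasZero (hG : MinCounter V G) {A : Set V} {a₁ a₂ a b : V} {c : Sym2 V → Fin 8}
    {k₁ k₂ : Fin 8} (h : Side G A a₁ a₂ c k₁ k₂) (hb : b ∉ A) (hab : G.Adj a b)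
    (hK : (K (inside G A) c a).card = 2) : ¬ HasZero (inside G A) c a := by
  intro hz
  have := K_card_zero h.pg hz {b} (by
    simp only [Finset.mem_singleton, forall_eq]
    exact ⟨hab, fun h => hb (mem_inside.1 h).2.2⟩)
  rw [hK, Finset.card_singleton, hG.cubic a] at this
  omega

lemma K_inside_empty {A : Set V} {c : Sym2 V → Fin 8} {z : V} (hz : z ∉ A) :
    K (inside G A) c z = ∅ := K_avoid_empty (by simpa using hz)

lemma Side.exists_free (hG : MinCounter V G) {A : Set V} {a₁ a₂ a b : V} {c : Sym2 V → Fin 8}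
    {k₁ k₂ : Fin 8} (h : Side G A a₁ a₂ c k₁ k₂) (ha : a ∈ A) (hb : b ∉ A) (hab : G.Adj a b)
    (hK : (K (inside G A) c a).card = 2) : ∃ Q : Finset (Fin 8), 3 ≤ Q.card ∧
      ∀ k ∈ Q, Free G (inside G A) c a k ∧ k ∉ K (inside G A) c a := by
  have hz := h.not_hasZero hG hb hab hK
  let F := (nbrs G a b).biUnion (K (inside G A) c)
  have hF : F.card ≤ 2 * 2 := by
    refine (Finset.card_biUnion_le_card_mul _ _ 2 ?_).trans (Nat.mul_le_mul_right _ ?_)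
    · intro z hz'
      obtain ⟨haz, -⟩ := mem_nbrs.1 hz'
      by_cases hzA : z ∈ A
      · have hzz := (h.max a z (mem_inside.2 ⟨haz, ha, hzA⟩)).resolve_left hz
        have := K_card_zero h.pg hzz ∅ (by simp)
        rw [hG.cubic z, Finset.card_empty] at this
        omega
      · rw [K_inside_empty hzA]; simp
    · have := card_nbrs hab
      rw [hG.cubic a] at this
      omega
  refine ⟨Finset.univ \ insert 0 F, ?_, ?_⟩
  · have h1 := Finset.le_card_sdiff (insert 0 F) Finset.univ
    have h2 := Finset.card_insert_le 0 F
    rw [Finset.card_univ, Fintype.card_fin] at h1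
    omega
  · intro k hk
    simp only [Finset.mem_sdiff, Finset.mem_univ, true_and, Finset.mem_insert, not_or] at hk
    obtain ⟨hk0, hkF⟩ := hk
    have hkz : ∀ z, G.Adj a z → z ≠ b → k ∉ K (inside G A) c z := fun z haz hzb hkz =>
      hkF (Finset.mem_biUnion.2 ⟨z, mem_nbrs.2 ⟨haz, hzb⟩, hkz⟩)
    refine ⟨⟨hk0, ?_⟩, ?_⟩
    · intro z haz
      by_cases hzb : z = b
      · rw [hzb, K_inside_empty hb]; simp
      · exact hkz z haz hzb
    · intro hka
      obtain ⟨-, f, hf, ⟨w, rfl⟩, hfk⟩ := mem_K.1 hka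
      obtain ⟨haw, -, hwA⟩ := mem_inside.1 hf
      exact hkz w haw (fun h => hb (h ▸ hwA)) (mem_K.2 ⟨hk0, _, hf, by simp, hfk⟩)

lemma TwoCut.exists_side (hG : MinCounter V G) {A : Set V} {a₁ b₁ a₂ b₂ : V}
    (h : TwoCut G A a₁ b₁ a₂ b₂) : ∃ c k₁ k₂, Side G A a₁ a₂ c k₁ k₂ := by
  obtain ⟨c, k₁, k₂, h1, h2, h3, h4, h5, h6, h7, h8, h9⟩ := h.side hG
  exact ⟨c, k₁, k₂, h1, h2, h3, h4, h5, h6, h7, h8, h9⟩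

lemma Side.not_adj (hG : MinCounter V G) {A : Set V} {a₁ b₁ a₂ b₂ : V}
    (h : TwoCut G A a₁ b₁ a₂ b₂) {c : Sym2 V → Fin 8} {k₁ k₂ : Fin 8}
    (hs : Side G A a₁ a₂ c k₁ k₂) (h1 : (K (inside G A) c a₁).card = 2)
    (h2 : (K (inside G A) c a₂).card = 2) : ¬ G.Adj a₁ a₂ := by
  intro hadj
  rcases hs.max a₁ a₂ (mem_inside.2 ⟨hadj, h.ha₁, h.ha₂⟩) with hz | hz
  · exact hs.not_hasZero hG h.hb₁ h.adj₁ h1 hz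
  · exact hs.not_hasZero hG h.hb₂ h.adj₂ h2 hz

lemma TwoCut.false_of_eq (hG : MinCounter V G) {A : Set V} {a₁ b₁ a₂ b₂ : V}
    (h : TwoCut G A a₁ b₁ a₂ b₂) {c c' : Sym2 V → Fin 8} {k₁ k₂ l₁ l₂ : Fin 8}
    (hs : Side G A a₁ a₂ c k₁ k₂) (hs' : Side G Aᶜ b₁ b₂ c' l₁ l₂)
    (hP : K (inside G A) c a₁ = K (inside G A) c a₂) (hP2 : (K (inside G A) c a₁).card = 2)
    (hR : Disjoint (K (inside G Aᶜ) c' b₁) (K (inside G Aᶜ) c' b₂))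
    (hR₁ : (K (inside G Aᶜ) c' b₁).card = 2) (hR₂ : (K (inside G Aᶜ) c' b₂).card = 2) :
    False := by
  have hc := h.compl
  have hna := hs.not_adj hG h hP2 (hP ▸ hP2)
  have hnb := hs'.not_adj hG hc hR₁ hR₂
  obtain ⟨Q₁, hQ₁, hQ₁f⟩ := hs.exists_free hG h.ha₁ h.hb₁ h.adj₁ hP2
  obtain ⟨Q₂, hQ₂, hQ₂f⟩ := hs.exists_free hG h.ha₂ h.hb₂ h.adj₂ (hP ▸ hP2)
  obtain ⟨S₁, hS₁, hS₁f⟩ := hs'.exists_free hG hc.ha₁ hc.hb₁ hc.adj₁ hR₁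
  obtain ⟨S₂, hS₂, hS₂f⟩ := hs'.exists_free hG hc.ha₂ hc.hb₂ hc.adj₂ hR₂
  set P₁ := K (inside G A) c a₁ with hP₁
  set P₂ := K (inside G A) c a₂ with hP₂
  set R₁ := K (inside G Aᶜ) c' b₁ with hR₁'
  set R₂ := K (inside G Aᶜ) c' b₂ with hR₂'
  have h0P : 0 ∉ P₁ := zero_notMem_K
  have h0R₁ : 0 ∉ R₁ := zero_notMem_K
  have h0R₂ : 0 ∉ R₂ := zero_notMem_K
  have hRcard : (R₁ ∪ R₂).card = 4 := by
    rw [Finset.card_union_of_disjoint hR, hR₁, hR₂]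
  by_cases hSS : Disjoint S₁ S₂
  · have hmeet : ∀ S S' R R' : Finset (Fin 8), Disjoint S S' → 3 ≤ S.card → 3 ≤ S'.card →
        Disjoint R R' → R.card = 2 → R'.card = 2 → 0 ∉ R → 0 ∉ R' → 0 ∉ S → 0 ∉ S' →
        Disjoint S R → Disjoint S' R' → ∃ x ∈ S, x ∈ R' := by
      intro S S' R R' hSS hS hS' hRR hR hR' h0 h0' h0S h0S' hSR hSR'
      by_contra! hno
      have hd : Disjoint S R' := Finset.disjoint_left.2 hno
      have h1 : Disjoint (S ∪ S') R' := Finset.disjoint_union_left.2 ⟨hd, hSR'⟩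
      have h2 : (insert 0 (S ∪ S' ∪ R')).card ≤ 8 := Finset.card_le_univ _
      rw [Finset.card_insert_of_notMem (by simp [h0S, h0S', h0']),
        Finset.card_union_of_disjoint h1, Finset.card_union_of_disjoint hSS] at h2
      omega
    have h0S₁ : 0 ∉ S₁ := fun h => (hS₁f 0 h).1.1 rfl
    have h0S₂ : 0 ∉ S₂ := fun h => (hS₂f 0 h).1.1 rfl
    have hSR₁ : Disjoint S₁ R₁ := Finset.disjoint_left.2 fun x hx => (hS₁f x hx).2
    have hSR₂ : Disjoint S₂ R₂ := Finset.disjoint_left.2 fun x hx => (hS₂f x hx).2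
    obtain ⟨x, hxS, hxR⟩ := hmeet S₁ S₂ R₁ R₂ hSS hS₁ hS₂ hR hR₁ hR₂ h0R₁ h0R₂ h0S₁ h0S₂ hSR₁ hSR₂
    obtain ⟨y, hyS, hyR⟩ := hmeet S₂ S₁ R₂ R₁ hSS.symm hS₂ hS₁ hR.symm hR₂ hR₁ h0R₂ h0R₁ h0S₂ h0S₁
      hSR₂ hSR₁
    have hx0 : x ≠ 0 := fun h => h0S₁ (h ▸ hxS)
    have hy0 : y ≠ 0 := fun h => h0S₂ (h ▸ hyS)
    have hxy : x ≠ y := fun h => Finset.disjoint_left.1 hSS hxS (h ▸ hyS)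
    have hk0 := hs.free₁.1
    have hk0' := hs.free₂.1
    let f : Fin 8 → Fin 8 := fun z => if z = 0 then 0 else if z = x then k₁ else k₂
    have f0 : f 0 = 0 := by simp [f]
    have f1 : f x = k₁ := by simp [f, hx0]
    have f2 : f y = k₂ := by simp [f, hy0, hxy.symm]
    obtain ⟨σ, hσ, hσT⟩ := exists_perm {0, x, y} f (by
        intro u hu v hv huv
        simp only [Finset.mem_coe, Finset.mem_insert, Finset.mem_singleton] at hu hv
        rcases hu with rfl | rfl | rfl <;> rcases hv with rfl | rfl | rfl <;>
        first
        | rfl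
        | exfalso
          simp only [f0, f1, f2] at huv
          first
          | exact hk0 huv
          | exact hk0 huv.symm
          | exact hk0' huv
          | exact hk0' huv.symm
          | exact hs.ne huv
          | exact hs.ne huv.symm) ((R₁ ∪ R₂) \ {x, y})
        (Finset.univ \ (P₁ ∪ {0, k₁, k₂})) (by
        rw [Finset.disjoint_left]
        intro u hu hu'
        simp only [Finset.mem_insert, Finset.mem_singleton, Finset.mem_sdiff,
          Finset.mem_union] at hu hu'
        rcases hu with rfl | rfl | rfl
        · tauto
        · tauto
        · tauto) (by
        intro u hu
        simp only [Finset.mem_insert, Finset.mem_singleton] at hu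
        rcases hu with rfl | rfl | rfl
        · simp [f0]
        · simp [f1]
        · simp [f2]) (by
        have h1 : ({x, y} : Finset (Fin 8)) ⊆ R₁ ∪ R₂ := by
          intro u hu
          simp only [Finset.mem_insert, Finset.mem_singleton] at hu
          rcases hu with rfl | rfl
          · exact Finset.mem_union_right _ hxR
          · exact Finset.mem_union_left _ hyR
        rw [Finset.card_sdiff_of_subset h1, hRcard, Finset.card_pair hxy]
        have h2 := Finset.le_card_sdiff (P₁ ∪ {0, k₁, k₂}) Finset.univ
        have h3 := Finset.card_union_le P₁ {0, k₁, k₂}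
        have h4 := Finset.card_le_three (a := (0 : Fin 8)) (b := k₁) (c := k₂)
        rw [Finset.card_univ, Fintype.card_fin] at h2
        omega)
    have hσ0 : σ 0 = 0 := by rw [hσ 0 (by simp), f0]
    have hσx : σ x = k₁ := by rw [hσ x (by simp), f1]
    have hσy : σ y = k₂ := by rw [hσ y (by simp), f2]
    have hav : ∀ r ∈ R₁ ∪ R₂, σ r ∉ P₁ := by
      intro r hr
      by_cases hrx : r = x
      · rw [hrx, hσx]; exact hs.n₁₁
      by_cases hry : r = y
      · rw [hry, hσy]; exact hs.n₂₁
      have := hσT r (by simp only [Finset.mem_sdiff]; exact ⟨hr, by simp [hrx, hry]⟩)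
      rw [Finset.mem_sdiff] at this
      exact fun h => this.2 (Finset.mem_union_left _ h)
    exact h.false_of_perm hG hs.pg hs'.pg σ hσ0 hs.free₁ hs.free₂ (hS₁f x hxS).1 (hS₂f y hyS).1
      hσx hσy (fun r hr => hav r (Finset.mem_union_left _ hr))
      (fun r hr => by rw [← hP₂, ← hP]; exact hav r (Finset.mem_union_right _ hr)) (Or.inl hs.ne)
  · obtain ⟨l, hl₁, hl₂⟩ := Finset.not_disjoint_iff.1 hSS
    have hQQ : ¬ Disjoint Q₁ Q₂ := by
      intro hQQ
      have h1 : Disjoint (Q₁ ∪ Q₂) P₁ := by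
        rw [Finset.disjoint_union_left]
        exact ⟨Finset.disjoint_left.2 fun x hx => (hQ₁f x hx).2,
          Finset.disjoint_left.2 fun x hx => hP ▸ (hQ₂f x hx).2⟩
      have h2 : (insert 0 (Q₁ ∪ Q₂ ∪ P₁)).card ≤ 8 := Finset.card_le_univ _
      have h3 : 0 ∉ Q₁ := fun h => (hQ₁f 0 h).1.1 rfl
      have h4 : 0 ∉ Q₂ := fun h => (hQ₂f 0 h).1.1 rfl
      rw [Finset.card_insert_of_notMem (by simp [h3, h4, h0P]),
        Finset.card_union_of_disjoint h1, Finset.card_union_of_disjoint hQQ] at h2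
      omega
    obtain ⟨k, hk₁, hk₂⟩ := Finset.not_disjoint_iff.1 hQQ
    obtain ⟨σ, hσ0, hσl, hσ⟩ := exists_perm_one (hQ₁f k hk₁).1.1 (hS₁f l hl₁).1.1
      (P := P₁) (R := R₁ ∪ R₂) (by
        rw [Finset.mem_union]
        rintro (h | h)
        · exact (hS₁f l hl₁).2 h
        · exact (hS₂f l hl₂).2 h) (by simp [h0R₁, h0R₂]) (by omega)
    exact h.false_of_perm hG hs.pg hs'.pg σ hσ0 (hQ₁f k hk₁).1 (hQ₂f k hk₂).1 (hS₁f l hl₁).1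
      (hS₂f l hl₂).1 hσl hσl (fun r hr => hσ r (Finset.mem_union_left _ hr))
      (fun r hr => by rw [← hP₂, ← hP]; exact hσ r (Finset.mem_union_right _ hr)) (Or.inr ⟨hna, hnb⟩)

lemma Side.card_le (hG : MinCounter V G) {A : Set V} {a₁ a₂ : V} {c : Sym2 V → Fin 8}
    {k₁ k₂ : Fin 8} (_ : Side G A a₁ a₂ c k₁ k₂) {a b : V} (hb : b ∉ A) (hab : G.Adj a b) :
    (K (inside G A) c a).card ≤ 2 := by
  have := K_card (inside_sub (G := G) (A := A)) (c := c) (z := a) {b} (by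
    simp only [Finset.mem_singleton, forall_eq]
    exact ⟨hab, fun h => (hb (mem_inside.1 h).2.2).elim⟩)
  rw [hG.cubic a, Finset.card_singleton] at this
  omega

lemma TwoCut.false (hG : MinCounter V G) {A : Set V} {a₁ b₁ a₂ b₂ : V}
    (h : TwoCut G A a₁ b₁ a₂ b₂) : False := by
  obtain ⟨c, k₁, k₂, hs⟩ := h.exists_side hG
  obtain ⟨c', l₁, l₂, hs'⟩ := h.compl.exists_side hG
  by_cases h1 : K (inside G A) c a₁ = K (inside G A) c a₂ ∧ (K (inside G A) c a₁).card = 2 ∧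
    Disjoint (K (inside G Aᶜ) c' b₁) (K (inside G Aᶜ) c' b₂) ∧
    (K (inside G Aᶜ) c' b₁).card = 2 ∧ (K (inside G Aᶜ) c' b₂).card = 2
  · exact h.false_of_eq hG hs hs' h1.1 h1.2.1 h1.2.2.1 h1.2.2.2.1 h1.2.2.2.2
  by_cases h2 : K (inside G Aᶜ) c' b₁ = K (inside G Aᶜ) c' b₂ ∧
    (K (inside G Aᶜ) c' b₁).card = 2 ∧
    Disjoint (K (inside G A) c a₁) (K (inside G A) c a₂) ∧
    (K (inside G A) c a₁).card = 2 ∧ (K (inside G A) c a₂).card = 2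
  · have hcc : Aᶜᶜ = A := compl_compl A
    refine h.compl.false_of_eq hG hs' (hcc.symm ▸ hs) h2.1 h2.2.1 ?_ ?_ ?_
    · rw [hcc]; exact h2.2.2.1
    · rw [hcc]; exact h2.2.2.2.1
    · rw [hcc]; exact h2.2.2.2.2
  obtain ⟨σ, hσ0, hσ1, hσ2, hR1, hR2⟩ := exists_perm_two hs.free₁.1 hs.free₂.1 hs.ne hs'.free₁.1
    hs'.free₂.1 hs'.ne (hs.card_le hG h.hb₁ h.adj₁) (hs.card_le hG h.hb₂ h.adj₂)
    (hs'.card_le hG h.compl.hb₁ h.compl.adj₁) (hs'.card_le hG h.compl.hb₂ h.compl.adj₂) (by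
      intro r hr
      rcases Finset.mem_union.1 hr with hr | hr
      · exact ⟨fun h => zero_notMem_K (h ▸ hr), fun h => hs'.n₁₁ (h ▸ hr),
          fun h => hs'.n₂₁ (h ▸ hr)⟩
      · exact ⟨fun h => zero_notMem_K (h ▸ hr), fun h => hs'.n₁₂ (h ▸ hr),
          fun h => hs'.n₂₂ (h ▸ hr)⟩) h1 h2
  exact h.false_of_perm hG hs.pg hs'.pg σ hσ0 hs.free₁ hs.free₂ hs'.free₁ hs'.free₂ hσ1 hσ2 hR1 hR2
    (Or.inl hs.ne)

end TwoCuts2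

section TwoCuts3
open Classical

variable {V : Type} [Finite V] {G : SimpleGraph V}

lemma MinCounter.other_two (hG : MinCounter V G) {b v : V} (h : G.Adj b v) :
    ∃ z₁ z₂, z₁ ≠ v ∧ z₂ ≠ v ∧ z₁ ≠ z₂ ∧ G.Adj b z₁ ∧ G.Adj b z₂ ∧
      ∀ z, G.Adj b z → z = v ∨ z = z₁ ∨ z = z₂ := by
  obtain ⟨z₁, z₂, h1, h2, h3, h4, h5, ⟨h6, -⟩ | ⟨-, h6⟩⟩ := hG.nbr_cases h
  · exact ⟨z₁, z₂, h1, h2, h6, h3, h4, h5⟩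
  · have := hG.cubic b
    unfold V3 at this
    omega

lemma MinCounter.third (hG : MinCounter V G) {v a b : V} (ha : G.Adj v a) (hb : G.Adj v b)
    (hab : a ≠ b) :
    ∃ d, d ≠ a ∧ d ≠ b ∧ G.Adj v d ∧ ∀ z, G.Adj v z → z = a ∨ z = b ∨ z = d := by
  obtain ⟨z₁, z₂, h1, h2, h3, h4, h5, h6⟩ := hG.other_two ha
  rcases h6 b hb with rfl | rfl | rfl
  · exact (hab rfl).elim
  · exact ⟨z₂, h2, h3.symm, h5, h6⟩
  · exact ⟨z₁, h1, h3, h4, fun z hz => by have := h6 z hz; tauto⟩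

lemma MinCounter.no_cut_two_of_eq (hG : MinCounter V G) (A : Set V) {a b₁ b₂ : V} (ha : a ∈ A)
    (hb₁ : b₁ ∉ A) (hb₂ : b₂ ∉ A) (h₁ : G.Adj a b₁) (h₂ : G.Adj a b₂) (hne : b₁ ≠ b₂)
    (hcut : ∀ x ∈ A, ∀ y ∉ A, G.Adj x y → x = a ∧ (y = b₁ ∨ y = b₂)) : False := by
  obtain ⟨w, hw1, hw2, haw, hN⟩ := hG.third h₁ h₂ hne
  have hwA : w ∈ A := by
    by_contra hwA
    have := (hcut a ha w hwA haw).2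
    tauto
  refine hG.no_cut_one (A \ {a}) (a := w) (b := a) ⟨hwA, haw.ne'⟩ (fun h => h.2 rfl) haw.symm ?_
  rintro x ⟨hx, hxa⟩ y hy hxy
  by_cases hyA : y ∈ A
  · have hya : y = a := by
      by_contra hya
      exact hy ⟨hyA, hya⟩
    subst hya
    rcases hN x hxy.symm with rfl | rfl | rfl
    exacts [(hb₁ hx).elim, (hb₂ hx).elim, ⟨rfl, rfl⟩]
  · exact (hxa (hcut x hx y hyA hxy).1).elim

lemma MinCounter.no_cut_two (hG : MinCounter V G) (A : Set V) {a₁ b₁ a₂ b₂ : V} (ha₁ : a₁ ∈ A)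
    (ha₂ : a₂ ∈ A) (hb₁ : b₁ ∉ A) (hb₂ : b₂ ∉ A) (h₁ : G.Adj a₁ b₁) (h₂ : G.Adj a₂ b₂)
    (hcut : ∀ x ∈ A, ∀ y ∉ A, G.Adj x y → (x = a₁ ∧ y = b₁) ∨ (x = a₂ ∧ y = b₂)) : False := by
  by_cases ha : a₁ = a₂
  · subst ha
    by_cases hb : b₁ = b₂
    · subst hb
      exact hG.no_cut_one A ha₁ hb₁ h₁ fun x hx y hy h => by simpa using hcut x hx y hy h
    · exact hG.no_cut_two_of_eq A ha₁ hb₁ hb₂ h₁ h₂ hb fun x hx y hy h => by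
        have := hcut x hx y hy h
        tauto
  by_cases hb : b₁ = b₂
  · subst hb
    refine hG.no_cut_two_of_eq Aᶜ hb₁ (not_not.2 ha₁) (not_not.2 ha₂) h₁.symm h₂.symm ha
      fun x hx y hy h => ?_
    have := hcut y (not_not.1 hy) x hx h.symm
    tauto
  exact TwoCut.false hG ⟨ha₁, ha₂, hb₁, hb₂, h₁, h₂, hcut, ha, hb⟩

lemma MinCounter.reachable_deleteEdges_pair (hG : MinCounter V G) {e₁ e₂ : Sym2 V}
    (u v : V) : (G.deleteEdges {e₁, e₂}).Reachable u v := by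
  by_contra huv
  set G' := G.deleteEdges {e₁, e₂} with hG'
  set A : Set V := {x | G'.Reachable u x} with hA
  have huA : u ∈ A := Reachable.refl u
  have hcross : ∀ x ∈ A, ∀ y ∉ A, G.Adj x y → s(x, y) = e₁ ∨ s(x, y) = e₂ := by
    intro x hx y hy hxy
    have : ¬ G'.Adj x y := fun h => hy (Reachable.trans hx h.reachable)
    by_contra h
    exact this (by simpa [G', hxy] using h)
  have huniq : ∀ x ∈ A, ∀ y ∉ A, ∀ x' ∈ A, ∀ y' ∉ A, s(x, y) = s(x', y') → x = x' ∧ y = y' := by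
    intro x hx y hy x' hx' y' hy' h
    rcases Sym2.eq_iff.1 h with h | ⟨rfl, rfl⟩
    · exact h
    · exact (hy' hx).elim
  have hex : ∃ x ∈ A, ∃ y ∉ A, G.Adj x y := by
    by_contra! h
    obtain ⟨w⟩ := hG.preconnected u v
    have : ∀ (x y : V) (w : G.Walk x y), x ∈ A → y ∈ A := by
      intro x y w
      induction w with
      | nil => exact id
      | cons hxy _ ih =>
        intro hx
        apply ih
        by_contra hy
        exact h _ hx _ hy hxy
    exact huv (this _ _ w huA)
  obtain ⟨x, hx, y, hy, hxy⟩ := hex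
  by_cases h2 : ∃ x' ∈ A, ∃ y' ∉ A, G.Adj x' y' ∧ s(x', y') ≠ s(x, y)
  · obtain ⟨x', hx', y', hy', hxy', hne⟩ := h2
    refine hG.no_cut_two A hx hx' hy hy' hxy hxy' fun p hp q hq hpq => ?_
    have h1 := hcross x hx y hy hxy
    have h2 := hcross x' hx' y' hy' hxy'
    have h3 := hcross p hp q hq hpq
    have h4 : s(p, q) = s(x, y) ∨ s(p, q) = s(x', y') := by
      grind
    exact h4.imp (huniq p hp q hq x hx y hy) (huniq p hp q hq x' hx' y' hy')
  · push Not at h2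
    exact hG.no_cut_one A hx hy hxy fun p hp q hq hpq =>
      huniq p hp q hq x hx y hy (h2 p hp q hq hpq)

end TwoCuts3

section ShortCycles
open Classical

variable {V : Type} [Finite V] {G : SimpleGraph V}

/-- The nonzero colours outside `S`. -/
def lst (S : Finset (Fin 8)) : Finset (Fin 8) := (insert 0 S)ᶜ

lemma mem_lst {S : Finset (Fin 8)} {k : Fin 8} : k ∈ lst S ↔ k ≠ 0 ∧ k ∉ S := by
  simp [lst]

lemma card_lst (S : Finset (Fin 8)) : 7 ≤ (lst S).card + S.card := by
  have := Finset.card_insert_le 0 S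
  rw [lst, Finset.card_compl, Fintype.card_fin]
  omega

/-- A good partial coloring missing only pairwise disjoint edges that can be coloured `0` and edges
with suitable available colours cannot exist. -/
lemma MinCounter.false_of_zeros (hG : MinCounter V G) {D : Set (Sym2 V)} {c : Sym2 V → Fin 8}
    (h : PG G D c) (Z : List (V × V)) (T : List (Sym2 V × Fin 8))
    (hZ : ∀ p ∈ Z, G.Adj p.1 p.2 ∧ ¬ HasZero D c p.1 ∧ ¬ HasZero D c p.2)
    (hZP : Z.Pairwise (fun p q => p.1 ≠ q.1 ∧ p.1 ≠ q.2 ∧ p.2 ≠ q.1 ∧ p.2 ≠ q.2))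
    (hT : ∀ p ∈ T, p.1 ∈ G.edgeSet ∧ p.2 ∈ avail G D c p.1)
    (hP : T.Pairwise (fun p q => p.2 ≠ q.2 ∨ ¬ Near G p.1 q.1))
    (hcov : ∀ e ∈ G.edgeSet, e ∈ D ∨ e ∈ Z.map (fun p => s(p.1, p.2)) ++ T.map Prod.fst) :
    False := by
  refine hG.false_of_extend h (Z.map (fun p => (s(p.1, p.2), 0)) ++ T) ?_ ?_ ?_
  · intro p hp
    rcases List.mem_append.1 hp with hp | hp
    · obtain ⟨q, hq, rfl⟩ := List.mem_map.1 hp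
      obtain ⟨h1, h2, h3⟩ := hZ q hq
      exact ⟨h1, fun _ x _ => hG.cubic x, PG.compat_zero h2 h3⟩
    · exact ⟨(hT p hp).1, fun h0 => ((mem_avail.1 (hT p hp).2).1 h0).elim,
        (mem_avail.1 (hT p hp).2).2⟩
  · rw [List.pairwise_append]
    refine ⟨?_, hP.imp fun hpq _ => hpq.elim compat_of_ne compat_of_not_near, ?_⟩
    · rw [List.pairwise_map]
      refine hZP.imp fun {p q} hpq _ => ⟨?_, fun _ h => (h rfl).elim⟩
      intro _ x hx hx'
      simp only [Sym2.mem_iff] at hx hx'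
      grind
    · intro p hp q hq _
      obtain ⟨r, hr, rfl⟩ := List.mem_map.1 hp
      exact compat_of_ne (Ne.symm (mem_avail.1 (hT q hq).2).1)
  · intro e he
    refine (hcov e he).imp_right fun h => ?_
    simpa [List.mem_append, List.mem_map, or_and_right, exists_or] using h

lemma not_hasZero_avoid {X : Set V} {c : Sym2 V → Fin 8} {z : V} (hz : z ∈ X) :
    ¬ HasZero (avoid G X).edgeSet c z := by
  rintro ⟨e, he, hze, -⟩
  exact (avoid_edgeSet.1 he).2 z hze hz

/-- Colours available on an edge inside `X` whose endpoints have one neighbour outside. -/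
lemma PG.lst_subset_avail {X : Set V} {c : Sym2 V → Fin 8} (h : PG G (avoid G X).edgeSet c)
    {x y a b d d' : V} (hx : ∀ z, G.Adj x z → z = y ∨ z = a ∨ z = d) (ha : a ∈ X)
    (hy : ∀ z, G.Adj y z → z = x ∨ z = b ∨ z = d') (hb : b ∈ X) {k : Fin 8}
    (hk : k ∈ lst (K (avoid G X).edgeSet c d ∪ K (avoid G X).edgeSet c d')) :
    k ∈ avail G (avoid G X).edgeSet c s(x, y) := by
  rw [mem_lst] at hk
  refine h.avail_superset _ ?_ ?_ hk.1 hk.2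
  · intro z hz hzy
    rcases hx z hz with rfl | rfl | rfl
    · exact (hzy rfl).elim
    · rw [K_avoid_empty ha]; exact Finset.empty_subset _
    · exact Finset.subset_union_left
  · intro z hz hzx
    rcases hy z hz with rfl | rfl | rfl
    · exact (hzx rfl).elim
    · rw [K_avoid_empty hb]; exact Finset.empty_subset _
    · exact Finset.subset_union_right

lemma MinCounter.card_K_avoid (hG : MinCounter V G) {X : Set V} (c : Sym2 V → Fin 8) {x d : V}
    (hx : x ∈ X) (hd : G.Adj d x) : (K (avoid G X).edgeSet c d).card ≤ 2 := by
  have := K_card (fun e he => (avoid_edgeSet.1 he).1) (c := c) (z := d)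
    (D := (avoid G X).edgeSet) {x} (by
      simp only [Finset.mem_singleton, forall_eq]
      exact ⟨hd, fun h => ((mem_avoid.1 h).2.2 hx).elim⟩)
  rw [hG.cubic d, Finset.card_singleton] at this
  omega

lemma MinCounter.card_K_avoid_zero (hG : MinCounter V G) {X : Set V} {c : Sym2 V → Fin 8}
    (h : PG G (avoid G X).edgeSet c) {x d : V} (hx : x ∈ X) (hd : G.Adj d x)
    (hz : HasZero (avoid G X).edgeSet c d) : (K (avoid G X).edgeSet c d).card ≤ 1 := by
  have := K_card_zero h hz {x} (by
      simp only [Finset.mem_singleton, forall_eq]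
      exact ⟨hd, fun h => ((mem_avoid.1 h).2.2 hx).elim⟩)
  rw [hG.cubic d, Finset.card_singleton] at this
  omega

lemma card_lst_union {S T : Finset (Fin 8)} (hS : S.card ≤ 2) (hT : T.card ≤ 2) :
    3 ≤ (lst (S ∪ T)).card := by
  have := card_lst (S ∪ T)
  have := Finset.card_union_le S T
  omega

lemma MinCounter.no_diamond (hG : MinCounter V G) {a b c d : V} (hab : G.Adj a b) (hac : G.Adj a c)
    (hbc : G.Adj b c) (had : G.Adj a d) (hbd : G.Adj b d) (hcd : c ≠ d) : False := by
  have hNa : ∀ z, G.Adj a z → z = b ∨ z = c ∨ z = d := by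
    obtain ⟨e, h1, h2, h3, h4⟩ := hG.third hab hac hbc.ne
    rcases h4 d had with rfl | rfl | rfl
    exacts [(hbd.ne rfl).elim, (hcd rfl).elim, h4]
  have hNb : ∀ z, G.Adj b z → z = a ∨ z = c ∨ z = d := by
    obtain ⟨e, h1, h2, h3, h4⟩ := hG.third hab.symm hbc hac.ne
    rcases h4 d hbd with rfl | rfl | rfl
    exacts [(had.ne rfl).elim, (hcd rfl).elim, h4]
  obtain ⟨p, hp1, hp2, hcp, hNc⟩ := hG.third hac.symm hbc.symm hab.ne
  obtain ⟨q, hq1, hq2, hdq, hNd⟩ := hG.third had.symm hbd.symm hab.ne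
  have := hab.ne; have := hac.ne; have := hbc.ne; have := had.ne; have := hbd.ne
  by_cases hpd : p = d
  · subst hpd
    have hqc : q = c := by
      rcases hNd c hcp.symm with rfl | rfl | rfl
      exacts [(hac.ne rfl).elim, (hbc.ne rfl).elim, rfl]
    subst hqc
    obtain ⟨f, hf, -⟩ := hG.color_avoid {a, b, q, p} (x := a) (by simp) hab
    have key : ∀ x ∈ ({a, b, q, p} : Set V), ∀ z, G.Adj x z → z ∈ ({a, b, q, p} : Set V) := by
      rintro x (rfl | rfl | rfl | rfl) z hz
      · rcases hNa z hz with rfl | rfl | rfl <;> simp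
      · rcases hNb z hz with rfl | rfl | rfl <;> simp
      · rcases hNc z hz with rfl | rfl | rfl <;> simp
      · rcases hNd z hz with rfl | rfl | rfl <;> simp
    have hav : ∀ x ∈ ({a, b, q, p} : Set V), ∀ y ∈ ({a, b, q, p} : Set V), ∀ k : Fin 8, k ≠ 0 →
        k ∈ avail G (avoid G {a, b, q, p}).edgeSet f s(x, y) := by
      intro x hx y hy k hk
      refine hf.avail_superset ∅ (fun z hz _ => ?_) (fun z hz _ => ?_) hk (by simp)
      · rw [K_avoid_empty (key x hx z hz)]
      · rw [K_avoid_empty (key y hy z hz)]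
    refine hG.false_of_avail hf [(s(a, b), 1), (s(a, q), 2), (s(a, p), 3), (s(b, q), 4),
      (s(b, p), 5), (s(q, p), 6)] ?_ ?_ (cover_avoid ?_)
    · simp only [List.mem_cons, List.not_mem_nil, or_false]
      rintro _ (rfl | rfl | rfl | rfl | rfl | rfl)
      exacts [⟨hab, hav _ (by simp) _ (by simp) _ (by simp)⟩,
        ⟨hac, hav _ (by simp) _ (by simp) _ (by simp)⟩,
        ⟨had, hav _ (by simp) _ (by simp) _ (by simp)⟩,
        ⟨hbc, hav _ (by simp) _ (by simp) _ (by simp)⟩,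
        ⟨hbd, hav _ (by simp) _ (by simp) _ (by simp)⟩,
        ⟨hcp, hav _ (by simp) _ (by simp) _ (by simp)⟩]
    · simp
    · rintro x (rfl | rfl | rfl | rfl) z hz
      · rcases hNa z hz with rfl | rfl | rfl <;> simp
      · rcases hNb z hz with rfl | rfl | rfl <;> simp
      · rcases hNc z hz with rfl | rfl | rfl <;> simp
      · rcases hNd z hz with rfl | rfl | rfl <;> simp
  · have hqc : q ≠ c := by
      rintro rfl
      rcases hNc d hdq.symm with rfl | rfl | rfl
      exacts [had.ne rfl, hbd.ne rfl, hpd rfl]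
    have := hcp.ne'; have := hdq.ne'
    refine hG.no_cut_two {a, b, c, d} (a₁ := c) (b₁ := p) (a₂ := d) (b₂ := q) (by simp) (by simp)
      (by simp; tauto) (by simp; tauto) hcp hdq ?_
    rintro x (rfl | rfl | rfl | rfl) z hz hxz
    · rcases hNa z hxz with rfl | rfl | rfl <;> simp at hz
    · rcases hNb z hxz with rfl | rfl | rfl <;> simp at hz
    · rcases hNc z hxz with rfl | rfl | rfl <;> simp at hz ⊢
    · rcases hNd z hxz with rfl | rfl | rfl <;> simp at hz ⊢

lemma MinCounter.no_triangle (hG : MinCounter V G) {a b c : V} (hab : G.Adj a b)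
    (hbc : G.Adj b c) (hac : G.Adj a c) : False := by
  obtain ⟨p, hpb, hpc, hap, hNa⟩ := hG.third hab hac hbc.ne
  obtain ⟨q, hqa, hqc, hbq, hNb⟩ := hG.third hab.symm hbc hac.ne
  obtain ⟨r, hra, hrb, hcr, hNc⟩ := hG.third hac.symm hbc.symm hab.ne
  have hpq : p ≠ q := by
    rintro rfl
    exact hG.no_diamond hab hac hbc hap hbq hpc.symm
  have hpr : p ≠ r := by
    rintro rfl
    exact hG.no_diamond hac hab hbc.symm hap hcr hpb.symm
  have hqr : q ≠ r := by
    rintro rfl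
    exact hG.no_diamond hbc hab.symm hac.symm hbq hcr hqa.symm
  have := hab.ne; have := hac.ne; have := hbc.ne; have := hap.ne; have := hbq.ne; have := hcr.ne
  set X : Set V := {a, b, c} with hX
  have haX : a ∈ X := by simp [hX]
  have hbX : b ∈ X := by simp [hX]
  have hcX : c ∈ X := by simp [hX]
  have hpX : p ∉ X := by simp [hX]; tauto
  have hqX : q ∉ X := by simp [hX]; tauto
  have hrX : r ∉ X := by simp [hX]; tauto
  obtain ⟨f, hf, hf0⟩ := hG.color_avoid X haX hab
  have hKp := hG.card_K_avoid f haX hap.symm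
  have hKq := hG.card_K_avoid f hbX hbq.symm
  have hKr := hG.card_K_avoid f hcX hcr.symm
  obtain ⟨k₁, hk₁, -⟩ := pick_one (L := lst (K (avoid G X).edgeSet f p ∪ K (avoid G X).edgeSet f q))
    (by have := card_lst_union hKp hKq; omega)
  obtain ⟨k₂, hk₂, h21⟩ :=
    pick_two (L := lst (K (avoid G X).edgeSet f p ∪ K (avoid G X).edgeSet f r))
    (by have := card_lst_union hKp hKr; omega) k₁
  obtain ⟨k₃, hk₃, h31, h32⟩ :=
    pick_three (L := lst (K (avoid G X).edgeSet f q ∪ K (avoid G X).edgeSet f r))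
    (card_lst_union hKq hKr) k₁ k₂
  refine hG.false_of_zeros hf [(a, p), (b, q), (c, r)]
    [(s(a, b), k₁), (s(a, c), k₂), (s(b, c), k₃)] ?_ ?_ ?_ ?_ (cover_avoid ?_)
  · simp only [List.mem_cons, List.not_mem_nil, or_false]
    rintro _ (rfl | rfl | rfl)
    exacts [⟨hap, not_hasZero_avoid haX, hf0 p hpX a haX hap.symm⟩,
      ⟨hbq, not_hasZero_avoid hbX, hf0 q hqX b hbX hbq.symm⟩,
      ⟨hcr, not_hasZero_avoid hcX, hf0 r hrX c hcX hcr.symm⟩]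
  · simp; tauto
  · simp only [List.mem_cons, List.not_mem_nil, or_false]
    rintro _ (rfl | rfl | rfl)
    exacts [⟨hab, hf.lst_subset_avail hNa hcX hNb hcX hk₁⟩,
      ⟨hac, hf.lst_subset_avail (a := b) (b := b) (fun z hz => by have := hNa z hz; tauto) hbX
        (fun z hz => by have := hNc z hz; tauto) hbX hk₂⟩,
      ⟨hbc, hf.lst_subset_avail (a := a) (b := a) (fun z hz => by have := hNb z hz; tauto) haX
        (fun z hz => by have := hNc z hz; tauto) haX hk₃⟩]
  · simp; tauto
  · rintro x (rfl | rfl | rfl) z hz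
    · rcases hNa z hz with rfl | rfl | rfl <;> simp
    · rcases hNb z hz with rfl | rfl | rfl <;> simp
    · rcases hNc z hz with rfl | rfl | rfl <;> simp

end ShortCycles

section AddEdge
open Classical

variable {V : Type} [Finite V] {G : SimpleGraph V}

/-- Coloring of the edges avoiding `X`, obtained from the graph with a further edge `uv`. -/
lemma MinCounter.color_avoid_edge (hG : MinCounter V G) (X : Set V) {u v p q : V} (hu : u ∉ X)
    (hv : v ∉ X) (huv : u ≠ v) (hn : ¬ G.Adj u v) (hp : p ∈ X) (hq : q ∈ X) (hup : G.Adj u p)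
    (hvq : G.Adj v q) :
    ∃ c k, PG G (avoid G X).edgeSet c ∧
      (∀ z ∉ X, z ≠ u → z ≠ v → ∀ x ∈ X, G.Adj z x → ¬ HasZero (avoid G X).edgeSet c z) ∧
      Disjoint (K (avoid G X).edgeSet c u) (K (avoid G X).edgeSet c v) ∧
      (HasZero (avoid G X).edgeSet c u ∨ HasZero (avoid G X).edgeSet c v → k ≠ 0 ∧
        ∀ z, z = u ∨ z = v ∨ G.Adj u z ∨ G.Adj v z → k ∉ K (avoid G X).edgeSet c z) := by
  set D := (avoid G X).edgeSet with hD
  let H : SimpleGraph V := avoid G X ⊔ edge u v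
  have hH : ∀ x y, H.Adj x y ↔ (G.Adj x y ∧ x ∉ X ∧ y ∉ X) ∨ (x = u ∧ y = v ∨ x = v ∧ y = u) := by
    intro x y
    have h1 : (avoid G X).Adj x y ↔ G.Adj x y ∧ x ∉ X ∧ y ∉ X := mem_avoid
    simp only [H, sup_adj, edge_adj, h1]
    constructor
    · tauto
    · rintro (h | h)
      · exact Or.inl h
      · refine Or.inr ⟨by tauto, ?_⟩
        rintro rfl
        rcases h with ⟨h, h'⟩ | ⟨h, h'⟩
        · exact huv (h.symm.trans h')
        · exact huv (h'.symm.trans h)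
  have hend : ∀ u v p : V, (∀ y, H.Adj u y → (G.Adj u y ∧ u ∉ X ∧ y ∉ X) ∨ y = v) → p ∈ X →
      G.Adj u p → (H.neighborSet u).ncard ≤ (G.neighborSet u).ncard := by
    intro u v p h hp hup
    have h1 : H.neighborSet u ⊆ insert v (G.neighborSet u \ {p}) := by
      intro y hy
      rcases h y hy with h | h
      · exact Or.inr ⟨h.1, fun hyp => h.2.2 (hyp ▸ hp)⟩
      · exact Or.inl h
    have h2 := Set.ncard_le_ncard h1 (Set.toFinite _)
    have h3 := Set.ncard_insert_le v (G.neighborSet u \ {p})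
    have h4 := Set.ncard_sdiff_singleton_add_one (s := G.neighborSet u) (a := p) hup (Set.toFinite _)
    omega
  have hle : ∀ x, (H.neighborSet x).ncard ≤ (G.neighborSet x).ncard := by
    intro x
    by_cases hxu : x = u
    · subst hxu
      exact hend x v p (fun y hy => by have := (hH x y).1 hy; tauto) hp hup
    by_cases hxv : x = v
    · subst hxv
      exact hend x u q (fun y hy => by have := (hH x y).1 hy; tauto) hq hvq
    · exact ncard_nbr_mono fun y hy => by have := (hH x y).1 hy; tauto
  have hcard : H.edgeSet.ncard < G.edgeSet.ncard := by
    have hne : s(u, p) ≠ s(v, q) := by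
      intro h
      rcases Sym2.eq_iff.1 h with h | h
      · exact huv h.1
      · exact hu (h.1 ▸ hq)
    have h1 : H.edgeSet ⊆ insert s(u, v) (G.edgeSet \ {s(u, p), s(v, q)}) := by
      intro e he
      induction e with | _ a b
      rcases (hH a b).1 he with h | h | h
      · refine Or.inr ⟨h.1, ?_⟩
        rintro (h' | h')
        · rcases Sym2.eq_iff.1 h' with h' | h'
          exacts [h.2.2 (h'.2 ▸ hp), h.2.1 (h'.1 ▸ hp)]
        · rcases Sym2.eq_iff.1 h' with h' | h'
          exacts [h.2.2 (h'.2 ▸ hq), h.2.1 (h'.1 ▸ hq)]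
      · exact Or.inl (by rw [h.1, h.2])
      · exact Or.inl (by rw [h.1, h.2, Sym2.eq_swap])
    have h2 := Set.ncard_le_ncard h1 (Set.toFinite _)
    have h3 := Set.ncard_insert_le s(u, v) (G.edgeSet \ {s(u, p), s(v, q)})
    have h4 := Set.ncard_sdiff_add_ncard_of_subset (s := {s(u, p), s(v, q)}) (t := G.edgeSet)
      (by rintro _ (rfl | rfl) <;> assumption) (Set.toFinite _)
    rw [Set.ncard_pair hne] at h4
    omega
  obtain ⟨c, hc⟩ := hG.color H (fun v => (hle v).trans (hG.1 v)) hcard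
  have hDH : D ⊆ H.edgeSet := fun e he => edgeSet_mono le_sup_left he
  have hV : ∀ e ∈ D, ∀ x ∈ e, x ∉ X := fun e he => (avoid_edgeSet.1 he).2
  have huvH : s(u, v) ∈ H.edgeSet := (hH u v).2 (by tauto)
  have huvD : s(u, v) ∉ D := fun h => hn (mem_avoid.1 h).1
  have hHG : PG H H.edgeSet c := PG_of_good hc subset_rfl subset_rfl (fun _ h => h)
    (fun _ _ _ _ h => h)
  refine ⟨c, c s(u, v), PG_of_good hc (fun e he => (avoid_edgeSet.1 he).1) hDH
    (V3_of_le hG.1 hle) ?_, ?_, ?_, ?_⟩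
  · rintro x y ⟨e, he, hxe⟩ ⟨f, hf, hyf⟩ hxy
    exact (hH x y).2 (Or.inl ⟨hxy, hV e he x hxe, hV f hf y hyf⟩)
  · intro z hz hzu hzv x hx hzx
    refine not_hasZero_of_lt hG.1 hc hDH (ncard_nbr_lt (fun y hy => ?_) hzx fun h => ?_)
    · have := (hH z y).1 hy; tauto
    · have := (hH z x).1 h; tauto
  · rw [Finset.disjoint_left]
    intro k hk hk'
    obtain ⟨h0, e, he, hue, rfl⟩ := mem_K.1 hk
    obtain ⟨-, f, hf, hvf, hfe⟩ := mem_K.1 hk'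
    by_cases hef : e = f
    · subst hef
      exact huvD ((Sym2.mem_and_mem_iff huv).1 ⟨hue, hvf⟩ ▸ he)
    · exact (hHG.compat e (hDH he) f (hDH hf) hef).2 hfe.symm h0
        ⟨u, hue, v, hvf, Or.inr ((hH u v).2 (by tauto))⟩
  · intro hz
    have h0 : c s(u, v) ≠ 0 := by
      intro h0
      rcases hz with ⟨e, he, hze, hc0⟩ | ⟨e, he, hze, hc0⟩
      · exact (hHG.compat e (hDH he) _ huvH (fun h => huvD (h ▸ he))).1 hc0 h0 u hze (by simp)
      · exact (hHG.compat e (hDH he) _ huvH (fun h => huvD (h ▸ he))).1 hc0 h0 v hze (by simp)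
    refine ⟨h0, fun z hz hk => ?_⟩
    obtain ⟨-, f, hf, hzf, hfe⟩ := mem_K.1 hk
    refine (hHG.compat _ huvH f (hDH hf) (fun h => huvD (h ▸ hf))).2 hfe.symm h0 ?_
    rcases hz with rfl | rfl | hz | hz
    · exact ⟨z, by simp, z, hzf, Or.inl rfl⟩
    · exact ⟨z, by simp, z, hzf, Or.inl rfl⟩
    · exact ⟨u, by simp, z, hzf, Or.inr ((hH u z).2 (Or.inl ⟨hz, hu, hV f hf z hzf⟩))⟩
    · exact ⟨v, by simp, z, hzf, Or.inr ((hH v z).2 (Or.inl ⟨hz, hv, hV f hf z hzf⟩))⟩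

/-- If `u` and `v` are adjacent, they share at most the colour of the edge joining them. -/
lemma PG.card_K_inter {D : Set (Sym2 V)} {c : Sym2 V → Fin 8} (h : PG G D c) {u v : V}
    (huv : G.Adj u v) : (K D c u ∩ K D c v).card ≤ 1 := by
  rw [Finset.card_le_one]
  suffices ∀ k ∈ K D c u ∩ K D c v, k = c s(u, v) from fun a ha b hb =>
    (this a ha).trans (this b hb).symm
  intro k hk
  rw [Finset.mem_inter] at hk
  obtain ⟨h0, e, he, hue, rfl⟩ := mem_K.1 hk.1
  obtain ⟨-, f, hf, hvf, hfe⟩ := mem_K.1 hk.2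
  by_cases hef : e = f
  · subst hef
    rw [(Sym2.mem_and_mem_iff huv.ne).1 ⟨hue, hvf⟩]
  · exact ((h.compat e he f hf hef).2 hfe.symm h0 ⟨u, hue, v, hvf, Or.inr huv⟩).elim

end AddEdge

section FourLists
open Classical

variable {α : Type*}

lemma four_sdr [DecidableEq α] {A B C D : Finset α} (hA : 3 ≤ A.card) (hB : 2 ≤ B.card) (hC : 2 ≤ C.card)
    (hD : 3 ≤ D.card) (hU : 4 ≤ (A ∪ B ∪ C ∪ D).card) : ∃ a ∈ A, ∃ b ∈ B, ∃ c ∈ C, ∃ d ∈ D,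
      a ≠ b ∧ a ≠ c ∧ a ≠ d ∧ b ≠ c ∧ b ≠ d ∧ c ≠ d := by
  let L : Fin 4 → Finset α := ![A, B, C, D]
  have hsub : ∀ (s : Finset (Fin 4)) i, i ∈ s → (L i).card ≤ (s.biUnion L).card := fun s i hi =>
    Finset.card_le_card (Finset.subset_biUnion_of_mem L hi)
  obtain ⟨f, hf, hfL⟩ := (Finset.all_card_le_biUnion_card_iff_exists_injective L).1 (by
    intro s
    have h4 : s.card ≤ 4 := Finset.card_le_univ s
    by_cases hs4 : s = Finset.univ
    · subst hs4
      have : Finset.univ.biUnion L = A ∪ B ∪ C ∪ D := by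
        ext x
        simp [Fin.exists_fin_succ, L]
      rw [this]
      simpa using hU
    by_cases h03 : 0 ∈ s ∨ 3 ∈ s
    · have h3 : s.card ≤ 3 := by
        have := Finset.card_lt_card (Finset.ssubset_univ_iff.2 hs4)
        rw [Finset.card_univ, Fintype.card_fin] at this
        omega
      rcases h03 with h | h
      · exact h3.trans (hA.trans (hsub s 0 h))
      · exact h3.trans (hD.trans (hsub s 3 h))
    · have h12 : s ⊆ {1, 2} := by
        intro i hi
        push Not at h03
        have h0 : i ≠ 0 := fun h => h03.1 (h ▸ hi)
        have h3 : i ≠ 3 := fun h => h03.2 (h ▸ hi)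
        simp only [Finset.mem_insert, Finset.mem_singleton]
        omega
      have h2 : s.card ≤ 2 := (Finset.card_le_card h12).trans Finset.card_le_two
      rcases s.eq_empty_or_nonempty with rfl | ⟨i, hi⟩
      · simp
      · have := h12 hi
        simp only [Finset.mem_insert, Finset.mem_singleton] at this
        rcases this with rfl | rfl
        · exact h2.trans (hB.trans (hsub s 1 hi))
        · exact h2.trans (hC.trans (hsub s 2 hi)))
  refine ⟨f 0, hfL 0, f 1, hfL 1, f 2, hfL 2, f 3, hfL 3, ?_⟩
  simp [hf.eq_iff]

lemma quad_choice {F K₁ K₂ K₃ K₄ : Finset (Fin 8)} (h₁ : F.card + K₁.card ≤ 2) (h₂ : K₂.card ≤ 2)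
    (h₃ : F.card + K₃.card ≤ 3) (h₄ : K₄.card ≤ 2) (h₁₃ : F.card + (K₁ ∩ K₃).card ≤ 1) :
    ∃ a ∈ lst (F ∪ (K₁ ∪ K₂)), ∃ b ∈ lst (F ∪ (K₂ ∪ K₃)), ∃ c ∈ lst (F ∪ (K₃ ∪ K₄)),
      ∃ d ∈ lst (F ∪ (K₄ ∪ K₁)),
      a ≠ b ∧ a ≠ c ∧ a ≠ d ∧ b ≠ c ∧ b ≠ d ∧ c ≠ d := by
  have key : ∀ P Q : Finset (Fin 8), 7 ≤ (lst (F ∪ (P ∪ Q))).card + F.card + P.card + Q.card := by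
    intro P Q
    have h1 := card_lst (F ∪ (P ∪ Q))
    have h2 := Finset.card_union_le F (P ∪ Q)
    have h3 := Finset.card_union_le P Q
    omega
  have k₁ := key K₁ K₂
  have k₂ := key K₂ K₃
  have k₃ := key K₃ K₄
  have k₄ := key K₄ K₁
  have hU : lst (F ∪ ((K₁ ∩ K₃) ∪ K₂ ∩ K₄)) ⊆ lst (F ∪ (K₁ ∪ K₂)) ∪ lst (F ∪ (K₂ ∪ K₃)) ∪
      lst (F ∪ (K₃ ∪ K₄)) ∪ lst (F ∪ (K₄ ∪ K₁)) := by
    intro x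
    simp only [Finset.mem_union, mem_lst, Finset.mem_inter]
    tauto
  have hU' := Finset.card_le_card hU
  have k₅ := key (K₁ ∩ K₃) (K₂ ∩ K₄)
  have := Finset.card_le_card (Finset.inter_subset_left (s₁ := K₂) (s₂ := K₄))
  exact four_sdr (by omega) (by omega) (by omega) (by omega) (by omega)

lemma five_choice {S L L' : Finset α} (hS : 4 ≤ S.card) (hL : 4 ≤ L.card) (hL' : 4 ≤ L'.card)
    (h : L = L' → 5 ≤ L.card) : ∃ s ∈ S, ∃ a ∈ L, ∃ b ∈ L, ∃ c ∈ L', ∃ d ∈ L',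
      [s, a, b, c, d].Nodup := by
  have main : ∀ {L L' : Finset α}, 4 ≤ L.card → 4 ≤ L'.card → (∃ x ∈ L, x ∉ L') →
      ∃ s ∈ S, ∃ a ∈ L, ∃ b ∈ L, ∃ c ∈ L', ∃ d ∈ L', [s, a, b, c, d].Nodup := by
    intro L L' hL hL' ⟨x, hx, hx'⟩
    obtain ⟨s, hs, hsx⟩ := pick_two (L := S) (by omega) x
    obtain ⟨b, hb, hbx, hbs⟩ := pick_three (L := L) (by omega) x s
    obtain ⟨c, hc, hcs, hcb⟩ := pick_three (L := L') (by omega) s b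
    obtain ⟨d, hd, hds, hdb, hdc⟩ := pick_four hL' s b c
    have hxc : x ≠ c := fun h => hx' (h ▸ hc)
    have hxd : x ≠ d := fun h => hx' (h ▸ hd)
    exact ⟨s, hs, x, hx, b, hb, c, hc, d, hd, by simp; tauto⟩
  by_cases hLL : L = L'
  · subst hLL
    obtain ⟨s, hs, -⟩ := pick_one (L := S) (by omega)
    obtain ⟨a, ha, has⟩ := pick_two (L := L) (by omega) s
    obtain ⟨b, hb, hbs, hba⟩ := pick_three (L := L) (by omega) s a
    obtain ⟨c, hc, hcs, hca, hcb⟩ := pick_four hL s a b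
    obtain ⟨d, hd, hn⟩ := Finset.exists_mem_notMem_of_card_lt_card
      (s := {s, a, b, c}) (t := L) (Finset.card_le_four.trans_lt (h rfl))
    simp only [Finset.mem_insert, Finset.mem_singleton, not_or] at hn
    exact ⟨s, hs, a, ha, b, hb, c, hc, d, hd, by simp; tauto⟩
  · by_cases hsub : L ⊆ L'
    · have : ∃ x ∈ L', x ∉ L := by
        by_contra! h
        exact hLL (hsub.antisymm h)
      obtain ⟨s, hs, a, ha, b, hb, c, hc, d, hd, hn⟩ := main hL' hL this
      exact ⟨s, hs, c, hc, d, hd, a, ha, b, hb, by simp at hn ⊢; tauto⟩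
    · exact main hL hL' (Finset.not_subset.1 hsub)

end FourLists

section Quads
open Classical

variable {V : Type} [Finite V] {G : SimpleGraph V}

/-- A 4-cycle of a cubic graph together with the third neighbours of its vertices. -/
structure Quad (G : SimpleGraph V) (c₁ c₂ c₃ c₄ d₁ d₂ d₃ d₄ : V) : Prop where
  e₁ : G.Adj c₁ c₂
  e₂ : G.Adj c₂ c₃
  e₃ : G.Adj c₃ c₄
  e₄ : G.Adj c₄ c₁
  s₁ : G.Adj c₁ d₁
  s₂ : G.Adj c₂ d₂
  s₃ : G.Adj c₃ d₃
  s₄ : G.Adj c₄ d₄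
  n₁ : ∀ z, G.Adj c₁ z → z = c₄ ∨ z = c₂ ∨ z = d₁
  n₂ : ∀ z, G.Adj c₂ z → z = c₁ ∨ z = c₃ ∨ z = d₂
  n₃ : ∀ z, G.Adj c₃ z → z = c₂ ∨ z = c₄ ∨ z = d₃
  n₄ : ∀ z, G.Adj c₄ z → z = c₃ ∨ z = c₁ ∨ z = d₄
  ne₁₃ : c₁ ≠ c₃
  ne₂₄ : c₂ ≠ c₄
  o₁ : d₁ ≠ c₁ ∧ d₁ ≠ c₂ ∧ d₁ ≠ c₃ ∧ d₁ ≠ c₄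
  o₂ : d₂ ≠ c₁ ∧ d₂ ≠ c₂ ∧ d₂ ≠ c₃ ∧ d₂ ≠ c₄
  o₃ : d₃ ≠ c₁ ∧ d₃ ≠ c₂ ∧ d₃ ≠ c₃ ∧ d₃ ≠ c₄
  o₄ : d₄ ≠ c₁ ∧ d₄ ≠ c₂ ∧ d₄ ≠ c₃ ∧ d₄ ≠ c₄
  d₁₂ : d₁ ≠ d₂
  d₂₃ : d₂ ≠ d₃
  d₃₄ : d₃ ≠ d₄
  d₄₁ : d₄ ≠ d₁

lemma MinCounter.exists_quad (hG : MinCounter V G) {c₁ c₂ c₃ c₄ : V} (e₁ : G.Adj c₁ c₂)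
    (e₂ : G.Adj c₂ c₃) (e₃ : G.Adj c₃ c₄) (e₄ : G.Adj c₄ c₁) (h₁₃ : c₁ ≠ c₃) (h₂₄ : c₂ ≠ c₄) :
    ∃ d₁ d₂ d₃ d₄, Quad G c₁ c₂ c₃ c₄ d₁ d₂ d₃ d₄ := by
  obtain ⟨d₁, h11, h12, s₁, n₁⟩ := hG.third e₄.symm e₁ h₂₄.symm
  obtain ⟨d₂, h21, h22, s₂, n₂⟩ := hG.third e₁.symm e₂ h₁₃
  obtain ⟨d₃, h31, h32, s₃, n₃⟩ := hG.third e₂.symm e₃ h₂₄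
  obtain ⟨d₄, h41, h42, s₄, n₄⟩ := hG.third e₃.symm e₄ h₁₃.symm
  refine ⟨d₁, d₂, d₃, d₄, e₁, e₂, e₃, e₄, s₁, s₂, s₃, s₄, n₁, n₂, n₃, n₄, h₁₃, h₂₄,
    ⟨s₁.ne', h12, ?_, h11⟩, ⟨h21, s₂.ne', h22, ?_⟩, ⟨?_, h31, s₃.ne', h32⟩, ⟨h42, ?_, h41, s₄.ne'⟩,
    ?_, ?_, ?_, ?_⟩
  · rintro rfl; exact hG.no_triangle e₁ e₂ s₁
  · rintro rfl; exact hG.no_triangle e₂ e₃ s₂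
  · rintro rfl; exact hG.no_triangle e₁ e₂ s₃.symm
  · rintro rfl; exact hG.no_triangle e₂ e₃ s₄.symm
  · rintro rfl; exact hG.no_triangle e₁ s₂ s₁
  · rintro rfl; exact hG.no_triangle e₂ s₃ s₂
  · rintro rfl; exact hG.no_triangle e₃ s₄ s₃
  · rintro rfl; exact hG.no_triangle e₄ s₁ s₄

variable {c₁ c₂ c₃ c₄ d₁ d₂ d₃ d₄ : V}

lemma Quad.rot (h : Quad G c₁ c₂ c₃ c₄ d₁ d₂ d₃ d₄) : Quad G c₂ c₃ c₄ c₁ d₂ d₃ d₄ d₁ :=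
  ⟨h.e₂, h.e₃, h.e₄, h.e₁, h.s₂, h.s₃, h.s₄, h.s₁, h.n₂, h.n₃, h.n₄, h.n₁, h.ne₂₄, h.ne₁₃.symm,
    by have := h.o₂; tauto, by have := h.o₃; tauto, by have := h.o₄; tauto, by have := h.o₁; tauto,
    h.d₂₃, h.d₃₄, h.d₄₁, h.d₁₂⟩

lemma Quad.flip (h : Quad G c₁ c₂ c₃ c₄ d₁ d₂ d₃ d₄) : Quad G c₁ c₄ c₃ c₂ d₁ d₄ d₃ d₂ :=
  ⟨h.e₄.symm, h.e₃.symm, h.e₂.symm, h.e₁.symm, h.s₁, h.s₄, h.s₃, h.s₂,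
    fun z hz => or_left_comm.1 (h.n₁ z hz), fun z hz => or_left_comm.1 (h.n₄ z hz),
    fun z hz => or_left_comm.1 (h.n₃ z hz), fun z hz => or_left_comm.1 (h.n₂ z hz),
    h.ne₁₃, h.ne₂₄.symm,
    by have := h.o₁; tauto, by have := h.o₄; tauto, by have := h.o₃; tauto, by have := h.o₂; tauto,
    h.d₄₁.symm, h.d₃₄.symm, h.d₂₃.symm, h.d₁₂.symm⟩

lemma PG.spoke_mem_avail {X : Set V} {c : Sym2 V → Fin 8} (h : PG G (avoid G X).edgeSet c)
    {x y : V} (hx : ∀ z, G.Adj x z → z ≠ y → z ∈ X) {k : Fin 8} (hk : k ≠ 0)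
    (hy : ∀ z, G.Adj y z → k ∉ K (avoid G X).edgeSet c z) :
    k ∈ avail G (avoid G X).edgeSet c s(x, y) :=
  mem_avail.2 ⟨hk, h.compat_edge hk (fun z hz hn => by simp [K_avoid_empty (hx z hz hn)])
    (fun z hz _ => hy z hz)⟩

lemma Quad.avail₁ {X : Set V} {c : Sym2 V → Fin 8} (h : Quad G c₁ c₂ c₃ c₄ d₁ d₂ d₃ d₄)
    (hf : PG G (avoid G X).edgeSet c) (h₃ : c₃ ∈ X) (h₄ : c₄ ∈ X) {F : Finset (Fin 8)} {k : Fin 8}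
    (hk : k ∈ lst (F ∪ (K (avoid G X).edgeSet c d₁ ∪ K (avoid G X).edgeSet c d₂))) :
    k ∈ avail G (avoid G X).edgeSet c s(c₁, c₂) := by
  refine hf.lst_subset_avail (fun z hz => or_left_comm.1 (h.n₁ z hz)) h₄ h.n₂ h₃ ?_
  rw [mem_lst] at hk ⊢
  exact ⟨hk.1, fun h => hk.2 (Finset.mem_union_right _ h)⟩

lemma Quad.not_near (h : Quad G c₁ c₂ c₃ c₄ d₁ d₂ d₃ d₄) (hG : MinCounter V G) (hd : d₁ ≠ d₃)
    (hn : ¬ G.Adj d₁ d₃) : ¬ Near G s(c₁, d₁) s(c₃, d₃) := by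
  have h13 := h.ne₁₃
  have h1 := h.o₁
  have h3 := h.o₃
  rw [near_mk]
  rintro ((h' | h') | (h' | h') | (h' | h') | (h' | h'))
  · exact h13 h'
  · exact hG.no_triangle h.e₁ h.e₂ h'
  · exact h3.1 h'.symm
  · have := h.n₁ _ h'; grind
  · exact h1.2.2.1 h'
  · have := h.n₃ _ h'.symm; grind
  · exact hd h'
  · exact hn h'

end Quads

section Quads2
open Classical

variable {V : Type} [Finite V] {G : SimpleGraph V} {c₁ c₂ c₃ c₄ d₁ d₂ d₃ d₄ : V}

lemma Quad.false_of_eq_eq {d e : V} (hG : MinCounter V G) (h : Quad G c₁ c₂ c₃ c₄ d e d e) :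
    False := by
  obtain ⟨o, ho1, ho3, hdo, hNd⟩ := hG.third h.s₁.symm h.s₃.symm h.ne₁₃
  obtain ⟨p, hp2, hp4, hep, hNe⟩ := hG.third h.s₂.symm h.s₄.symm h.ne₂₄
  obtain ⟨e₁, e₂, e₃, e₄, s₁, s₂, s₃, s₄, n₁, n₂, n₃, n₄, ne₁₃, ne₂₄, o₁, o₂, -, -, hde, -, -, -⟩ :=
    h
  have := e₁.ne; have := e₂.ne; have := e₃.ne; have := e₄.ne
  by_cases hoe : o = e
  · subst hoe
    have hpd : p = d := by
      rcases hNe d hdo.symm with h | h | h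
      exacts [(o₁.2.1 h).elim, (o₁.2.2.2 h).elim, h.symm]
    subst hpd
    set X : Set V := {c₁, c₂, c₃, c₄, p, o} with hX
    obtain ⟨f, hf, -⟩ := hG.color_avoid X (x := c₁) (by simp [hX]) e₁
    have key : ∀ x ∈ X, ∀ z, G.Adj x z → z ∈ X := by
      rintro x (rfl | rfl | rfl | rfl | rfl | rfl) z hz
      · rcases n₁ z hz with rfl | rfl | rfl <;> simp [hX]
      · rcases n₂ z hz with rfl | rfl | rfl <;> simp [hX]
      · rcases n₃ z hz with rfl | rfl | rfl <;> simp [hX]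
      · rcases n₄ z hz with rfl | rfl | rfl <;> simp [hX]
      · rcases hNd z hz with rfl | rfl | rfl <;> simp [hX]
      · rcases hNe z hz with rfl | rfl | rfl <;> simp [hX]
    have hav : ∀ x ∈ X, ∀ y ∈ X, ∀ k : Fin 8, k ≠ 0 →
        k ∈ avail G (avoid G X).edgeSet f s(x, y) := by
      intro x hx y hy k hk
      refine hf.avail_superset ∅ (fun z hz _ => ?_) (fun z hz _ => ?_) hk (by simp)
      · rw [K_avoid_empty (key x hx z hz)]
      · rw [K_avoid_empty (key y hy z hz)]
    refine hG.false_of_zeros hf [(c₁, c₂), (c₃, c₄), (p, o)] [(s(c₂, c₃), 1), (s(c₄, c₁), 2),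
      (s(c₁, p), 3), (s(c₂, o), 4), (s(c₃, p), 5), (s(c₄, o), 6)] ?_ ?_ ?_ ?_ (cover_avoid ?_)
    · simp only [List.mem_cons, List.not_mem_nil, or_false]
      rintro _ (rfl | rfl | rfl)
      exacts [⟨e₁, not_hasZero_avoid (by simp [hX]), not_hasZero_avoid (by simp [hX])⟩,
        ⟨e₃, not_hasZero_avoid (by simp [hX]), not_hasZero_avoid (by simp [hX])⟩,
        ⟨hdo, not_hasZero_avoid (by simp [hX]), not_hasZero_avoid (by simp [hX])⟩]
    · simp; grind
    · simp only [List.mem_cons, List.not_mem_nil, or_false]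
      rintro _ (rfl | rfl | rfl | rfl | rfl | rfl)
      exacts [⟨e₂, hav _ (by simp [hX]) _ (by simp [hX]) _ (by simp)⟩,
        ⟨e₄, hav _ (by simp [hX]) _ (by simp [hX]) _ (by simp)⟩,
        ⟨s₁, hav _ (by simp [hX]) _ (by simp [hX]) _ (by simp)⟩,
        ⟨s₂, hav _ (by simp [hX]) _ (by simp [hX]) _ (by simp)⟩,
        ⟨s₃, hav _ (by simp [hX]) _ (by simp [hX]) _ (by simp)⟩,
        ⟨s₄, hav _ (by simp [hX]) _ (by simp [hX]) _ (by simp)⟩]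
    · simp
    · rintro x (rfl | rfl | rfl | rfl | rfl | rfl) z hz
      · rcases n₁ z hz with rfl | rfl | rfl <;> simp
      · rcases n₂ z hz with rfl | rfl | rfl <;> simp
      · rcases n₃ z hz with rfl | rfl | rfl <;> simp
      · rcases n₄ z hz with rfl | rfl | rfl <;> simp
      · rcases hNd z hz with rfl | rfl | rfl <;> simp
      · rcases hNe z hz with rfl | rfl | rfl <;> simp
  · have hpd : p ≠ d := by
      rintro rfl
      rcases hNd e hep.symm with h | h | h
      exacts [o₂.1 h, o₂.2.2.1 h, hoe h.symm]
    have ho2 : o ≠ c₂ := by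
      rintro rfl; have := n₂ d hdo.symm; tauto
    have ho4 : o ≠ c₄ := by
      rintro rfl; have := n₄ d hdo.symm; tauto
    have hp1 : p ≠ c₁ := by
      rintro rfl; have := n₁ e hep.symm; have := hde.symm; tauto
    have hp3 : p ≠ c₃ := by
      rintro rfl; have := n₃ e hep.symm; have := hde.symm; tauto
    have := hdo.ne'; have := hep.ne'
    refine hG.no_cut_two {c₁, c₂, c₃, c₄, d, e} (a₁ := d) (b₁ := o) (a₂ := e) (b₂ := p)
      (by simp) (by simp) (by simp; tauto) (by simp; tauto) hdo hep ?_
    rintro x (rfl | rfl | rfl | rfl | rfl | rfl) z hz hxz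
    · rcases n₁ z hxz with rfl | rfl | rfl <;> simp at hz
    · rcases n₂ z hxz with rfl | rfl | rfl <;> simp at hz
    · rcases n₃ z hxz with rfl | rfl | rfl <;> simp at hz
    · rcases n₄ z hxz with rfl | rfl | rfl <;> simp at hz
    · rcases hNd z hxz with rfl | rfl | rfl <;> simp at hz ⊢
    · rcases hNe z hxz with rfl | rfl | rfl <;> simp at hz ⊢

/-- The case of two distinct pairs of opposite outer neighbours, given colours on the cycle. -/
lemma Quad.false_of_choice (hG : MinCounter V G) (h : Quad G c₁ c₂ c₃ c₄ d₁ d₂ d₃ d₄) {X : Set V}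
    (hX : ∀ x, x ∈ X ↔ x = c₁ ∨ x = c₂ ∨ x = c₃ ∨ x = c₄) {f : Sym2 V → Fin 8}
    (hf : PG G (avoid G X).edgeSet f) {F : Finset (Fin 8)} (Z : List (V × V))
    (T : List (Sym2 V × Fin 8))
    (hZ : ∀ p ∈ Z, (p.1 ∈ X ∧ p.2 ∉ X) ∧ G.Adj p.1 p.2 ∧ ¬ HasZero (avoid G X).edgeSet f p.2)
    (hZP : Z.Pairwise (fun p q => p.1 ≠ q.1 ∧ p.2 ≠ q.2))
    (hT : ∀ p ∈ T, p.1 ∈ G.edgeSet ∧ p.2 ∈ avail G (avoid G X).edgeSet f p.1 ∧ p.2 ∈ F)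
    (hP : T.Pairwise (fun p q => p.2 ≠ q.2 ∨ ¬ Near G p.1 q.1))
    (hcov : ∀ e, e = s(c₁, d₁) ∨ e = s(c₂, d₂) ∨ e = s(c₃, d₃) ∨ e = s(c₄, d₄) →
      e ∈ Z.map (fun p => s(p.1, p.2)) ∨ e ∈ T.map Prod.fst)
    (h₁ : F.card + (K (avoid G X).edgeSet f d₁).card ≤ 2)
    (h₃ : F.card + (K (avoid G X).edgeSet f d₃).card ≤ 3)
    (h₁₃ : F.card + (K (avoid G X).edgeSet f d₁ ∩ K (avoid G X).edgeSet f d₃).card ≤ 1) :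
    False := by
  have m₁ : c₁ ∈ X := (hX _).2 (by tauto)
  have m₂ : c₂ ∈ X := (hX _).2 (by tauto)
  have m₃ : c₃ ∈ X := (hX _).2 (by tauto)
  have m₄ : c₄ ∈ X := (hX _).2 (by tauto)
  obtain ⟨k₁, hk₁, k₂, hk₂, k₃, hk₃, k₄, hk₄, n12, n13, n14, n23, n24, n34⟩ := quad_choice h₁
    (hG.card_K_avoid f m₂ h.s₂.symm) h₃ (hG.card_K_avoid f m₄ h.s₄.symm) h₁₃
  have nF : ∀ {k S}, k ∈ lst (F ∪ S) → k ∉ F := fun hk hkF =>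
    (mem_lst.1 hk).2 (Finset.mem_union_left _ hkF)
  refine hG.false_of_zeros hf Z
    (T ++ [(s(c₁, c₂), k₁), (s(c₂, c₃), k₂), (s(c₃, c₄), k₃), (s(c₄, c₁), k₄)]) ?_ ?_ ?_ ?_
    (cover_avoid ?_)
  · exact fun p hp => ⟨(hZ p hp).2.1, not_hasZero_avoid (hZ p hp).1.1, (hZ p hp).2.2⟩
  · refine (List.pairwise_iff_forall_sublist.2 fun {p q} hpq => ?_)
    have hpq' := List.pairwise_iff_forall_sublist.1 hZP hpq
    have hp := hZ p (hpq.subset (by simp))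
    have hq := hZ q (hpq.subset (by simp))
    exact ⟨hpq'.1, fun h => hq.1.2 (h ▸ hp.1.1), fun h => hp.1.2 (h ▸ hq.1.1), hpq'.2⟩
  · intro p hp
    rcases List.mem_append.1 hp with hp | hp
    · exact ⟨(hT p hp).1, (hT p hp).2.1⟩
    · simp only [List.mem_cons, List.not_mem_nil, or_false] at hp
      rcases hp with rfl | rfl | rfl | rfl
      exacts [⟨h.e₁, h.avail₁ hf m₃ m₄ hk₁⟩, ⟨h.e₂, h.rot.avail₁ hf m₄ m₁ hk₂⟩,
        ⟨h.e₃, h.rot.rot.avail₁ hf m₁ m₂ hk₃⟩, ⟨h.e₄, h.rot.rot.rot.avail₁ hf m₂ m₃ hk₄⟩]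
  · rw [List.pairwise_append]
    refine ⟨hP, by simp; tauto, fun p hp q hq => Or.inl ?_⟩
    simp only [List.mem_cons, List.not_mem_nil, or_false] at hq
    intro hpq
    have := (hT p hp).2.2
    rw [hpq] at this
    rcases hq with rfl | rfl | rfl | rfl
    exacts [nF hk₁ this, nF hk₂ this, nF hk₃ this, nF hk₄ this]
  · have hc' : ∀ e, e = s(c₁, d₁) ∨ e = s(c₂, d₂) ∨ e = s(c₃, d₃) ∨ e = s(c₄, d₄) →
        e ∈ Z.map (fun p => s(p.1, p.2)) ++ (T ++ [(s(c₁, c₂), k₁), (s(c₂, c₃), k₂),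
          (s(c₃, c₄), k₃), (s(c₄, c₁), k₄)]).map Prod.fst := by
      intro e he
      rw [List.map_append, List.mem_append, List.mem_append]
      exact (hcov e he).imp_right Or.inl
    intro x hx z hz
    rw [hX] at hx
    rcases hx with rfl | rfl | rfl | rfl
    · rcases h.n₁ z hz with rfl | rfl | rfl
      · simp
      · simp
      · exact hc' _ (by simp)
    · rcases h.n₂ z hz with rfl | rfl | rfl
      · simp
      · simp
      · exact hc' _ (by simp)
    · rcases h.n₃ z hz with rfl | rfl | rfl
      · simp
      · simp
      · exact hc' _ (by simp)
    · rcases h.n₄ z hz with rfl | rfl | rfl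
      · simp
      · simp
      · exact hc' _ (by simp)

lemma Quad.notMem (h : Quad G c₁ c₂ c₃ c₄ d₁ d₂ d₃ d₄) {X : Set V}
    (hX : ∀ x, x ∈ X ↔ x = c₁ ∨ x = c₂ ∨ x = c₃ ∨ x = c₄) : d₁ ∉ X := by
  have := h.o₁
  rw [hX]
  tauto

lemma Quad.false_of_one_zero (hG : MinCounter V G) (h : Quad G c₁ c₂ c₃ c₄ d₁ d₂ d₃ d₄)
    (h₂₄ : d₂ ≠ d₄) {X : Set V} (hX : ∀ x, x ∈ X ↔ x = c₁ ∨ x = c₂ ∨ x = c₃ ∨ x = c₄)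
    {f : Sym2 V → Fin 8} (hf : PG G (avoid G X).edgeSet f)
    (hd : Disjoint (K (avoid G X).edgeSet f d₁) (K (avoid G X).edgeSet f d₃))
    (hz₁ : HasZero (avoid G X).edgeSet f d₁) (hz₂ : ¬ HasZero (avoid G X).edgeSet f d₂)
    (hz₃ : ¬ HasZero (avoid G X).edgeSet f d₃) (hz₄ : ¬ HasZero (avoid G X).edgeSet f d₄)
    {k : Fin 8} (hk : k ≠ 0) (hkK : ∀ z, G.Adj d₁ z → k ∉ K (avoid G X).edgeSet f z) : False := by
  have m₁ : c₁ ∈ X := (hX _).2 (by tauto)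
  have m₂ : c₂ ∈ X := (hX _).2 (by tauto)
  have m₃ : c₃ ∈ X := (hX _).2 (by tauto)
  have m₄ : c₄ ∈ X := (hX _).2 (by tauto)
  have hK₁ := hG.card_K_avoid_zero hf m₁ h.s₁.symm hz₁
  have hK₃ := hG.card_K_avoid f m₃ h.s₃.symm
  have hX₂ := h.rot.notMem (X := X) (fun x => by rw [hX]; tauto)
  have hX₃ := h.rot.rot.notMem (X := X) (fun x => by rw [hX]; tauto)
  have hX₄ := h.rot.rot.rot.notMem (X := X) (fun x => by rw [hX]; tauto)
  refine h.false_of_choice hG hX hf (F := {k}) [(c₂, d₂), (c₃, d₃), (c₄, d₄)] [(s(c₁, d₁), k)]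
    ?_ ?_ ?_ (by simp) ?_ (by simp; omega) (by simp; omega) ?_
  · simp only [List.mem_cons, List.not_mem_nil, or_false]
    rintro _ (rfl | rfl | rfl)
    exacts [⟨⟨m₂, hX₂⟩, h.s₂, hz₂⟩, ⟨⟨m₃, hX₃⟩, h.s₃, hz₃⟩, ⟨⟨m₄, hX₄⟩, h.s₄, hz₄⟩]
  · have := h.d₂₃; have := h.d₃₄; have := h.e₂.ne; have := h.e₃.ne; have := h.ne₂₄
    simp; tauto
  · simp only [List.mem_singleton, forall_eq, Finset.mem_singleton, and_true]
    refine ⟨h.s₁, hf.spoke_mem_avail (fun z hz hn => ?_) hk hkK⟩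
    rcases h.n₁ z hz with rfl | rfl | rfl
    exacts [m₄, m₂, (hn rfl).elim]
  · rintro e (rfl | rfl | rfl | rfl) <;> simp
  · rw [Finset.disjoint_iff_inter_eq_empty.1 hd]; simp

lemma Quad.false_of_ne (hG : MinCounter V G) (h : Quad G c₁ c₂ c₃ c₄ d₁ d₂ d₃ d₄)
    (h₁₃ : d₁ ≠ d₃) (h₂₄ : d₂ ≠ d₄) : False := by
  obtain ⟨X, hX⟩ : ∃ X : Set V, ∀ x, x ∈ X ↔ x = c₁ ∨ x = c₂ ∨ x = c₃ ∨ x = c₄ :=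
    ⟨{x | x = c₁ ∨ x = c₂ ∨ x = c₃ ∨ x = c₄}, fun x => Iff.rfl⟩
  have m₁ : c₁ ∈ X := (hX _).2 (by tauto)
  have m₂ : c₂ ∈ X := (hX _).2 (by tauto)
  have m₃ : c₃ ∈ X := (hX _).2 (by tauto)
  have m₄ : c₄ ∈ X := (hX _).2 (by tauto)
  have hX₁ := h.notMem hX
  have hX₂ := h.rot.notMem (X := X) (fun x => by rw [hX]; tauto)
  have hX₃ := h.rot.rot.notMem (X := X) (fun x => by rw [hX]; tauto)
  have hX₄ := h.rot.rot.rot.notMem (X := X) (fun x => by rw [hX]; tauto)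
  have zero : ∀ f, PG G (avoid G X).edgeSet f →
      (K (avoid G X).edgeSet f d₁ ∩ K (avoid G X).edgeSet f d₃).card ≤ 1 →
      ¬ HasZero (avoid G X).edgeSet f d₁ → ¬ HasZero (avoid G X).edgeSet f d₂ →
      ¬ HasZero (avoid G X).edgeSet f d₃ → ¬ HasZero (avoid G X).edgeSet f d₄ → False := by
    intro f hf hi hz₁ hz₂ hz₃ hz₄
    have hK₁ := hG.card_K_avoid f m₁ h.s₁.symm
    have hK₃ := hG.card_K_avoid f m₃ h.s₃.symm
    refine h.false_of_choice hG hX hf (F := ∅) [(c₁, d₁), (c₂, d₂), (c₃, d₃), (c₄, d₄)] []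
      ?_ ?_ (by simp) (by simp) ?_ (by simpa using hK₁) (by simp; omega) (by simpa using hi)
    · simp only [List.mem_cons, List.not_mem_nil, or_false]
      rintro _ (rfl | rfl | rfl | rfl)
      exacts [⟨⟨m₁, hX₁⟩, h.s₁, hz₁⟩, ⟨⟨m₂, hX₂⟩, h.s₂, hz₂⟩, ⟨⟨m₃, hX₃⟩, h.s₃, hz₃⟩,
        ⟨⟨m₄, hX₄⟩, h.s₄, hz₄⟩]
    · have := h.d₁₂; have := h.d₂₃; have := h.d₃₄; have := h.d₄₁.symm
      have := h.e₁.ne; have := h.e₂.ne; have := h.e₃.ne; have := h.e₄.ne'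
      have := h.ne₁₃; have := h.ne₂₄
      simp; tauto
    · rintro e (rfl | rfl | rfl | rfl) <;> simp
  by_cases hadj : G.Adj d₁ d₃
  · obtain ⟨f, hf, hf0⟩ := hG.color_avoid X m₁ h.e₁
    exact zero f hf (hf.card_K_inter hadj) (hf0 _ hX₁ _ m₁ h.s₁.symm) (hf0 _ hX₂ _ m₂ h.s₂.symm)
      (hf0 _ hX₃ _ m₃ h.s₃.symm) (hf0 _ hX₄ _ m₄ h.s₄.symm)
  obtain ⟨f, k, hf, hf0, hdis, hk⟩ := hG.color_avoid_edge X hX₁ hX₃ h₁₃ hadj m₁ m₃ h.s₁.symm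
    h.s₃.symm
  have hz₂ := hf0 d₂ hX₂ h.d₁₂.symm h.d₂₃ c₂ m₂ h.s₂.symm
  have hz₄ := hf0 d₄ hX₄ h.d₄₁ h.d₃₄.symm c₄ m₄ h.s₄.symm
  by_cases hz₁ : HasZero (avoid G X).edgeSet f d₁
  · obtain ⟨hk0, hk⟩ := hk (Or.inl hz₁)
    by_cases hz₃ : HasZero (avoid G X).edgeSet f d₃
    · have hK₁ := hG.card_K_avoid_zero hf m₁ h.s₁.symm hz₁
      have hK₃ := hG.card_K_avoid_zero hf m₃ h.s₃.symm hz₃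
      refine h.false_of_choice hG hX hf (F := {k}) [(c₂, d₂), (c₄, d₄)]
        [(s(c₁, d₁), k), (s(c₃, d₃), k)] ?_ ?_ ?_ ?_ ?_ (by simp; omega) (by simp; omega) ?_
      · simp only [List.mem_cons, List.not_mem_nil, or_false]
        rintro _ (rfl | rfl)
        exacts [⟨⟨m₂, hX₂⟩, h.s₂, hz₂⟩, ⟨⟨m₄, hX₄⟩, h.s₄, hz₄⟩]
      · have := h.ne₂₄
        simp; tauto
      · simp only [List.mem_cons, List.not_mem_nil, or_false]
        rintro _ (rfl | rfl)
        · refine ⟨h.s₁, hf.spoke_mem_avail (fun z hz hn => ?_) hk0 fun z hz => hk z (by tauto),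
            by simp⟩
          rcases h.n₁ z hz with rfl | rfl | rfl
          exacts [m₄, m₂, (hn rfl).elim]
        · refine ⟨h.s₃, hf.spoke_mem_avail (fun z hz hn => ?_) hk0 fun z hz => hk z (by tauto),
            by simp⟩
          rcases h.n₃ z hz with rfl | rfl | rfl
          exacts [m₂, m₄, (hn rfl).elim]
      · simpa using h.not_near hG h₁₃ hadj
      · rintro e (rfl | rfl | rfl | rfl) <;> simp
      · rw [Finset.disjoint_iff_inter_eq_empty.1 hdis]; simp
    · exact h.false_of_one_zero hG h₂₄ hX hf hdis hz₁ hz₂ hz₃ hz₄ hk0 fun z hz => hk z (by tauto)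
  · by_cases hz₃ : HasZero (avoid G X).edgeSet f d₃
    · obtain ⟨hk0, hk⟩ := hk (Or.inr hz₃)
      exact h.rot.rot.false_of_one_zero hG h₂₄.symm (fun x => by rw [hX]; tauto) hf hdis.symm hz₃
        hz₄ hz₁ hz₂ hk0 fun z hz => hk z (by tauto)
    · exact zero f hf (by rw [Finset.disjoint_iff_inter_eq_empty.1 hdis]; simp) hz₁ hz₂ hz₃ hz₄

end Quads2

section Quads3
open Classical

variable {V : Type} [Finite V] {G : SimpleGraph V} {c₁ c₂ c₃ c₄ d d₂ d₄ : V}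

lemma Quad.card_K_le_one (hG : MinCounter V G) (h : Quad G c₁ c₂ c₃ c₄ d d₂ d d₄) {X : Set V}
    (m₁ : c₁ ∈ X) (m₃ : c₃ ∈ X) (f : Sym2 V → Fin 8) : (K (avoid G X).edgeSet f d).card ≤ 1 := by
  have := K_card (fun e he => (avoid_edgeSet.1 he).1) (c := f) (z := d)
    (D := (avoid G X).edgeSet) {c₁, c₃} (by
      simp only [Finset.mem_insert, Finset.mem_singleton, forall_eq_or_imp, forall_eq]
      exact ⟨⟨h.s₁.symm, fun h => ((mem_avoid.1 h).2.2 m₁).elim⟩,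
        ⟨h.s₃.symm, fun h => ((mem_avoid.1 h).2.2 m₃).elim⟩⟩)
  rw [hG.cubic d, Finset.card_pair h.ne₁₃] at this
  omega

lemma Quad.spoke_avail {o : V} (h : Quad G c₁ c₂ c₃ c₄ d d₂ d d₄)
    (hN : ∀ z, G.Adj d z → z = c₁ ∨ z = c₃ ∨ z = o) {X : Set V} (m₁ : c₁ ∈ X) (m₂ : c₂ ∈ X)
    (m₄ : c₄ ∈ X) {f : Sym2 V → Fin 8} (hf : PG G (avoid G X).edgeSet f) {F : Finset (Fin 8)}
    {k : Fin 8} (hk : k ∈ lst (F ∪ K (avoid G X).edgeSet f o)) :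
    k ∈ avail G (avoid G X).edgeSet f s(c₃, d) := by
  rw [mem_lst] at hk
  refine hf.avail_superset (K (avoid G X).edgeSet f o) (fun z hz hn => ?_) (fun z hz hn => ?_) hk.1
    fun h => hk.2 (Finset.mem_union_right _ h)
  · rcases h.n₃ z hz with rfl | rfl | rfl
    · simp [K_avoid_empty m₂]
    · simp [K_avoid_empty m₄]
    · exact (hn rfl).elim
  · rcases hN z hz with rfl | rfl | rfl
    · simp [K_avoid_empty m₁]
    · exact (hn rfl).elim
    · exact subset_rfl

lemma Quad.false_of_eq_zero_free {o : V} (hG : MinCounter V G)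
    (h : Quad G c₁ c₂ c₃ c₄ d d₂ d d₄) (hN : ∀ z, G.Adj d z → z = c₁ ∨ z = c₃ ∨ z = o)
    (h₂₄ : d₂ ≠ d₄) {X : Set V} (hX : ∀ x, x ∈ X ↔ x = c₁ ∨ x = c₂ ∨ x = c₃ ∨ x = c₄)
    {f : Sym2 V → Fin 8} (hf : PG G (avoid G X).edgeSet f)
    (hi : (K (avoid G X).edgeSet f d₂ ∩ K (avoid G X).edgeSet f d₄).card ≤ 1)
    (hz : ¬ HasZero (avoid G X).edgeSet f d) (hz₂ : ¬ HasZero (avoid G X).edgeSet f d₂)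
    (hz₄ : ¬ HasZero (avoid G X).edgeSet f d₄) : False := by
  have m₁ : c₁ ∈ X := (hX _).2 (by tauto)
  have m₂ : c₂ ∈ X := (hX _).2 (by tauto)
  have m₃ : c₃ ∈ X := (hX _).2 (by tauto)
  have m₄ : c₄ ∈ X := (hX _).2 (by tauto)
  have hK := h.card_K_le_one hG m₁ m₃ f
  have hK₂ := hG.card_K_avoid f m₂ h.s₂.symm
  have hK₄ := hG.card_K_avoid f m₄ h.s₄.symm
  have hKo := K_card_le_three hG.1 (fun e he => (avoid_edgeSet.1 he).1)
    (D := (avoid G X).edgeSet) (c := f) o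
  set D := (avoid G X).edgeSet with hD
  have l₀ := card_lst (∅ ∪ K D f o)
  have l₁ := card_lst (∅ ∪ (K D f d ∪ K D f d₂))
  have l₂ := card_lst (∅ ∪ (K D f d ∪ K D f d₄))
  have u₁ := Finset.card_union_le (K D f d) (K D f d₂)
  have u₂ := Finset.card_union_le (K D f d) (K D f d₄)
  rw [Finset.empty_union] at l₀ l₁ l₂
  obtain ⟨s, hs, k₁, hk₁, k₂, hk₂, k₃, hk₃, k₄, hk₄, hnd⟩ := five_choice
    (S := lst (∅ ∪ K D f o)) (L := lst (∅ ∪ (K D f d ∪ K D f d₂)))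
    (L' := lst (∅ ∪ (K D f d ∪ K D f d₄)))
    (by rw [Finset.empty_union]; omega) (by rw [Finset.empty_union]; omega)
    (by rw [Finset.empty_union]; omega) (by
      intro hLL
      have hsub : K D f d ∪ K D f d₂ ⊆ K D f d ∪ (K D f d₂ ∩ K D f d₄) := by
        intro k hk
        have hk0 : k ≠ 0 := by
          rintro rfl
          rcases Finset.mem_union.1 hk with hk | hk <;> exact zero_notMem_K hk
        have := Finset.ext_iff.1 hLL k
        simp only [mem_lst, Finset.mem_union, Finset.notMem_empty, false_or,
          Finset.mem_inter] at this hk ⊢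
        tauto
      have h1 := Finset.card_le_card hsub
      have h2 := Finset.card_union_le (K D f d) (K D f d₂ ∩ K D f d₄)
      rw [Finset.empty_union]
      omega)
  refine hG.false_of_zeros hf [(c₁, d), (c₂, d₂), (c₄, d₄)] [(s(c₃, d), s), (s(c₁, c₂), k₁),
    (s(c₂, c₃), k₂), (s(c₃, c₄), k₃), (s(c₄, c₁), k₄)] ?_ ?_ ?_ ?_ (cover_avoid ?_)
  · simp only [List.mem_cons, List.not_mem_nil, or_false]
    rintro _ (rfl | rfl | rfl)
    exacts [⟨h.s₁, not_hasZero_avoid m₁, hz⟩, ⟨h.s₂, not_hasZero_avoid m₂, hz₂⟩,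
      ⟨h.s₄, not_hasZero_avoid m₄, hz₄⟩]
  · have := h.e₁.ne; have := h.e₄.ne'; have := h.ne₂₄; have := h.o₁; have := h.o₂; have := h.o₄
    have := h.d₁₂; have := h.d₄₁
    simp; grind
  · simp only [List.mem_cons, List.not_mem_nil, or_false]
    rintro _ (rfl | rfl | rfl | rfl | rfl)
    exacts [⟨h.s₃, h.spoke_avail hN m₁ m₂ m₄ hf hs⟩, ⟨h.e₁, h.avail₁ hf m₃ m₄ hk₁⟩,
      ⟨h.e₂, h.rot.avail₁ hf m₄ m₁ (by rw [Finset.union_comm (K D f d)] at hk₂; exact hk₂)⟩,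
      ⟨h.e₃, h.rot.rot.avail₁ hf m₁ m₂ hk₃⟩,
      ⟨h.e₄, h.rot.rot.rot.avail₁ hf m₂ m₃
        (by rw [Finset.union_comm (K D f d)] at hk₄; exact hk₄)⟩]
  · simp at hnd ⊢; tauto
  · intro x hx z hz
    rw [hX] at hx
    rcases hx with rfl | rfl | rfl | rfl
    · rcases h.n₁ z hz with rfl | rfl | rfl <;> simp
    · rcases h.n₂ z hz with rfl | rfl | rfl <;> simp
    · rcases h.n₃ z hz with rfl | rfl | rfl <;> simp
    · rcases h.n₄ z hz with rfl | rfl | rfl <;> simp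

set_option maxHeartbeats 2000000 in
/-- The case in which the edge at `c₂` leaving the cycle receives a nonzero colour `k`. -/
lemma Quad.false_of_eq_zero {o : V} (hG : MinCounter V G)
    (h : Quad G c₁ c₂ c₃ c₄ d d₂ d d₄) (hN : ∀ z, G.Adj d z → z = c₁ ∨ z = c₃ ∨ z = o)
    (h₂₄ : d₂ ≠ d₄) (hadj : ¬ G.Adj d₂ d₄) {X : Set V}
    (hX : ∀ x, x ∈ X ↔ x = c₁ ∨ x = c₂ ∨ x = c₃ ∨ x = c₄)
    {f : Sym2 V → Fin 8} (hf : PG G (avoid G X).edgeSet f)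
    (hz : ¬ HasZero (avoid G X).edgeSet f d) (hz₂ : HasZero (avoid G X).edgeSet f d₂) {k : Fin 8}
    (hk : k ≠ 0) (hkK : ∀ z, G.Adj d₂ z ∨ G.Adj d₄ z → k ∉ K (avoid G X).edgeSet f z) : False := by
  have m₁ : c₁ ∈ X := (hX _).2 (by tauto)
  have m₂ : c₂ ∈ X := (hX _).2 (by tauto)
  have m₃ : c₃ ∈ X := (hX _).2 (by tauto)
  have m₄ : c₄ ∈ X := (hX _).2 (by tauto)
  have hK := h.card_K_le_one hG m₁ m₃ f
  have hK₂ := hG.card_K_avoid_zero hf m₂ h.s₂.symm hz₂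
  have hK₄ := hG.card_K_avoid f m₄ h.s₄.symm
  have hKo := K_card_le_three hG.1 (fun e he => (avoid_edgeSet.1 he).1)
    (D := (avoid G X).edgeSet) (c := f) o
  have hk₀ : k ∈ avail G (avoid G X).edgeSet f s(c₂, d₂) := by
    refine hf.spoke_mem_avail (fun z hz hn => ?_) hk fun z hz => hkK z (Or.inl hz)
    rcases h.n₂ z hz with rfl | rfl | rfl
    exacts [m₁, m₃, (hn rfl).elim]
  have hk₀' : k ∈ avail G (avoid G X).edgeSet f s(c₄, d₄) := by
    refine hf.spoke_mem_avail (fun z hz hn => ?_) hk fun z hz => hkK z (Or.inr hz)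
    rcases h.n₄ z hz with rfl | rfl | rfl
    exacts [m₃, m₁, (hn rfl).elim]
  set D := (avoid G X).edgeSet with hD
  have key : ∀ P : Finset (Fin 8), 6 ≤ (lst ({k} ∪ P)).card + P.card := by
    intro P
    have h1 := card_lst ({k} ∪ P)
    have h2 := Finset.card_union_le {k} P
    rw [Finset.card_singleton] at h2
    omega
  have l₀ := key (K D f o)
  have l₁ := key (K D f d ∪ K D f d₂)
  have l₃ := key (K D f d ∪ K D f d₄)
  have l₄ := key (K D f d₄ ∪ K D f d)
  have u₁ := Finset.card_union_le (K D f d) (K D f d₂)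
  have u₃ := Finset.card_union_le (K D f d) (K D f d₄)
  have u₄ := Finset.card_union_le (K D f d₄) (K D f d)
  obtain ⟨s, hs, k₃, hk₃, k₄, hk₄, k₁, hk₁, hs3, hs4, hs1, h34, h31, h41⟩ := greedy_four
    (A := lst ({k} ∪ K D f o)) (B := lst ({k} ∪ (K D f d ∪ K D f d₄)))
    (C := lst ({k} ∪ (K D f d₄ ∪ K D f d))) (D := lst ({k} ∪ (K D f d ∪ K D f d₂)))
    (by omega) (by omega) (by omega) (by omega)
  have nk : ∀ {l S}, l ∈ lst ({k} ∪ S) → k ≠ l := fun hl hkl =>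
    (mem_lst.1 hl).2 (Finset.mem_union_left _ (Finset.mem_singleton.2 hkl.symm))
  have := nk hs; have := nk hk₁; have := nk hk₃; have := nk hk₄
  have hT : ∀ p ∈ [(s(c₃, d), s), (s(c₁, c₂), k₁), (s(c₃, c₄), k₃), (s(c₄, c₁), k₄)],
      p.1 ∈ G.edgeSet ∧ p.2 ∈ avail G D f p.1 := by
    simp only [List.mem_cons, List.not_mem_nil, or_false]
    rintro _ (rfl | rfl | rfl | rfl)
    exacts [⟨h.s₃, h.spoke_avail hN m₁ m₂ m₄ hf hs⟩, ⟨h.e₁, h.avail₁ hf m₃ m₄ hk₁⟩,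
      ⟨h.e₃, h.rot.rot.avail₁ hf m₁ m₂ hk₃⟩, ⟨h.e₄, h.rot.rot.rot.avail₁ hf m₂ m₃ hk₄⟩]
  have := h.e₁.ne; have := h.e₂.ne; have := h.e₃.ne; have := h.e₄.ne'; have := h.ne₂₄
  have := h.ne₁₃; have := h.o₁; have := h.o₂; have := h.o₄; have := h.d₁₂; have := h.d₄₁
  by_cases hz₄ : HasZero D f d₄
  · refine hG.false_of_zeros hf [(c₁, d), (c₂, c₃)] ((s(c₂, d₂), k) :: (s(c₄, d₄), k) ::
      [(s(c₃, d), s), (s(c₁, c₂), k₁), (s(c₃, c₄), k₃), (s(c₄, c₁), k₄)]) ?_ ?_ ?_ ?_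
      (cover_avoid ?_)
    · simp only [List.mem_cons, List.not_mem_nil, or_false]
      rintro _ (rfl | rfl)
      exacts [⟨h.s₁, not_hasZero_avoid m₁, hz⟩, ⟨h.e₂, not_hasZero_avoid m₂, not_hasZero_avoid m₃⟩]
    · simp; grind
    · simp only [List.forall_mem_cons]
      exact ⟨⟨h.s₂, hk₀⟩, ⟨h.s₄, hk₀'⟩, by simpa using hT⟩
    · have := h.rot.not_near hG h₂₄ hadj
      simp; tauto
    · intro x hx z hz
      rw [hX] at hx
      rcases hx with rfl | rfl | rfl | rfl
      · rcases h.n₁ z hz with rfl | rfl | rfl <;> simp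
      · rcases h.n₂ z hz with rfl | rfl | rfl <;> simp
      · rcases h.n₃ z hz with rfl | rfl | rfl <;> simp
      · rcases h.n₄ z hz with rfl | rfl | rfl <;> simp
  · refine hG.false_of_zeros hf [(c₁, d), (c₂, c₃), (c₄, d₄)] ((s(c₂, d₂), k) ::
      [(s(c₃, d), s), (s(c₁, c₂), k₁), (s(c₃, c₄), k₃), (s(c₄, c₁), k₄)]) ?_ ?_ ?_ ?_
      (cover_avoid ?_)
    · simp only [List.mem_cons, List.not_mem_nil, or_false]
      rintro _ (rfl | rfl | rfl)
      exacts [⟨h.s₁, not_hasZero_avoid m₁, hz⟩, ⟨h.e₂, not_hasZero_avoid m₂, not_hasZero_avoid m₃⟩,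
        ⟨h.s₄, not_hasZero_avoid m₄, hz₄⟩]
    · simp; grind
    · simp only [List.forall_mem_cons]
      exact ⟨⟨h.s₂, hk₀⟩, by simpa using hT⟩
    · simp; tauto
    · intro x hx z hz
      rw [hX] at hx
      rcases hx with rfl | rfl | rfl | rfl
      · rcases h.n₁ z hz with rfl | rfl | rfl <;> simp
      · rcases h.n₂ z hz with rfl | rfl | rfl <;> simp
      · rcases h.n₃ z hz with rfl | rfl | rfl <;> simp
      · rcases h.n₄ z hz with rfl | rfl | rfl <;> simp

lemma Quad.false_of_eq (hG : MinCounter V G) (h : Quad G c₁ c₂ c₃ c₄ d d₂ d d₄)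
    (h₂₄ : d₂ ≠ d₄) : False := by
  obtain ⟨X, hX⟩ : ∃ X : Set V, ∀ x, x ∈ X ↔ x = c₁ ∨ x = c₂ ∨ x = c₃ ∨ x = c₄ :=
    ⟨{x | x = c₁ ∨ x = c₂ ∨ x = c₃ ∨ x = c₄}, fun x => Iff.rfl⟩
  have m₁ : c₁ ∈ X := (hX _).2 (by tauto)
  have m₂ : c₂ ∈ X := (hX _).2 (by tauto)
  have m₄ : c₄ ∈ X := (hX _).2 (by tauto)
  have hX₁ := h.notMem hX
  have hX₂ := h.rot.notMem (X := X) (fun x => by rw [hX]; tauto)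
  have hX₄ := h.rot.rot.rot.notMem (X := X) (fun x => by rw [hX]; tauto)
  obtain ⟨o, -, -, -, hN⟩ := hG.third h.s₁.symm h.s₃.symm h.ne₁₃
  by_cases hadj : G.Adj d₂ d₄
  · obtain ⟨f, hf, hf0⟩ := hG.color_avoid X m₁ h.e₁
    exact h.false_of_eq_zero_free hG hN h₂₄ hX hf (hf.card_K_inter hadj)
      (hf0 _ hX₁ _ m₁ h.s₁.symm) (hf0 _ hX₂ _ m₂ h.s₂.symm) (hf0 _ hX₄ _ m₄ h.s₄.symm)
  obtain ⟨f, k, hf, hf0, hdis, hk⟩ := hG.color_avoid_edge X hX₂ hX₄ h₂₄ hadj m₂ m₄ h.s₂.symm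
    h.s₄.symm
  have hz := hf0 d hX₁ h.d₁₂ h.d₄₁.symm c₁ m₁ h.s₁.symm
  by_cases hz₂ : HasZero (avoid G X).edgeSet f d₂
  · obtain ⟨hk0, hk⟩ := hk (Or.inl hz₂)
    exact h.false_of_eq_zero hG hN h₂₄ hadj hX hf hz hz₂ hk0 fun z hz => hk z (by tauto)
  by_cases hz₄ : HasZero (avoid G X).edgeSet f d₄
  · obtain ⟨hk0, hk⟩ := hk (Or.inr hz₄)
    exact h.flip.false_of_eq_zero hG hN h₂₄.symm (fun h => hadj h.symm)
      (fun x => by rw [hX]; tauto) hf hz hz₄ hk0 fun z hz => hk z (by tauto)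
  · exact h.false_of_eq_zero_free hG hN h₂₄ hX hf
      (by rw [Finset.disjoint_iff_inter_eq_empty.1 hdis]; simp) hz hz₂ hz₄

lemma MinCounter.no_quad (hG : MinCounter V G) {a b c d : V} (hab : G.Adj a b) (hbc : G.Adj b c)
    (hcd : G.Adj c d) (hda : G.Adj d a) (hac : a ≠ c) (hbd : b ≠ d) : False := by
  obtain ⟨d₁, d₂, d₃, d₄, h⟩ := hG.exists_quad hab hbc hcd hda hac hbd
  by_cases h₁₃ : d₁ = d₃
  · subst h₁₃
    by_cases h₂₄ : d₂ = d₄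
    · subst h₂₄
      exact h.false_of_eq_eq hG
    · exact h.false_of_eq hG h₂₄
  · by_cases h₂₄ : d₂ = d₄
    · subst h₂₄
      exact h.rot.false_of_eq hG (Ne.symm h₁₃)
    · exact h.false_of_ne hG h₁₃ h₂₄

end Quads3

section SpikedCycles
open Classical

variable {V : Type} [Finite V] {G : SimpleGraph V}

/-- A cycle of a cubic graph together with the third neighbours of its vertices, which are distinct
and lie outside the cycle. -/
structure Spiked (G : SimpleGraph V) {n : ℕ} [NeZero n] (c d : Fin n → V) : Prop where
  adj : ∀ i, G.Adj (c i) (c (i + 1))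
  spoke : ∀ i, G.Adj (c i) (d i)
  nbr : ∀ i z, G.Adj (c i) z → z = c (i - 1) ∨ z = c (i + 1) ∨ z = d i
  inj : c.Injective
  inj' : d.Injective
  ne : ∀ i j, c i ≠ d j

variable {n : ℕ} [NeZero n] {c d : Fin n → V}

lemma MinCounter.exists_spiked (hG : MinCounter V G) (hc : c.Injective)
    (hadj : ∀ i, G.Adj (c i) (c (i + 1))) (hn : ∀ i : Fin n, i - 1 ≠ i + 1)
    (hchord : ∀ i j, G.Adj (c i) (c j) → j = i - 1 ∨ j = i + 1)
    (hout : ∀ i j z, i ≠ j → G.Adj (c i) z → G.Adj (c j) z → ∃ k, z = c k) :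
    ∃ d, Spiked G c d := by
  have hprev : ∀ i, G.Adj (c i) (c (i - 1)) := fun i => by
    have := (hadj (i - 1)).symm
    rwa [sub_add_cancel] at this
  choose d h1 h2 h3 h4 using fun i => hG.third (hprev i) (hadj i) fun h => hn i (hc h)
  have hne : ∀ i j, c i ≠ d j := by
    intro i j h
    rcases hchord j i (h ▸ h3 j) with rfl | rfl
    exacts [h1 j h.symm, h2 j h.symm]
  refine ⟨d, hadj, h3, h4, hc, fun i j hij => ?_, hne⟩
  by_contra hn
  obtain ⟨k, hk⟩ := hout i j (d i) hn (h3 i) (hij ▸ h3 j)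
  exact hne k i hk.symm

lemma Spiked.notMem (h : Spiked G c d) (i : Fin n) : d i ∉ Set.range c := by
  rintro ⟨j, hj⟩
  exact h.ne j i hj

lemma Spiked.nbr' (h : Spiked G c d) (i : Fin n) (z : V) (hz : G.Adj (c (i + 1)) z) :
    z = c i ∨ z = c (i + 1 + 1) ∨ z = d (i + 1) := by
  have := h.nbr _ _ hz
  rwa [add_sub_cancel_right] at this

lemma Spiked.adj_outer (h : Spiked G c d) {i j : Fin n} (hij : G.Adj (c i) (d j)) : i = j := by
  rcases h.nbr _ _ hij with h' | h' | h'
  · exact (h.ne _ _ h'.symm).elim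
  · exact (h.ne _ _ h'.symm).elim
  · exact (h.inj' h').symm

lemma Spiked.adj_cycle (h : Spiked G c d) {i j : Fin n} (hij : G.Adj (c i) (c j)) :
    j = i - 1 ∨ j = i + 1 := by
  rcases h.nbr _ _ hij with h' | h' | h'
  · exact Or.inl (h.inj h')
  · exact Or.inr (h.inj h')
  · exact (h.ne _ _ h').elim

lemma Spiked.cover (h : Spiked G c d) {P : Sym2 V → Prop}
    (h₀ : ∀ e ∈ (avoid G (Set.range c)).edgeSet, P e) (h₁ : ∀ i, P s(c i, c (i + 1)))
    (h₂ : ∀ i, P s(c i, d i)) : ∀ e ∈ G.edgeSet, P e := by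
  have key : ∀ i z, G.Adj (c i) z → P s(c i, z) := by
    intro i z hz
    rcases h.nbr i z hz with rfl | rfl | rfl
    · have := h₁ (i - 1)
      rwa [sub_add_cancel, Sym2.eq_swap] at this
    · exact h₁ i
    · exact h₂ i
  intro e he
  induction e with | _ a b
  by_cases ha : a ∈ Set.range c
  · obtain ⟨i, rfl⟩ := ha
    exact key i b he
  by_cases hb : b ∈ Set.range c
  · obtain ⟨i, rfl⟩ := hb
    rw [Sym2.eq_swap]
    exact key i a (show G.Adj a (c i) from he).symm
  · exact h₀ _ (mem_avoid.2 ⟨he, ha, hb⟩)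

/-- If all edges leaving the cycle can be coloured `0`, the edges of the cycle cannot be coloured
from the lists of colours missing at the ends of these edges. -/
lemma Spiked.false_of_cycle (hG : MinCounter V G) (h : Spiked G c d) {f : Sym2 V → Fin 8}
    (hf : PG G (avoid G (Set.range c)).edgeSet f)
    (hz : ∀ i, ¬ HasZero (avoid G (Set.range c)).edgeSet f (d i)) (k : Fin n → Fin 8)
    (hk : ∀ i, k i ∈ lst (K (avoid G (Set.range c)).edgeSet f (d i) ∪
      K (avoid G (Set.range c)).edgeSet f (d (i + 1))))
    (hne : ∀ i j, i ≠ j → k i ≠ k j ∨ ¬ Near G s(c i, c (i + 1)) s(c j, c (j + 1))) : False := by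
  refine hG.false_of_zeros hf ((List.finRange n).map fun i => (c i, d i))
    ((List.finRange n).map fun i => (s(c i, c (i + 1)), k i)) ?_ ?_ ?_ ?_
    (h.cover (fun e he => Or.inl he) (fun i => Or.inr ?_) fun i => Or.inr ?_)
  · intro p hp
    obtain ⟨i, -, rfl⟩ := List.mem_map.1 hp
    exact ⟨h.spoke i, not_hasZero_avoid ⟨i, rfl⟩, hz i⟩
  · rw [List.pairwise_map]
    exact (List.nodup_finRange n).imp fun {i j} hij =>
      ⟨h.inj.ne hij, h.ne _ _, (h.ne _ _).symm, h.inj'.ne hij⟩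
  · intro p hp
    obtain ⟨i, -, rfl⟩ := List.mem_map.1 hp
    exact ⟨h.adj i, hf.lst_subset_avail (fun z hz => or_left_comm.1 (h.nbr i z hz)) ⟨_, rfl⟩
      (h.nbr' i) ⟨_, rfl⟩ (hk i)⟩
  · rw [List.pairwise_map]
    exact (List.nodup_finRange n).imp fun {i j} hij => hne i j hij
  · rw [List.map_map, List.map_map]
    exact List.mem_append_right _ (List.mem_map.2 ⟨i, List.mem_finRange i, rfl⟩)
  · rw [List.map_map, List.map_map]
    exact List.mem_append_left _ (List.mem_map.2 ⟨i, List.mem_finRange i, rfl⟩)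

lemma Spiked.not_near_spoke (h : Spiked G c d) {i j : Fin n} (h₁ : i ≠ j) (h₂ : i ≠ j + 1)
    (h₃ : j ≠ i + 1) (h₄ : j + 1 ≠ i - 1) : ¬ Near G s(c i, d i) s(c j, c (j + 1)) := by
  rw [near_mk]
  rintro ((h' | h') | (h' | h') | (h' | h') | (h' | h'))
  · exact h₁ (h.inj h')
  · rcases h.adj_cycle h' with rfl | rfl
    · exact h₂ (sub_add_cancel _ _).symm
    · exact h₃ rfl
  · exact h₂ (h.inj h')
  · rcases h.adj_cycle h' with h' | h'
    · exact h₄ h'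
    · exact h₁ (add_right_cancel h').symm
  · exact h.ne _ _ h'.symm
  · exact h₁ (h.adj_outer h'.symm).symm
  · exact h.ne _ _ h'.symm
  · exact h₂ (h.adj_outer h'.symm).symm

lemma Spiked.outer (hG : MinCounter V G) (h : Spiked G c d) (i : Fin n) :
    ∃ o o', o ≠ o' ∧ G.Adj (d i) o ∧ G.Adj (d i) o' ∧ o ∉ Set.range c ∧ o' ∉ Set.range c ∧
      ∀ z, G.Adj (d i) z → z = c i ∨ z = o ∨ z = o' := by
  obtain ⟨o, o', ho, ho', hne, hdo, hdo', hN⟩ := hG.other_two (h.spoke i).symm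
  refine ⟨o, o', hne, hdo, hdo', ?_, ?_, hN⟩
  · rintro ⟨j, rfl⟩
    exact ho (by rw [h.adj_outer hdo.symm])
  · rintro ⟨j, rfl⟩
    exact ho' (by rw [h.adj_outer hdo'.symm])

/-- Further disjoint edges can be coloured `0` so that every old edge meets an edge coloured `0`,
without creating new restrictions for the other colours. -/
lemma MinCounter.add_zeros (hG : MinCounter V G) {D S : Set (Sym2 V)} {f : Sym2 V → Fin 8}
    (h : PG G D f) (hS : S ⊆ G.edgeSet) (hz : ∀ e ∈ S, ∀ x ∈ e, ¬ HasZero D f x)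
    (hP : ∀ e ∈ S, ∀ e' ∈ S, e ≠ e' → ∀ x ∈ e, x ∉ e') :
    ∃ f', PG G (D ∪ S) f' ∧ (∀ z, K (D ∪ S) f' z ⊆ K D f z) ∧ (∀ e ∈ S, f' e = 0) ∧
      ∀ x y, s(x, y) ∈ D → HasZero (D ∪ S) f' x ∨ HasZero (D ∪ S) f' y := by
  set g : Sym2 V → Fin 8 := fun e => if e ∈ S then 0 else f e with hg
  have hD : ∀ e ∈ D ∪ S, e ∉ S → e ∈ D := fun e he he' => he.resolve_right he'
  have hPG : PG G (D ∪ S) g := by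
    refine ⟨Set.union_subset h.sub hS, fun _ _ _ x _ => hG.cubic x, fun e he e' he' hne => ?_⟩
    by_cases heS : e ∈ S <;> by_cases heS' : e' ∈ S <;> simp only [hg, heS, heS', if_true, if_false]
    · exact ⟨fun _ _ => hP e heS e' heS' hne, fun _ h => (h rfl).elim⟩
    · exact ⟨fun _ h0 x hx hx' => hz e heS x hx ⟨e', hD e' he' heS', hx', h0⟩,
        fun _ h => (h rfl).elim⟩
    · exact ⟨fun h0 _ x hx hx' => hz e' heS' x hx' ⟨e, hD e he heS, hx, h0⟩,
        fun h h' => (h' h).elim⟩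
    · exact h.compat e (hD e he heS) e' (hD e' he' heS') hne
  obtain ⟨f', hf', h0, hmax⟩ := hPG.exists_zero_max
  refine ⟨f', hf', fun z => (K_mono_of_zero h0 z).trans ?_, fun e he => ?_,
    fun x y hxy => hmax x y (Or.inl hxy) (hG.cubic x) (hG.cubic y)⟩
  · intro k hk
    obtain ⟨hk0, e, he, hze, hek⟩ := mem_K.1 hk
    by_cases heS : e ∈ S
    · exact (hk0 (by rw [← hek]; simp [hg, heS])).elim
    · exact mem_K.2 ⟨hk0, e, hD e he heS, hze, by rw [← hek]; simp [hg, heS]⟩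
  · rcases h0 e with h | h
    · rw [h]; simp [hg, he]
    · exact h

end SpikedCycles

section CyclicLists

variable {α : Type*} [DecidableEq α]

lemma square_choice {A A' B B' : Finset α} (hA : 2 ≤ A.card) (hA' : 2 ≤ A'.card) (hB : 2 ≤ B.card)
    (hB' : 2 ≤ B'.card) : ∃ a ∈ A, ∃ a' ∈ A', ∃ b ∈ B, ∃ b' ∈ B',
      a ≠ b ∧ a ≠ b' ∧ a' ≠ b ∧ a' ≠ b' := by
  by_cases hx : ∃ x ∈ A, x ∈ A'
  · obtain ⟨x, hx, hx'⟩ := hx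
    obtain ⟨b, hb, hbx⟩ := pick_two hB x
    obtain ⟨b', hb', hbx'⟩ := pick_two hB' x
    exact ⟨x, hx, x, hx', b, hb, b', hb', hbx.symm, hbx'.symm, hbx.symm, hbx'.symm⟩
  push Not at hx
  have key : ∀ {A A' : Finset α}, 2 ≤ A.card → 2 ≤ A'.card → ∀ b, b ∉ A →
      ∃ b' ∈ B', (∃ a ∈ A, a ≠ b ∧ a ≠ b') ∧ ∃ a' ∈ A', a' ≠ b ∧ a' ≠ b' := by
    intro A A' hA hA' b hb
    obtain ⟨a', ha', hab'⟩ := pick_two hA' b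
    obtain ⟨b', hb', hne⟩ := pick_two hB' a'
    obtain ⟨a, ha, hab⟩ := pick_two hA b'
    exact ⟨b', hb', ⟨a, ha, fun h => hb (h ▸ ha), hab⟩, a', ha', hab', hne.symm⟩
  obtain ⟨b, hb, -⟩ := pick_one (L := B) (by omega)
  by_cases hbA : b ∈ A
  · obtain ⟨b', hb', ⟨a', ha', h1, h2⟩, a, ha, h3, h4⟩ := key hA' hA b (hx b hbA)
    exact ⟨a, ha, a', ha', b, hb, b', hb', h3, h4, h1, h2⟩
  · obtain ⟨b', hb', ⟨a, ha, h1, h2⟩, a', ha', h3, h4⟩ := key hA hA' b hbA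
    exact ⟨a, ha, a', ha', b, hb, b', hb', h1, h2, h3, h4⟩

lemma hexagon_choice {L : Fin 6 → Finset α} (hL : ∀ i, 3 ≤ (L i).card) :
    ∃ k : Fin 6 → α, (∀ i, k i ∈ L i) ∧ ∀ i j, i ≠ j → k i ≠ k j ∨ j = i + 3 := by
  by_cases hx : ∃ i, ∃ x ∈ L i, x ∈ L (i + 3)
  · obtain ⟨i, x, hx, hx'⟩ := hx
    have he : ∀ j, 2 ≤ ((L j).erase x).card := fun j => by
      have := Finset.pred_card_le_card_erase (s := L j) (a := x)
      have := hL j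
      omega
    obtain ⟨a, ha, a', ha', b, hb, b', hb', h1, h2, h3, h4⟩ :=
      square_choice (he (i + 1)) (he (i + 4)) (he (i + 2)) (he (i + 5))
    rw [Finset.mem_erase] at ha ha' hb hb'
    have hcases : ∀ i j : Fin 6, j = i ∨ j = i + 1 ∨ j = i + 2 ∨ j = i + 3 ∨ j = i + 4 ∨
        j = i + 5 := by decide
    refine ⟨fun j => if j = i then x else if j = i + 1 then a else if j = i + 2 then b else
      if j = i + 3 then x else if j = i + 4 then a' else b', fun j => ?_, fun j l hjl => ?_⟩
    · rcases hcases i j with rfl | rfl | rfl | rfl | rfl | rfl <;>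
        simp [hx, hx', ha.2, ha'.2, hb.2, hb'.2]
    · rcases hcases i j with hj | hj | hj | hj | hj | hj <;>
        rcases hcases i l with hl | hl | hl | hl | hl | hl <;> rw [hj, hl] at hjl ⊢ <;>
        simp [add_assoc] at hjl ⊢ <;> grind
  · push Not at hx
    have hopp : ∀ s : Finset (Fin 6), 4 ≤ s.card → ∃ i, i ∈ s ∧ i + 3 ∈ s := by decide
    obtain ⟨k, hk, hkL⟩ := (Finset.all_card_le_biUnion_card_iff_exists_injective L).1 (by
      intro s
      by_cases hs : 4 ≤ s.card
      · obtain ⟨i, hi, hi'⟩ := hopp s hs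
        have h1 : L i ∪ L (i + 3) ⊆ s.biUnion L :=
          Finset.union_subset (Finset.subset_biUnion_of_mem L hi)
            (Finset.subset_biUnion_of_mem L hi')
        have h2 := Finset.card_le_card h1
        rw [Finset.card_union_of_disjoint (Finset.disjoint_left.2 (hx i))] at h2
        have := hL i
        have := hL (i + 3)
        have h6 : s.card ≤ 6 := Finset.card_le_univ s
        omega
      · rcases s.eq_empty_or_nonempty with rfl | ⟨i, hi⟩
        · simp
        · have := Finset.card_le_card (Finset.subset_biUnion_of_mem L hi)
          have := hL i
          omega)
    exact ⟨k, hkL, fun i j hij => Or.inl (hk.ne hij)⟩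

end CyclicLists

section PentagonLists

/-- Two colours `b` and `c` of a list that avoid `β` and `α` and exhaust the common colours of the
list and `{α, β}`. -/
lemma absorb_pair {α : Type*} [DecidableEq α] {U : Finset α} (hU : 3 ≤ U.card) {x y : α}
    (hxy : x ≠ y) : ∃ b ∈ U, ∃ c ∈ U, b ≠ c ∧ b ≠ y ∧ c ≠ x ∧ (x ∈ U → b = x) ∧
      (y ∈ U → c = y) := by
  obtain ⟨b, hb, hby, hbx⟩ : ∃ b ∈ U, b ≠ y ∧ (x ∈ U → b = x) := by
    by_cases hx : x ∈ U
    · exact ⟨x, hx, hxy, fun _ => rfl⟩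
    · obtain ⟨b, hb, hby⟩ := pick_two (L := U) (by omega) y
      exact ⟨b, hb, hby, fun h => (hx h).elim⟩
  by_cases hy : y ∈ U
  · exact ⟨b, hb, y, hy, hby, hby, hxy.symm, hbx, fun _ => rfl⟩
  · obtain ⟨c, hc, hcb, hcx⟩ := pick_three (L := U) (by omega) b x
    exact ⟨b, hb, c, hc, hcb.symm, hby, hcx, hbx, fun h => (hy h).elim⟩

/-- All lists of the cyclic lists contain four common colours, except that one colour may be missing
from two consecutive lists. -/
lemma pentagon_choice_of_common {K : Fin 5 → Finset (Fin 8)} (hK : ∀ i, (K i).card ≤ 2)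
    {W : Finset (Fin 8)} (hW : 3 ≤ W.card) (hWK : ∀ w ∈ W, ∀ i, w ∈ K i ∨ w ∈ K (i + 1)) :
    ∃ m, ∀ x y, x ≠ y → ∃ a ∈ lst (K (m + 1) ∪ K (m + 1 + 1)),
      ∃ b ∈ lst (K (m + 2) ∪ K (m + 2 + 1)), ∃ c ∈ lst (K (m + 3) ∪ K (m + 3 + 1)),
      ∃ d ∈ lst (K (m + 4) ∪ K (m + 4 + 1)), [a, b, c, d].Nodup ∧ x ∉ [a, c, d] ∧
        y ∉ [a, b, d] := by
  have hcover : ∀ s : Finset (Fin 5), (∀ i, i ∈ s ∨ i + 1 ∈ s) → 3 ≤ s.card := by decide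
  have h1 : 3 * W.card ≤ ∑ i, (W ∩ K i).card := by
    have hd : ∑ i, (W ∩ K i).card = ∑ w ∈ W, (Finset.univ.filter fun i => w ∈ K i).card := by
      have := Finset.sum_card_bipartiteAbove_eq_sum_card_bipartiteBelow (s := W)
        (t := (Finset.univ : Finset (Fin 5))) (fun w i => w ∈ K i)
      simp only [Finset.bipartiteAbove, Finset.bipartiteBelow] at this
      rw [this]
      exact Finset.sum_congr rfl fun i _ => by rw [Finset.filter_mem_eq_inter]
    rw [hd, mul_comm, ← smul_eq_mul]
    exact Finset.card_nsmul_le_sum _ _ _ fun w hw => hcover _ (by simpa using hWK w hw)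
  have h2 : ∑ i, (W ∩ K i).card + ∑ i, (K i \ W).card ≤ 10 := by
    rw [← Finset.sum_add_distrib]
    calc _ ≤ ∑ _i : Fin 5, 2 := Finset.sum_le_sum fun i _ => by
          rw [Finset.inter_comm, Finset.card_inter_add_card_sdiff]; exact hK i
      _ = 10 := by simp
  have hU : 4 ≤ (lst W).card := by
    have := card_lst W
    omega
  obtain ⟨m, y₀, hm⟩ : ∃ m y₀, ∀ i, ∀ x ∈ K i, x ∉ W → i = m ∧ x = y₀ := by
    have hc : (Finset.univ.sigma fun i => K i \ W).card ≤ 1 := by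
      rw [Finset.card_sigma]
      omega
    rcases Finset.card_le_one_iff_subset_singleton.1 hc with ⟨⟨m, y₀⟩, hs⟩
    refine ⟨m, y₀, fun i x hx hxW => ?_⟩
    have : (⟨i, x⟩ : (_ : Fin 5) × Fin 8) ∈ Finset.univ.sigma fun i => K i \ W := by
      simp [hx, hxW]
    have := hs this
    simpa using this
  refine ⟨m, fun x y hxy => ?_⟩
  obtain ⟨b, hb, c, hc, hbc, hby, hcx, hbx, hcy⟩ := absorb_pair (U := lst W) (by omega) hxy
  obtain ⟨d, hd, hdb, hdc, hdy⟩ := pick_four hU b c y₀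
  obtain ⟨a, ha, hab, hac, had⟩ := pick_four hU b c d
  have hlst : ∀ i u, u ∈ lst W → (u = y₀ → i ≠ m ∧ i + 1 ≠ m) → u ∈ lst (K i ∪ K (i + 1)) := by
    intro i u hu h
    rw [mem_lst] at hu ⊢
    refine ⟨hu.1, fun hu' => ?_⟩
    rcases Finset.mem_union.1 hu' with hu' | hu'
    · obtain ⟨h1, h2⟩ := hm i u hu' hu.2
      exact (h h2).1 h1
    · obtain ⟨h1, h2⟩ := hm (i + 1) u hu' hu.2
      exact (h h2).2 h1
  have hne : ∀ m : Fin 5, (m + 1 ≠ m ∧ m + 1 + 1 ≠ m) ∧ (m + 2 ≠ m ∧ m + 2 + 1 ≠ m) ∧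
      m + 3 ≠ m ∧ m + 3 + 1 ≠ m := by decide
  refine ⟨a, hlst _ _ ha fun _ => (hne m).1, b, hlst _ _ hb fun _ => (hne m).2.1, c,
    hlst _ _ hc fun _ => (hne m).2.2, d, hlst _ _ hd fun h => (hdy h).elim, ?_, ?_, ?_⟩
  · simp; tauto
  · simp only [List.mem_cons, List.not_mem_nil, or_false]
    rintro (rfl | rfl | rfl)
    exacts [hab (hbx ha).symm, hcx rfl, hdb (hbx hd).symm]
  · simp only [List.mem_cons, List.not_mem_nil, or_false]
    rintro (rfl | rfl | rfl)
    exacts [hac (hcy ha).symm, hby rfl, hdc (hcy hd).symm]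

/-- Four of the cyclic lists coincide and have three elements. -/
lemma pentagon_choice_of_four {K : Fin 5 → Finset (Fin 8)} (hK : ∀ i, (K i).card ≤ 2)
    (h0 : ∀ i, 0 ∉ K i) {j : Fin 5} {U : Finset (Fin 8)} (hU : U.card = 3)
    (hUK : ∀ i, i ≠ j → lst (K i ∪ K (i + 1)) = U) :
    ∃ m, ∀ x y, x ≠ y → y ∉ K (m + 1) → ∃ a ∈ lst (K (m + 1) ∪ K (m + 1 + 1)),
      ∃ b ∈ lst (K (m + 2) ∪ K (m + 2 + 1)), ∃ c ∈ lst (K (m + 3) ∪ K (m + 3 + 1)),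
      ∃ d ∈ lst (K (m + 4) ∪ K (m + 4 + 1)), [a, b, c, d].Nodup ∧ x ∉ [a, c, d] ∧
        y ∉ [a, b, d] := by
  have hW : 4 ≤ (lst U).card := by
    have := card_lst U
    omega
  have hsub : ∀ i, i ≠ j → lst U ⊆ K i ∪ K (i + 1) := by
    intro i hi w hw
    rw [mem_lst, ← hUK i hi, mem_lst] at hw
    tauto
  have hcard : ∀ i, i ≠ j → (K i).card = 2 ∧ Disjoint (K i) (K (i + 1)) := by
    intro i hi
    have h1 := Finset.card_le_card (hsub i hi)
    have h2 := Finset.card_union_add_card_inter (K i) (K (i + 1))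
    have := hK i
    have := hK (i + 1)
    exact ⟨by omega, Finset.disjoint_iff_inter_eq_empty.2 (Finset.card_eq_zero.1 (by omega))⟩
  have hKU : ∀ i, i ≠ j → ∀ k ∈ K i, k ∈ lst U := by
    intro i hi k hk
    rw [mem_lst, ← hUK i hi, mem_lst]
    exact ⟨fun h => h0 i (h ▸ hk), fun h => h.2 (Finset.mem_union_left _ hk)⟩
  have e : ∀ j : Fin 5, (j + 1 ≠ j ∧ j + 1 + 1 ≠ j ∧ j + 1 + 2 ≠ j ∧ j + 1 + 3 ≠ j) ∧
      j + 1 + 4 = j ∧ j + 1 + 1 + 1 = j + 1 + 2 ∧ j + 1 + 2 + 1 = j + 1 + 3 ∧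
      j + 1 + 3 + 1 = j := by decide
  obtain ⟨⟨e1, e2, e3, e4⟩, e5, e6, e7, e8⟩ := e j
  refine ⟨j + 1, fun x y hxy hy => ?_⟩
  obtain ⟨b, hb, c, hc, hbc, hby, hcx, hbx, hcy⟩ := absorb_pair (U := U) (by omega) hxy
  obtain ⟨a, ha, hab, hac⟩ := pick_three (L := U) (by omega) b c
  obtain ⟨d, hd, hdx⟩ := pick_two (L := K (j + 1 + 1)) (hcard _ e2).1.ge x
  have hdU := hKU _ e2 d hd
  have hd₁ : d ∉ K (j + 1) := fun h => Finset.disjoint_left.1 (hcard _ e1).2 h hd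
  have hd₃ : d ∉ K (j + 1 + 2) := fun h =>
    Finset.disjoint_left.1 (hcard _ e2).2 hd (by rwa [e6])
  have hd₄ : d ∈ K (j + 1 + 3) := by
    have := hsub _ e3 hdU
    rw [e7, Finset.mem_union] at this
    exact this.resolve_left hd₃
  have hd₀ : d ∉ K j := fun h => Finset.disjoint_left.1 (hcard _ e4).2 hd₄ (by rwa [e8])
  have hdU' : ∀ u ∈ U, d ≠ u := by
    rintro u hu rfl
    exact (mem_lst.1 hdU).2 hu
  refine ⟨a, by rwa [hUK _ e2], b, by rwa [hUK _ e3], c, by rwa [hUK _ e4], d, ?_, ?_, ?_, ?_⟩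
  · rw [e5, mem_lst, Finset.mem_union]
    exact ⟨fun h => h0 _ (h ▸ hd), not_or.2 ⟨hd₀, hd₁⟩⟩
  · simp [hab, hac, hbc, (hdU' a ha).symm, (hdU' b hb).symm, (hdU' c hc).symm]
  · simp only [List.mem_cons, List.not_mem_nil, or_false]
    rintro (rfl | rfl | rfl)
    exacts [hab (hbx ha).symm, hcx rfl, hdx rfl]
  · simp only [List.mem_cons, List.not_mem_nil, or_false]
    rintro (rfl | rfl | rfl)
    exacts [hac (hcy ha).symm, hby rfl, hy hd]

lemma pentagon_choice {K : Fin 5 → Finset (Fin 8)} (hK : ∀ i, (K i).card ≤ 2)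
    (h0 : ∀ i, 0 ∉ K i) :
    (∃ k : Fin 5 → Fin 8, k.Injective ∧ ∀ i, k i ∈ lst (K i ∪ K (i + 1))) ∨
    ∃ m, ∀ x y, x ≠ y → y ∉ K (m + 1) → ∃ a ∈ lst (K (m + 1) ∪ K (m + 1 + 1)),
      ∃ b ∈ lst (K (m + 2) ∪ K (m + 2 + 1)), ∃ c ∈ lst (K (m + 3) ∪ K (m + 3 + 1)),
      ∃ d ∈ lst (K (m + 4) ∪ K (m + 4 + 1)), [a, b, c, d].Nodup ∧ x ∉ [a, c, d] ∧
        y ∉ [a, b, d] := by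
  set L : Fin 5 → Finset (Fin 8) := fun i => lst (K i ∪ K (i + 1)) with hL
  have hLc : ∀ i, 3 ≤ (L i).card := fun i => card_lst_union (hK i) (hK (i + 1))
  by_cases hH : ∀ s : Finset (Fin 5), s.card ≤ (s.biUnion L).card
  · exact Or.inl ((Finset.all_card_le_biUnion_card_iff_exists_injective L).1 hH)
  refine Or.inr ?_
  push Not at hH
  obtain ⟨s, hs⟩ := hH
  have hsub : ∀ i ∈ s, L i ⊆ s.biUnion L := fun i hi => Finset.subset_biUnion_of_mem L hi
  have h4 : 4 ≤ s.card := by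
    rcases s.eq_empty_or_nonempty with rfl | ⟨i, hi⟩
    · simp at hs
    · have := Finset.card_le_card (hsub i hi)
      have := hLc i
      omega
  have h5 : ∀ s : Finset (Fin 5), 4 ≤ s.card → s = Finset.univ ∨ s.card = 4 ∧ ∃ j, ∀ i, i ≠ j → i ∈ s := by
    decide
  rcases h5 s h4 with rfl | ⟨h4, j, hj⟩
  · rw [Finset.card_univ, Fintype.card_fin] at hs
    obtain ⟨m, hm⟩ := pentagon_choice_of_common hK (W := lst (Finset.univ.biUnion L)) (by
      have := card_lst (Finset.univ.biUnion L)
      omega) (by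
      intro w hw i
      rw [mem_lst] at hw
      by_contra hn
      exact hw.2 (hsub i (Finset.mem_univ i) (mem_lst.2 ⟨hw.1, by simpa using hn⟩)))
    exact ⟨m, fun x y hxy _ => hm x y hxy⟩
  · have heq : ∀ i, i ≠ j → L i = s.biUnion L := fun i hi =>
      Finset.eq_of_subset_of_card_le (hsub i (hj i hi)) (by have := hLc i; omega)
    refine pentagon_choice_of_four hK h0 ?_ heq
    rw [← heq (j + 1) (by simp)]
    have := hLc (j + 1)
    rw [heq (j + 1) (by simp)] at this ⊢
    omega

end PentagonLists

section Pentagons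
open Classical

variable {V : Type} [Finite V] {G : SimpleGraph V}

/-- An uncoloured edge `xy` such that no colours appear at the other neighbours of `x` and some
edge next to it is coloured `0` has two available colours. -/
lemma MinCounter.two_le_card_avail (hG : MinCounter V G) {D : Set (Sym2 V)} {g : Sym2 V → Fin 8}
    (h : PG G D g) {x y o o' : V} (hx : ∀ z, G.Adj x z → z ≠ y → K D g z = ∅)
    (hy : ∀ z, G.Adj y z → z = x ∨ z = o ∨ z = o') (hD : s(y, x) ∉ D)
    (hmax : HasZero D g y ∨ HasZero D g o) : 2 ≤ (avail G D g s(x, y)).card := by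
  have hF := h.card_avail (x := x) (y := y) (K D g o ∪ K D g o')
    (fun z hz hzy => by simp [hx z hz hzy]) (fun z hz hzx => by
      rcases hy z hz with rfl | rfl | rfl
      exacts [(hzx rfl).elim, Finset.subset_union_left, Finset.subset_union_right])
  have hz : HasZero D g o ∨ HasZero D g o' := by
    rcases hmax with ⟨e, he, hye, h0⟩ | hmax
    · obtain ⟨z, rfl⟩ := Sym2.mem_iff_exists.1 hye
      rcases hy z (h.sub he) with rfl | rfl | rfl
      exacts [(hD he).elim, Or.inl ⟨_, he, by simp, h0⟩, Or.inr ⟨_, he, by simp, h0⟩]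
    · exact Or.inl hmax
  have hle : ∀ z, HasZero D g z → (K D g z).card ≤ 2 := by
    intro z hz
    have := K_card_zero h hz ∅ (by simp)
    rw [hG.cubic z, Finset.card_empty] at this
    omega
  have h1 := K_card_le_three hG.1 h.sub (c := g) o
  have h2 := K_card_le_three hG.1 h.sub (c := g) o'
  have h3 := Finset.card_union_le (K D g o) (K D g o')
  rcases hz with hz | hz
  · have := hle _ hz
    omega
  · have := hle _ hz
    omega

/-- Under two coloured edges at `y`, the colours at `y` cannot exhaust the available colours. -/
lemma PG.exists_avail_notMem {D : Set (Sym2 V)} {g : Sym2 V → Fin 8} (h : PG G D g)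
    {x y o o' : V} (hD : s(x, y) ∉ D) (ho : s(y, o) ∈ D) (ho' : s(y, o') ∈ D) (hoo : o ≠ o')
    {L : Finset (Fin 8)} (hL : L.card ≤ 2) (hKL : K D g y ⊆ L)
    (hA : 2 ≤ (avail G D g s(x, y)).card) : ∃ k ∈ avail G D g s(x, y), k ∉ L := by
  have hne : s(y, o) ≠ s(y, o') := fun h => hoo (Sym2.congr_right.1 h)
  obtain ⟨t, ht⟩ : ∃ t, t ∈ K D g y := by
    by_cases h0 : g s(y, o) = 0
    · refine ⟨g s(y, o'), mem_K.2 ⟨fun h0' => ?_, _, ho', by simp, rfl⟩⟩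
      exact (h.compat _ ho _ ho' hne).1 h0 h0' y (by simp) (by simp)
    · exact ⟨_, mem_K.2 ⟨h0, _, ho, by simp, rfl⟩⟩
  have htA : t ∉ avail G D g s(x, y) := by
    intro htA
    obtain ⟨h0, e, he, hye, rfl⟩ := mem_K.1 ht
    exact ((mem_avail.1 htA).2 e he fun h => hD (h ▸ he)).2 rfl h0
      ⟨y, by simp, y, hye, Or.inl rfl⟩
  by_contra! hn
  have : insert t (avail G D g s(x, y)) ⊆ L := Finset.insert_subset (hKL ht) hn
  have := Finset.card_le_card this
  rw [Finset.card_insert_of_notMem htA] at this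
  omega

lemma Spiked.false_of_pentagon (hG : MinCounter V G) {c d : Fin 5 → V} (h : Spiked G c d) :
    False := by
  obtain ⟨f, hf, hz⟩ := hG.color_avoid (X := Set.range c) ⟨0, rfl⟩ (h.adj 0)
  replace hz : ∀ i, ¬ HasZero (avoid G (Set.range c)).edgeSet f (d i) := fun i =>
    hz _ (h.notMem i) (c i) ⟨i, rfl⟩ (h.spoke i).symm
  rcases pentagon_choice (K := fun i => K (avoid G (Set.range c)).edgeSet f (d i))
    (fun i => hG.card_K_avoid f ⟨i, rfl⟩ (h.spoke i).symm) (fun i => zero_notMem_K) with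
    ⟨k, hk, hkL⟩ | ⟨m, hm⟩
  · exact h.false_of_cycle hG hf hz k hkL fun i j hij => Or.inl (hk.ne hij)
  set D := (avoid G (Set.range c)).edgeSet with hDdef
  set S : Set (Sym2 V) := {e | ∃ i, i ≠ m ∧ i ≠ m + 1 ∧ e = s(c i, d i)} with hS
  have hzS : ∀ e ∈ S, ∀ x ∈ e, ¬ HasZero D f x := by
    rintro _ ⟨i, -, -, rfl⟩ x hx
    rcases Sym2.mem_iff.1 hx with rfl | rfl
    exacts [not_hasZero_avoid ⟨i, rfl⟩, hz i]
  obtain ⟨g, hg, hK, hg0, hmax⟩ := hG.add_zeros hf (S := S) (by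
    rintro _ ⟨i, -, -, rfl⟩
    exact h.spoke i) hzS (by
    rintro _ ⟨i, -, -, rfl⟩ _ ⟨j, -, -, rfl⟩ hne x hx hx'
    have hij : i ≠ j := fun hij => hne (by rw [hij])
    rcases Sym2.mem_iff.1 hx with rfl | rfl <;> rcases Sym2.mem_iff.1 hx' with h' | h'
    exacts [hij (h.inj h'), h.ne _ _ h', h.ne _ _ h'.symm, hij (h.inj' h')])
  have hcD : ∀ i z, s(c i, z) ∈ D ∪ S → z = d i ∧ i ≠ m ∧ i ≠ m + 1 := by
    rintro i z (he | ⟨j, h1, h2, he⟩)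
    · exact ((mem_avoid.1 he).2.1 ⟨i, rfl⟩).elim
    · rw [Sym2.eq_iff] at he
      rcases he with ⟨he, rfl⟩ | ⟨he, -⟩
      · rw [h.inj he]
        exact ⟨rfl, h1, h2⟩
      · exact (h.ne _ _ he).elim
  have hzc : ∀ i, i = m ∨ i = m + 1 → ¬ HasZero (D ∪ S) g (c i) := by
    rintro i hi ⟨e, he, hie, -⟩
    obtain ⟨z, rfl⟩ := Sym2.mem_iff_exists.1 hie
    obtain ⟨-, h1, h2⟩ := hcD i z he
    exact hi.elim h1 h2
  have hKc : ∀ i, K (D ∪ S) g (c i) = ∅ := fun i =>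
    Finset.subset_empty.1 ((hK (c i)).trans (K_avoid_empty (Set.mem_range_self i)).subset)
  have hspoke : ∀ i, i = m ∨ i = m + 1 → s(c i, d i) ∉ D ∪ S := fun i hi he =>
    hi.elim (hcD i _ he).2.1 (hcD i _ he).2.2
  have hA : ∀ i, i = m ∨ i = m + 1 → 2 ≤ (avail G (D ∪ S) g s(c i, d i)).card ∧
      ∃ k ∈ avail G (D ∪ S) g s(c i, d i), k ∉ K D f (d i) := by
    intro i hi
    obtain ⟨o, o', hne, ho, ho', hoc, hoc', hN⟩ := h.outer hG i
    have hoD : s(d i, o) ∈ D := mem_avoid.2 ⟨ho, h.notMem i, hoc⟩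
    have hoD' : s(d i, o') ∈ D := mem_avoid.2 ⟨ho', h.notMem i, hoc'⟩
    have h2 := hG.two_le_card_avail hg (x := c i) (y := d i) (o := o) (o' := o') (by
      intro z hz hzd
      rcases h.nbr i z hz with rfl | rfl | rfl
      exacts [hKc _, hKc _, (hzd rfl).elim]) hN (by
      rw [Sym2.eq_swap]
      exact hspoke i hi) (hmax _ _ hoD)
    exact ⟨h2, hg.exists_avail_notMem (hspoke i hi) (Or.inl hoD) (Or.inl hoD') hne
      (hG.card_K_avoid f ⟨i, rfl⟩ (h.spoke i).symm) (hK _) h2⟩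
  obtain ⟨y, hyA, hyK⟩ := (hA (m + 1) (Or.inr rfl)).2
  obtain ⟨x, hxA, hxy⟩ := pick_two (hA m (Or.inl rfl)).1 y
  obtain ⟨k₁, h₁, k₂, h₂, k₃, h₃, k₄, h₄, hnd, hxk, hyk⟩ := hm x y hxy hyK
  have hcyc : ∀ i k, k ∈ lst (K D f (d i) ∪ K D f (d (i + 1))) →
      k ∈ avail G (D ∪ S) g s(c i, c (i + 1)) := by
    intro i k hk
    rw [mem_lst] at hk
    refine hg.avail_superset _ ?_ ?_ hk.1 hk.2
    · intro z hz hzc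
      rcases h.nbr i z hz with rfl | rfl | rfl
      · simp [hKc]
      · exact (hzc rfl).elim
      · exact (hK _).trans Finset.subset_union_left
    · intro z hz hzc
      rcases h.nbr' i z hz with rfl | rfl | rfl
      · exact (hzc rfl).elim
      · simp [hKc]
      · exact (hK _).trans Finset.subset_union_right
  refine hG.false_of_zeros hg [(c m, c (m + 1))] [(s(c m, d m), x), (s(c (m + 1), d (m + 1)), y),
    (s(c (m + 1), c (m + 1 + 1)), k₁), (s(c (m + 2), c (m + 2 + 1)), k₂),
    (s(c (m + 3), c (m + 3 + 1)), k₃), (s(c (m + 4), c (m + 4 + 1)), k₄)] ?_ ?_ ?_ ?_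
    (h.cover (fun e he => Or.inl (Or.inl he)) (fun i => Or.inr ?_) fun i => ?_)
  · simp only [List.mem_singleton, forall_eq]
    exact ⟨h.adj m, hzc _ (Or.inl rfl), hzc _ (Or.inr rfl)⟩
  · simp
  · simp only [List.mem_cons, List.not_mem_nil, or_false]
    rintro p (rfl | rfl | rfl | rfl | rfl | rfl)
    exacts [⟨h.spoke _, hxA⟩, ⟨h.spoke _, hyA⟩, ⟨h.adj _, hcyc _ _ h₁⟩, ⟨h.adj _, hcyc _ _ h₂⟩,
      ⟨h.adj _, hcyc _ _ h₃⟩, ⟨h.adj _, hcyc _ _ h₄⟩]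
  · have hidx : ∀ i : Fin 5, i ≠ i + 2 ∧ i ≠ i + 2 + 1 ∧ i + 2 ≠ i + 1 ∧ i + 2 + 1 ≠ i - 1 := by
      decide
    have n₁ : ¬ Near G s(c m, d m) s(c (m + 2), c (m + 2 + 1)) := by
      obtain ⟨i₁, i₂, i₃, i₄⟩ := hidx m
      exact h.not_near_spoke i₁ i₂ i₃ i₄
    have n₂ : ¬ Near G s(c (m + 1), d (m + 1)) s(c (m + 3), c (m + 3 + 1)) := by
      obtain ⟨i₁, i₂, i₃, i₄⟩ := hidx (m + 1)
      rw [show m + 1 + 2 = m + 3 by rw [add_assoc]; rfl] at i₁ i₂ i₃ i₄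
      exact h.not_near_spoke i₁ i₂ i₃ i₄
    simp only [List.nodup_cons, List.mem_cons, List.not_mem_nil, or_false, not_or] at hnd hxk hyk
    simp only [List.pairwise_cons, List.mem_cons, List.not_mem_nil, or_false, forall_eq_or_imp,
      forall_eq]
    tauto
  · have hall : ∀ i m : Fin 5, i = m ∨ i = m + 1 ∨ i = m + 2 ∨ i = m + 3 ∨ i = m + 4 := by
      decide
    rcases hall i m with rfl | rfl | rfl | rfl | rfl <;> simp
  · by_cases h1 : i = m
    · subst h1
      exact Or.inr (by simp)
    by_cases h2 : i = m + 1
    · subst h2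
      exact Or.inr (by simp)
    · exact Or.inl (Or.inr ⟨i, h1, h2, rfl⟩)

lemma MinCounter.no_pentagon (hG : MinCounter V G) {c : Fin 5 → V} (hc : c.Injective)
    (hadj : ∀ i, G.Adj (c i) (c (i + 1))) : False := by
  have hcase : ∀ i j : Fin 5, j = i ∨ j = i - 1 ∨ j = i + 1 ∨ j = i + 1 + 1 ∨ i = j + 1 + 1 := by
    decide
  have hne : ∀ i : Fin 5, i ≠ i + 1 + 1 := by decide
  have hchord : ∀ i j, G.Adj (c i) (c j) → j = i - 1 ∨ j = i + 1 := by
    intro i j hij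
    rcases hcase i j with rfl | hj | hj | rfl | rfl
    · exact (hij.ne rfl).elim
    · exact Or.inl hj
    · exact Or.inr hj
    · exact (hG.no_triangle (hadj _) (hadj _) hij).elim
    · exact (hG.no_triangle (hadj _) (hadj _) hij.symm).elim
  obtain ⟨d, hd⟩ := hG.exists_spiked hc hadj (by decide) hchord (by
    intro i j z hij hi hj
    by_contra! hn
    rcases hcase i j with rfl | rfl | rfl | rfl | rfl
    · exact hij rfl
    · have := hadj (i - 1)
      rw [sub_add_cancel] at this
      exact hG.no_triangle this hi hj
    · exact hG.no_triangle (hadj i) hj hi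
    · exact hG.no_quad (hadj i) (hadj (i + 1)) hj hi.symm (fun h => hne _ (hc h)) (hn _).symm
    · exact hG.no_quad (hadj j) (hadj (j + 1)) hi hj.symm (fun h => hne _ (hc h)) (hn _).symm)
  exact hd.false_of_pentagon hG

end Pentagons

section Hexagons
open Classical

variable {V : Type} [Finite V] {G : SimpleGraph V}

lemma MinCounter.no_five_cycle (hG : MinCounter V G) {a b c d e : V} (hab : G.Adj a b)
    (hbc : G.Adj b c) (hcd : G.Adj c d) (hde : G.Adj d e) (hea : G.Adj e a) (hac : a ≠ c)
    (had : a ≠ d) (hbd : b ≠ d) (hbe : b ≠ e) (hce : c ≠ e) : False := by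
  refine hG.no_pentagon (c := ![a, b, c, d, e]) ?_ ?_
  · have := hab.ne
    have := hbc.ne
    have := hcd.ne
    have := hde.ne
    have := hea.ne
    intro i j hij
    fin_cases i <;> fin_cases j <;> simp_all
  · intro i
    fin_cases i
    exacts [hab, hbc, hcd, hde, hea]

lemma Spiked.not_near_cycle {n : ℕ} [NeZero n] {c d : Fin n → V} (h : Spiked G c d) {i j : Fin n}
    (h₀ : j ≠ i) (h₁ : j ≠ i + 1) (h₂ : i ≠ j + 1) (h₃ : j ≠ i + 1 + 1) (h₄ : i ≠ j + 1 + 1) :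
    ¬ Near G s(c i, c (i + 1)) s(c j, c (j + 1)) := by
  have key : ∀ k l : Fin n, c k = c l ∨ G.Adj (c k) (c l) → k = l ∨ k = l + 1 ∨ l = k + 1 := by
    rintro k l (h' | h')
    · exact Or.inl (h.inj h')
    · rcases h.adj_cycle h' with rfl | h'
      · exact Or.inr (Or.inl (sub_add_cancel _ _).symm)
      · exact Or.inr (Or.inr h')
  rw [near_mk]
  rintro (h' | h' | h' | h') <;> rcases key _ _ h' with h' | h' | h'
  exacts [h₀ h'.symm, h₂ h', h₁ h', h₂ h', h₄ h', h₀ (add_right_cancel h'), h₁ h'.symm,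
    h₀ (add_right_cancel h').symm, h₃ h', h₀ (add_right_cancel h').symm,
    h₂ (add_right_cancel h'), h₁ (add_right_cancel h')]

lemma Spiked.false_of_hexagon (hG : MinCounter V G) {c d : Fin 6 → V} (h : Spiked G c d) :
    False := by
  obtain ⟨f, hf, hz⟩ := hG.color_avoid (X := Set.range c) ⟨0, rfl⟩ (h.adj 0)
  replace hz : ∀ i, ¬ HasZero (avoid G (Set.range c)).edgeSet f (d i) := fun i =>
    hz _ (h.notMem i) (c i) ⟨i, rfl⟩ (h.spoke i).symm
  have hK : ∀ i, (K (avoid G (Set.range c)).edgeSet f (d i)).card ≤ 2 := fun i =>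
    hG.card_K_avoid f ⟨i, rfl⟩ (h.spoke i).symm
  obtain ⟨k, hk, hkne⟩ := hexagon_choice fun i => card_lst_union (hK i) (hK (i + 1))
  refine h.false_of_cycle hG hf hz k hk fun i j hij => (hkne i j hij).imp_right ?_
  rintro rfl
  have hidx : ∀ i : Fin 6, i + 3 ≠ i ∧ i + 3 ≠ i + 1 ∧ i ≠ i + 3 + 1 ∧ i + 3 ≠ i + 1 + 1 ∧
      i ≠ i + 3 + 1 + 1 := by
    decide
  obtain ⟨i₁, i₂, i₃, i₄, i₅⟩ := hidx i
  exact h.not_near_cycle i₁ i₂ i₃ i₄ i₅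

lemma MinCounter.no_hexagon (hG : MinCounter V G) {c : Fin 6 → V} (hc : c.Injective)
    (hadj : ∀ i, G.Adj (c i) (c (i + 1))) : False := by
  have hcase : ∀ i j : Fin 6, j = i ∨ j = i - 1 ∨ j = i + 1 ∨ j = i + 1 + 1 ∨ i = j + 1 + 1 ∨
      j = i + 1 + 1 + 1 := by
    decide
  have hne₂ : ∀ i : Fin 6, i ≠ i + 1 + 1 := by decide
  have hne₃ : ∀ i : Fin 6, i ≠ i + 1 + 1 + 1 := by decide
  have hchord : ∀ i j, G.Adj (c i) (c j) → j = i - 1 ∨ j = i + 1 := by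
    intro i j hij
    rcases hcase i j with rfl | hj | hj | rfl | rfl | rfl
    · exact (hij.ne rfl).elim
    · exact Or.inl hj
    · exact Or.inr hj
    · exact (hG.no_triangle (hadj _) (hadj _) hij).elim
    · exact (hG.no_triangle (hadj _) (hadj _) hij.symm).elim
    · exact (hG.no_quad (hadj _) (hadj _) (hadj _) hij.symm (fun h => hne₂ _ (hc h))
        (fun h => hne₂ _ (hc h))).elim
  obtain ⟨d, hd⟩ := hG.exists_spiked hc hadj (by decide) hchord (by
    intro i j z hij hi hj
    by_contra! hn
    rcases hcase i j with rfl | rfl | rfl | rfl | rfl | rfl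
    · exact hij rfl
    · have := hadj (i - 1)
      rw [sub_add_cancel] at this
      exact hG.no_triangle this hi hj
    · exact hG.no_triangle (hadj i) hj hi
    · exact hG.no_quad (hadj i) (hadj (i + 1)) hj hi.symm (fun h => hne₂ _ (hc h)) (hn _).symm
    · exact hG.no_quad (hadj j) (hadj (j + 1)) hi hj.symm (fun h => hne₂ _ (hc h)) (hn _).symm
    · exact hG.no_five_cycle (hadj i) (hadj _) (hadj _) hj hi.symm (fun h => hne₂ _ (hc h))
        (fun h => hne₃ _ (hc h)) (fun h => hne₂ _ (hc h)) (hn _).symm (hn _).symm)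
  exact hd.false_of_hexagon hG

end Hexagons

section Conclusion
open Classical

variable {V : Type} [Finite V] {G : SimpleGraph V}

lemma exists_injective_of_isCycle {v : V} {w : G.Walk v v} (hw : w.IsCycle) {n : ℕ} [NeZero n]
    (hn : w.length = n) (h1 : 1 < n) :
    ∃ c : Fin n → V, c.Injective ∧ ∀ i, G.Adj (c i) (c (i + 1)) := by
  refine ⟨fun i => w.getVert i, fun i j hij => ?_, fun i => ?_⟩
  · have h := hw.getVert_injOn' (x₁ := i) (x₂ := j)
    refine Fin.ext (h ?_ ?_ hij) <;> simp only [Set.mem_ofPred_eq] <;> omega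
  · have hi : (i : ℕ) < w.length := by omega
    have h := w.adj_getVert_succ hi
    by_cases hlast : (i : ℕ) + 1 < n
    · have : ((i + 1 : Fin n) : ℕ) = i + 1 := by
        rw [Fin.val_add, Fin.val_one', Nat.mod_eq_of_lt h1, Nat.mod_eq_of_lt hlast]
      simpa only [this] using h
    · have hi' : (i : ℕ) + 1 = w.length := by omega
      have : ((i + 1 : Fin n) : ℕ) = 0 := by
        rw [Fin.val_add, Fin.val_one', Nat.mod_eq_of_lt h1, hi', hn, Nat.mod_self]
      rw [hi', w.getVert_length] at h
      simpa only [this, w.getVert_zero] using h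

lemma MinCounter.seven_le_length (hG : MinCounter V G) {v : V} {w : G.Walk v v}
    (hw : w.IsCycle) : 7 ≤ w.length := by
  by_contra! hlt
  have h3 := hw.three_le_length
  obtain h | h | h | h : w.length = 3 ∨ w.length = 4 ∨ w.length = 5 ∨ w.length = 6 := by omega
  all_goals obtain ⟨c, hc, hadj⟩ := exists_injective_of_isCycle hw h (by norm_num)
  · exact hG.no_triangle (hadj 0) (hadj 1) (hadj 2).symm
  · exact hG.no_quad (hadj 0) (hadj 1) (hadj 2) (hadj 3) (hc.ne (by decide)) (hc.ne (by decide))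
  · exact hG.no_pentagon hc hadj
  · exact hG.no_hexagon hc hadj

lemma MinCounter.nonempty (hG : MinCounter V G) : Nonempty V := by
  by_contra hV
  rw [not_nonempty_iff] at hV
  exact hG.2.1 ⟨fun _ => 0, ⟨fun a => isEmptyElim a, fun a => isEmptyElim a⟩,
    fun a => isEmptyElim a⟩

lemma MinCounter.ten_le_card (hG : MinCounter V G) : 10 ≤ Nat.card V := by
  obtain ⟨v⟩ := hG.nonempty
  have := Fintype.ofFinite V
  have hdeg : ∀ x, (G.neighborFinset x).card = 3 := fun x => by
    rw [card_neighborFinset_eq_degree, ← hG.cubic x, Set.ncard_eq_toFinset_card',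
      ← card_neighborFinset_eq_degree]
    rfl
  set N := G.neighborFinset v with hN
  set M := N.biUnion fun x => (G.neighborFinset x).erase v with hM
  have hMc : M.card = 6 := by
    rw [hM, Finset.card_biUnion, Finset.sum_congr rfl (g := fun _ => 2), Finset.sum_const, hdeg]
    · rfl
    · intro x hx
      rw [Finset.card_erase_of_mem, hdeg]
      rw [mem_neighborFinset]
      exact ((mem_neighborFinset ..).1 hx).symm
    · intro x hx y hy hxy
      refine Finset.disjoint_left.2 fun z hzx hzy => ?_
      simp only [hN, Finset.mem_coe, Finset.mem_erase, mem_neighborFinset] at hx hy hzx hzy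
      exact hG.no_quad hx hzx.2 hzy.2.symm hy.symm hzx.1.symm hxy
  have hNM : Disjoint N M := by
    rw [Finset.disjoint_left]
    intro z hz hz'
    obtain ⟨x, hx, hxz⟩ := Finset.mem_biUnion.1 hz'
    simp only [hN, Finset.mem_erase, mem_neighborFinset] at hx hz hxz
    exact hG.no_triangle hx hxz.2 hz
  have hv : v ∉ N ∪ M := by
    simp [hN, hM]
  have := Finset.card_le_univ (insert v (N ∪ M))
  rw [Finset.card_insert_of_notMem hv, Finset.card_union_of_disjoint hNM, hdeg, hMc] at this
  rwa [Nat.card_eq_fintype_card]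

end Conclusion

/-- A minimal counterexample is 3-regular, has at least 10 vertices, has girth at least 7,
has no cut-edge, and has no edge-cut of size two. -/
theorem minCounter_structure {V : Type} [Finite V] (G : SimpleGraph V)
    (hG : MinCounter V G) :
    (∀ v : V, (G.neighborSet v).ncard = 3) ∧
    10 ≤ Nat.card V ∧
    (∀ (v : V) (w : G.Walk v v), w.IsCycle → 7 ≤ w.length) ∧
    (∀ e : Sym2 V, ¬G.IsBridge e) ∧
    (∀ e₁ e₂ : Sym2 V, e₁ ∈ G.edgeSet → e₂ ∈ G.edgeSet → e₁ ≠ e₂ →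
      ∀ u v : V, G.Reachable u v → (G.deleteEdges {e₁, e₂}).Reachable u v) := by
  exact ⟨hG.cubic, hG.ten_le_card, fun _ _ hw => hG.seven_le_length hw, hG.not_isBridge,
    fun _ _ _ _ _ u v _ => hG.reachable_deleteEdges_pair u v⟩
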